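/- arXiv:math/0508305 — 2 statements merged into one kernel-verified Lean document; each statement's English description precedes it below -/
import Mathlib

section
/- Let Z be an abelian von Neumann algebra (countably decomposable) and M = Z ⊗ M_n(ℂ). If A is a maximal abelian self-adjoint subalgebra of M, then M is generated by the normalizer of A; that is, A is regular in M. -/
namespace RegMasa

variable {ℋ : Type*} [NormedAddCommGroup ℋ] [InnerProductSpace ℂ ℋ] [CompleteSpace ℋ]

/-- projection onto the joint kernel of a family -/
lemma exists_kerproj (B : Set (ℋ →L[ℂ] ℋ)) :
    ∃ P : ℋ →L[ℂ] ℋ, star P = P ∧ P * P = P ∧ (∀ b ∈ B, b * P = 0) ∧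
      (∀ y, (∀ b ∈ B, b * y = 0) → P * y = y) ∧
      ∀ T, (∀ b ∈ B, b * T = T * b) → (∀ b ∈ B, b * star T = star T * b) → T * P = P * T := by
  let K : Submodule ℂ ℋ := ⨅ b ∈ B, (LinearMap.ker (b : ℋ →ₗ[ℂ] ℋ))
  have memK : ∀ x, x ∈ K ↔ ∀ b ∈ B, b x = 0 := by
    intro x
    simp [K, Submodule.mem_iInf]
  have hKc : IsClosed (K : Set ℋ) := by
    have : (K : Set ℋ) = ⋂ b ∈ B, {x | b x = 0} := by
      ext x
      simp only [SetLike.mem_coe, memK, Set.mem_iInter, Set.mem_ofPred_eq]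
    rw [this]
    exact isClosed_biInter fun b _ => isClosed_eq b.continuous continuous_const
  have : CompleteSpace K := hKc.completeSpace_coe
  have hs : star K.starProjection = K.starProjection := isSelfAdjoint_starProjection K
  have hi : K.starProjection * K.starProjection = K.starProjection := K.isIdempotentElem_starProjection
  have hinv : ∀ T : ℋ →L[ℂ] ℋ, (∀ b ∈ B, b * T = T * b) →
      K.starProjection * T * K.starProjection = T * K.starProjection := by
    intro T hT
    ext x
    change K.starProjection (T (K.starProjection x)) = T (K.starProjection x)
    rw [Submodule.starProjection_eq_self_iff, memK]
    intro b hb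
    have h1 := DFunLike.congr_fun (hT b hb) (K.starProjection x)
    have h2 : b (K.starProjection x) = 0 := (memK _).1 (K.starProjection_apply_mem x) b hb
    change b (T _) = T (b _) at h1
    rw [h1, h2, map_zero]
  refine ⟨K.starProjection, hs, hi, ?_, ?_, ?_⟩
  · intro b hb
    ext x
    exact (memK _).1 (K.starProjection_apply_mem x) b hb
  · intro y hy
    ext x
    change K.starProjection (y x) = y x
    rw [Submodule.starProjection_eq_self_iff, memK]
    intro b hb
    exact DFunLike.congr_fun (hy b hb) x
  · intro T h1 h2
    have e1 := hinv T h1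
    have e2 := congrArg star (hinv _ h2)
    simp only [star_mul, star_star, hs] at e2
    exact e1.symm.trans ((mul_assoc _ _ _).trans e2)

lemma star_mul_self_eq_zero' (c : ℋ →L[ℂ] ℋ) (h : star c * c = 0) : c = 0 :=
  (CStarRing.star_mul_self_eq_zero_iff c).1 h

lemma exists_sqrt (s : ℋ →L[ℂ] ℋ) (hs : 0 ≤ s) :
    ∃ h : ℋ →L[ℂ] ℋ, star h = h ∧ h * h = s ∧ (∃ c, h = star c * c) ∧
      ∀ T, s * T = T * s → h * T = T * h := by
  refine ⟨CFC.sqrt s, (CFC.sqrt_nonneg s).isSelfAdjoint, CFC.sqrt_mul_sqrt_self s hs,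
    CStarAlgebra.nonneg_iff_eq_star_mul_self.1 (CFC.sqrt_nonneg s), ?_⟩
  intro T hT
  exact (Commute.cfcₙ_nnreal (a := s) (b := T) hT _)

lemma exists_abs (s : ℋ →L[ℂ] ℋ) (hs : star s = s) :
    ∃ h : ℋ →L[ℂ] ℋ, star h = h ∧ h * h = s * s ∧ (∃ c, h = star c * c) ∧
      ∀ T, s * s * T = T * (s * s) → h * T = T * h := by
  apply exists_sqrt
  nth_rewrite 1 [← hs]
  exact star_mul_self_nonneg s

/-- a selfadjoint contraction is the half sum of a unitary and its adjoint -/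
lemma exists_unitary (a : ℋ →L[ℂ] ℋ) (ha : star a = a) (hn : ‖a‖ ≤ 1) :
    ∃ u ∈ unitary (ℋ →L[ℂ] ℋ), u + star u = (2 : ℂ) • a ∧
      ∀ T, a * T = T * a → u * T = T * u := by
  refine ⟨selfAdjoint.unitarySelfAddISMul ⟨a, ha⟩ hn, Subtype.property _, ?_, ?_⟩
  · have := selfAdjoint.star_coe_unitarySelfAddISMul ⟨a, ha⟩ hn
    rw [this]
    change (a + Complex.I • CFC.sqrt (1 - a ^ 2)) + (a - Complex.I • CFC.sqrt (1 - a ^ 2)) = _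
    rw [two_smul]; abel
  · intro T hT
    change (a + Complex.I • CFC.sqrt (1 - a ^ 2)) * T = T * (a + Complex.I • CFC.sqrt (1 - a ^ 2))
    have h1 : Commute (1 - a ^ 2) T := by
      have : Commute a T := hT
      exact (Commute.one_left T).sub_left (this.pow_left 2)
    have h2 : Commute (CFC.sqrt (1 - a ^ 2)) T := Commute.cfcₙ_nnreal h1 _
    rw [add_mul, mul_add, hT, smul_mul_assoc, mul_smul_comm, h2.eq]

lemma trace_idem_field {K : Type*} [Field K] {n : ℕ} (P : Matrix (Fin n) (Fin n) K)
    (h : P * P = P) : ∃ k ≤ n, P.trace = (k : K) := by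
  have hi : IsIdempotentElem (Matrix.toLin' P) := by
    rw [IsIdempotentElem, Module.End.mul_eq_comp, ← Matrix.toLin'_mul, h]
  have := (LinearMap.IsIdempotentElem.isProj_range _ hi).trace
  rw [Matrix.trace_toLin'_eq] at this
  refine ⟨_, ?_, this⟩
  simpa using Submodule.finrank_le (LinearMap.range (Matrix.toLin' P))

lemma trace_idem {R : Type*} [CommRing R] [IsReduced R] {n : ℕ} (P : Matrix (Fin n) (Fin n) R)
    (h : P * P = P) : ∏ k ∈ Finset.range (n + 1), (P.trace - (k : R)) = 0 := by
  apply IsNilpotent.eq_zero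
  rw [nilpotent_iff_mem_prime]
  intro J hJ
  rw [← Ideal.Quotient.eq_zero_iff_mem]
  apply IsFractionRing.injective (R ⧸ J) (FractionRing (R ⧸ J))
  let f : R →+* FractionRing (R ⧸ J) := (algebraMap (R ⧸ J) _).comp (Ideal.Quotient.mk J)
  change f _ = algebraMap (R ⧸ J) _ 0
  rw [map_zero, map_prod]
  obtain ⟨k, hk, hk'⟩ := trace_idem_field (f.mapMatrix P) (by rw [← map_mul, h])
  apply Finset.prod_eq_zero (i := k) (by simp; omega)
  have : f P.trace = (f.mapMatrix P).trace := by
    simp [Matrix.trace]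
  rw [map_sub, this, hk', map_natCast, sub_self]

structure Ctx (M Z A : Subalgebra ℂ (ℋ →L[ℂ] ℋ)) {n : ℕ} (e : Fin n → Fin n → (ℋ →L[ℂ] ℋ)) :
    Prop where
  M_cc : ∀ x, (∀ T, (∀ m ∈ M, m * T = T * m) → T * x = x * T) → x ∈ M
  M_star : ∀ x ∈ M, star x ∈ M
  Z_cc : ∀ x, (∀ T, (∀ m ∈ Z, m * T = T * m) → T * x = x * T) → x ∈ Z
  Z_star : ∀ x ∈ Z, star x ∈ Z
  Z_le : ∀ x ∈ Z, x ∈ M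
  Z_comm : ∀ x ∈ Z, ∀ y ∈ Z, x * y = y * x
  he : ∀ i j, e i j ∈ M
  hesum : ∑ i, e i i = 1
  hestar : ∀ i j, star (e i j) = e j i
  hemul : ∀ i j k l, e i j * e k l = if j = k then e i l else 0
  hZe : ∀ z ∈ Z, ∀ i j, z * e i j = e i j * z
  gen : ∀ T, (∀ z ∈ Z, z * T = T * z) → (∀ i j, e i j * T = T * e i j) → ∀ m ∈ M, m * T = T * m
  A_le : ∀ x ∈ A, x ∈ M
  A_star : ∀ x ∈ A, star x ∈ A
  A_comm : ∀ x ∈ A, ∀ y ∈ A, x * y = y * x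
  A_max : ∀ x ∈ M, (∀ a ∈ A, a * x = x * a) → x ∈ A

/-- matrix entries -/
noncomputable def ent {n : ℕ} (e : Fin n → Fin n → (ℋ →L[ℂ] ℋ)) (i j : Fin n)
    (x : ℋ →L[ℂ] ℋ) : ℋ →L[ℂ] ℋ := ∑ l, e l i * x * e j l

/-- center valued trace -/
noncomputable def tau {n : ℕ} (e : Fin n → Fin n → (ℋ →L[ℂ] ℋ))
    (x : ℋ →L[ℂ] ℋ) : ℋ →L[ℂ] ℋ := ∑ i, ent e i i x

namespace Ctx

variable {M Z A : Subalgebra ℂ (ℋ →L[ℂ] ℋ)} {n : ℕ} {e : Fin n → Fin n → (ℋ →L[ℂ] ℋ)}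

lemma Z_central (c : Ctx M Z A e) {z m} (hz : z ∈ Z) (hm : m ∈ M) : z * m = m * z :=
  (c.gen z (fun w hw => c.Z_comm w hw z hz) (fun i j => (c.hZe z hz i j).symm) m hm).symm

lemma Z_A (c : Ctx M Z A e) {z} (hz : z ∈ Z) : z ∈ A :=
  c.A_max z (c.Z_le z hz) fun a ha => (c.Z_central hz (c.A_le a ha)).symm

lemma ent_comm (c : Ctx M Z A e) (i j a b : Fin n) (x) :
    e a b * ent e i j x = ent e i j x * e a b := by
  simp only [ent, Finset.mul_sum, Finset.sum_mul]
  have h1 : ∀ l, e a b * (e l i * x * e j l) = if b = l then e a i * x * e j l else 0 := by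
    intro l
    rw [← mul_assoc, ← mul_assoc, c.hemul]
    split_ifs <;> simp
  have h2 : ∀ l, (e l i * x * e j l) * e a b = if l = a then e l i * x * e j b else 0 := by
    intro l
    rw [mul_assoc, c.hemul]
    split_ifs <;> simp
  simp [h1, h2]

lemma ent_mem (c : Ctx M Z A e) (i j : Fin n) {x} (hx : x ∈ M) : ent e i j x ∈ M :=
  sum_mem fun l _ => mul_mem (mul_mem (c.he l i) hx) (c.he j l)

lemma ent_sum (c : Ctx M Z A e) (x) : ∑ i, ∑ j, ent e i j x * e i j = x := by
  have h : ∀ i j, ent e i j x * e i j = e i i * x * e j j := by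
    intro i j
    have h2 : ∀ l, (e l i * x * e j l) * e i j = if l = i then e l i * x * e j j else 0 := by
      intro l
      rw [mul_assoc, c.hemul]
      split_ifs <;> simp
    simp [ent, Finset.sum_mul, h2]
  simp only [h]
  simp only [← Finset.mul_sum, ← Finset.sum_mul, c.hesum, one_mul, mul_one]

lemma ent_Z (c : Ctx M Z A e) (i j : Fin n) {x} (hx : x ∈ M) : ent e i j x ∈ Z := by
  apply c.Z_cc
  intro S hS
  have key : ∀ a b, ent e i j x * ent e a b S = ent e a b S * ent e i j x := by
    intro a b
    apply c.gen _ _ (fun k l => c.ent_comm a b k l S) _ (c.ent_mem i j hx)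
    intro z hz
    simp only [ent, Finset.mul_sum, Finset.sum_mul]
    refine Finset.sum_congr rfl fun l _ => ?_
    rw [← mul_assoc, ← mul_assoc, c.hZe z hz, mul_assoc (e l a), hS z hz, mul_assoc, mul_assoc,
      mul_assoc, c.hZe z hz, mul_assoc]
  have h := c.ent_sum S
  rw [← h]
  simp only [Finset.mul_sum, Finset.sum_mul]
  refine Finset.sum_congr rfl fun a _ => Finset.sum_congr rfl fun b _ => ?_
  rw [mul_assoc, c.ent_comm, ← mul_assoc, ← key, mul_assoc]

lemma ent_mul (c : Ctx M Z A e) (i j : Fin n) (x y) :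
    ∑ k, ent e i k x * ent e k j y = ent e i j (x * y) := by
  have h1 : ∀ k, ent e i k x * ent e k j y = ∑ l, e l i * x * (e k k * (y * e j l)) := by
    intro k
    simp only [ent, Finset.mul_sum, Finset.sum_mul]
    have h2 : ∀ l m, (e l i * x * e k l) * (e m k * y * e j m) =
        if l = m then e l i * x * (e k k * (y * e j m)) else 0 := by
      intro l m
      have : (e l i * x * e k l) * (e m k * y * e j m) =
        e l i * x * (e k l * e m k * (y * e j m)) := by simp only [mul_assoc]
      rw [this, c.hemul]
      split_ifs <;> simp
    simp [h2]
  simp only [h1]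
  rw [Finset.sum_comm]
  simp only [← Finset.mul_sum, ← Finset.sum_mul, c.hesum, one_mul, ent, mul_assoc]

lemma tau_Z (c : Ctx M Z A e) {x} (hx : x ∈ M) : tau e x ∈ Z :=
  sum_mem fun i _ => c.ent_Z i i hx

lemma tau_mul (c : Ctx M Z A e) {z} (hz : z ∈ Z) (x) : tau e (x * z) = tau e x * z := by
  simp only [tau, ent, Finset.sum_mul]
  refine Finset.sum_congr rfl fun a _ => Finset.sum_congr rfl fun b _ => ?_
  rw [mul_assoc, mul_assoc x, c.hZe z hz]; simp only [mul_assoc]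

lemma tau_add (x y) : tau e (x + y) = tau e x + tau e y := by
  simp only [tau, ent, mul_add, add_mul, Finset.sum_add_distrib]

lemma tau_sub (x y) : tau e (x - y) = tau e x - tau e y := by
  simp only [tau, ent, mul_sub, sub_mul, Finset.sum_sub_distrib]

lemma tau_star (c : Ctx M Z A e) (x) : tau e (star x) = star (tau e x) := by
  simp only [tau, ent, star_sum, star_mul, c.hestar, mul_assoc]

lemma tau_faithful (c : Ctx M Z A e) (x)
    (h : ∀ v, RCLike.re (inner ℂ v (tau e (star x * x) v)) ≤ 0) : x = 0 := by
  have h1 : ∀ v, inner ℂ v (tau e (star x * x) v) =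
      ∑ i, ∑ l, inner ℂ (x (e i l v)) (x (e i l v)) := by
    intro v
    simp only [tau, ent, sum_apply, inner_sum]
    refine Finset.sum_congr rfl fun i _ => Finset.sum_congr rfl fun l _ => ?_
    have : e l i * (star x * x) * e i l = star (x * e i l) * (x * e i l) := by
      rw [star_mul, c.hestar]; simp only [mul_assoc]
    rw [this]
    exact ContinuousLinearMap.adjoint_inner_right (x * e i l) v ((x * e i l) v)
  have h2 : ∀ v i l, x (e i l v) = 0 := by
    intro v
    have h3 := h v
    rw [h1] at h3
    simp only [map_sum, ← norm_sq_eq_re_inner] at h3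
    have h4 : ∑ i, ∑ l, ‖x (e i l v)‖ ^ 2 = 0 :=
      le_antisymm h3 (Finset.sum_nonneg fun i _ => Finset.sum_nonneg fun l _ => by positivity)
    intro i l
    rw [Finset.sum_eq_zero_iff_of_nonneg (fun i _ => Finset.sum_nonneg fun l _ => by positivity)]
      at h4
    have h5 := h4 i (Finset.mem_univ _)
    rw [Finset.sum_eq_zero_iff_of_nonneg (fun l _ => by positivity)] at h5
    have h6 := h5 l (Finset.mem_univ _)
    simpa using h6
  have h3 : ∀ i, x * e i i = 0 := fun i => by ext v; exact h2 v i i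
  rw [← mul_one x, ← c.hesum, Finset.mul_sum]
  exact Finset.sum_eq_zero fun i _ => h3 i

lemma tau_faithful0 (c : Ctx M Z A e) (x) (h : tau e (star x * x) = 0) : x = 0 :=
  c.tau_faithful x fun v => by simp [h]

lemma tau_idem (c : Ctx M Z A e) {r} (hr : r ∈ M) (hrr : r * r = r) :
    ∃ f : ℕ → ℋ →L[ℂ] ℋ, f 0 = 1 ∧ (∀ k, f (k + 1) = f k * (tau e r - (k : ℂ) • 1)) ∧
      f (n + 1) = 0 := by
  let _ : CommRing Z := { (inferInstance : Ring Z) with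
    mul_comm := fun a b => Subtype.ext (c.Z_comm a a.2 b b.2) }
  have : IsReduced Z := by
    rw [isReduced_iff_pow_one_lt 2 (by norm_num)]
    intro z hz
    have hz0 : (z : ℋ →L[ℂ] ℋ) * z = 0 := by
      have := congrArg (Subtype.val) hz
      rw [pow_two] at this
      exact this
    apply Subtype.ext
    change (z : ℋ →L[ℂ] ℋ) = 0
    apply star_mul_self_eq_zero'
    apply star_mul_self_eq_zero'
    rw [star_mul, star_star]
    have hc := c.Z_comm _ (c.Z_star _ z.2) _ z.2
    calc star (z : ℋ →L[ℂ] ℋ) * z * (star (z : ℋ →L[ℂ] ℋ) * z)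
        = star (z : ℋ →L[ℂ] ℋ) * (z * star (z : ℋ →L[ℂ] ℋ)) * z := by simp only [mul_assoc]
      _ = star (z : ℋ →L[ℂ] ℋ) * star (z : ℋ →L[ℂ] ℋ) * (z * z) := by
        rw [← hc]; simp only [mul_assoc]
      _ = 0 := by rw [hz0, mul_zero]
  let P : Matrix (Fin n) (Fin n) Z := fun i j => ⟨ent e i j r, c.ent_Z i j hr⟩
  have hP : P * P = P := by
    ext1 i j
    apply Subtype.ext
    rw [Matrix.mul_apply]
    have := c.ent_mul i j r r
    rw [hrr] at this
    change Z.subtype _ = _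
    rw [map_sum]
    exact this
  have ht := trace_idem P hP
  have htr : ((P.trace : Z) : ℋ →L[ℂ] ℋ) = tau e r := by
    change Z.subtype _ = _
    rw [Matrix.trace, map_sum]
    rfl
  refine ⟨fun m => ((∏ k ∈ Finset.range m, (P.trace - (k : Z)) : Z) : ℋ →L[ℂ] ℋ), ?_, ?_, ?_⟩
  · rfl
  · intro k
    simp only [Finset.prod_range_succ]
    rw [← htr]
    change _ * _ = _ * _
    congr 1
    change ((P.trace : Z) : ℋ →L[ℂ] ℋ) - (((k : ℕ) : Z) : ℋ →L[ℂ] ℋ) = _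
    congr 1
    have hk : (((k : ℕ) : Z) : ℋ →L[ℂ] ℋ) = ((k : ℕ) : ℋ →L[ℂ] ℋ) := rfl
    rw [hk, ← nsmul_one, Nat.cast_smul_eq_nsmul ℂ]
  · simp only [ht]; rfl

/-- projections in `Z` onto eigenspaces of the trace -/
lemma spec (c : Ctx M Z A e) {r} (hr : r ∈ M) (hrr : r * r = r) (hrs : star r = r) :
    ∃ z : ℕ → ℋ →L[ℂ] ℋ, (∀ j, z j ∈ Z ∧ star (z j) = z j ∧ z j * z j = z j ∧
      tau e r * z j = (j : ℂ) • z j) ∧ ∀ y ∈ M, (∀ j, y * z j = 0) → y = 0 := by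
  obtain ⟨f, hf0, hf, hfn⟩ := c.tau_idem hr hrr
  have ht : tau e r ∈ Z := c.tau_Z hr
  have hts : star (tau e r) = tau e r := by rw [← c.tau_star, hrs]
  have hex : ∀ j : ℕ, ∃ P : ℋ →L[ℂ] ℋ, (P ∈ Z ∧ star P = P ∧ P * P = P ∧
      tau e r * P = (j : ℂ) • P) ∧ ∀ y, (tau e r - (j : ℂ) • 1) * y = 0 → P * y = y := by
    intro j
    obtain ⟨P, h1, h2, h3, h4, h5⟩ := exists_kerproj {tau e r - (j : ℂ) • (1 : ℋ →L[ℂ] ℋ)}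
    refine ⟨P, ⟨?_, h1, h2, ?_⟩, fun y hy => h4 y (by simpa using hy)⟩
    · apply c.Z_cc
      intro T hT
      have hT1 := hT _ ht
      have hT2 := congrArg star hT1
      simp only [star_mul, hts] at hT2
      apply h5
      · simp [sub_mul, mul_sub, hT1]
      · simp [sub_mul, mul_sub, hT2]
    · have := h3 _ rfl
      rw [sub_mul, sub_eq_zero] at this
      simpa using this
  choose z hz hz' using hex
  refine ⟨z, hz, fun y hy hyz => ?_⟩
  have hfM : ∀ m, f m ∈ Z := by
    intro m
    induction m with
    | zero => rw [hf0]; exact one_mem _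
    | succ m ih => rw [hf]; exact mul_mem ih (sub_mem ht (Z.smul_mem (one_mem _) _))
  have : ∀ m, y * f m = 0 → y = 0 := by
    intro m
    induction m with
    | zero => intro h; simpa [hf0] using h
    | succ m ih =>
      intro h
      apply ih
      have h1 : (tau e r - (m : ℂ) • 1) * (y * f m) = 0 := by
        rw [c.Z_central (sub_mem ht (Z.smul_mem (one_mem _) _)) (mul_mem hy (c.Z_le _ (hfM m))),
          mul_assoc, ← hf, h]
      rw [← hz' m _ h1, ← mul_assoc, c.Z_central (hz m).1 hy, hyz, zero_mul]
  exact this (n + 1) (by rw [hfn, mul_zero])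

lemma kerproj_A (c : Ctx M Z A e) (B : Set (ℋ →L[ℂ] ℋ)) (hB : ∀ b ∈ B, b ∈ A) :
    ∃ P ∈ A, star P = P ∧ P * P = P ∧ (∀ b ∈ B, b * P = 0) ∧
      (∀ y, (∀ b ∈ B, b * y = 0) → P * y = y) := by
  obtain ⟨P, h1, h2, h3, h4, h5⟩ := exists_kerproj B
  refine ⟨P, ?_, h1, h2, h3, h4⟩
  apply c.A_max
  · apply c.M_cc
    intro T hT
    apply h5
    · exact fun b hb => hT b (c.A_le b (hB b hb))
    · intro b hb
      have := congrArg star (hT _ (c.M_star _ (c.A_le b (hB b hb))))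
      simpa using this.symm
  · intro a ha
    apply h5
    · exact fun b hb => c.A_comm b (hB b hb) a ha
    · exact fun b hb => c.A_comm b (hB b hb) _ (c.A_star a ha)

lemma kerproj_M (c : Ctx M Z A e) (b : ℋ →L[ℂ] ℋ) (hb : b ∈ M) :
    ∃ P ∈ M, star P = P ∧ P * P = P ∧ b * P = 0 ∧
      (∀ y, b * y = 0 → P * y = y) ∧
      ∀ T, b * T = T * b → b * star T = star T * b → T * P = P * T := by
  obtain ⟨P, h1, h2, h3, h4, h5⟩ := exists_kerproj {b}
  refine ⟨P, ?_, h1, h2, h3 b rfl, fun y hy => h4 y (by simpa using hy),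
    fun T hT hT' => h5 T (by simpa using hT) (by simpa using hT')⟩
  apply c.M_cc
  intro T hT
  apply h5
  · rintro _ rfl
    exact hT _ hb
  · rintro _ rfl
    have := congrArg star (hT _ (c.M_star _ hb))
    simpa using this.symm

/-- `q` is a piece of `p` of constant trace `k` on its central carrier -/
def Piece (Z A : Subalgebra ℂ (ℋ →L[ℂ] ℋ)) {n : ℕ} (e : Fin n → Fin n → (ℋ →L[ℂ] ℋ))
    (p : ℋ →L[ℂ] ℋ) (k : ℕ) : Prop :=
  ∃ q z : ℋ →L[ℂ] ℋ, q ∈ A ∧ star q = q ∧ q * q = q ∧ q ≠ 0 ∧ p * q = q ∧ z ∈ Z ∧ star z = z ∧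
    z * z = z ∧ q * z = q ∧ tau e q = (k : ℂ) • z

lemma proj_mul_central (c : Ctx M Z A e) {p z} (hp : p ∈ A) (hps : star p = p) (hpp : p * p = p)
    (hz : z ∈ Z) (hzs : star z = z) (hzz : z * z = z) :
    p * z ∈ A ∧ star (p * z) = p * z ∧ p * z * (p * z) = p * z := by
  have hc := c.Z_central hz (c.A_le p hp)
  refine ⟨mul_mem hp (c.Z_A hz), by rw [star_mul, hps, hzs, hc], ?_⟩
  rw [mul_assoc, ← mul_assoc z, hc, mul_assoc, hzz, ← mul_assoc, hpp]

lemma piece_of (c : Ctx M Z A e) {p q z} (hq : q ∈ A) (hqs : star q = q) (hqq : q * q = q)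
    (hpq : p * q = q) (hz : z ∈ Z) (hzs : star z = z) (hzz : z * z = z) {j : ℕ}
    (ht : tau e q * z = (j : ℂ) • z) (h0 : q * z ≠ 0) : Piece Z A e p j := by
  obtain ⟨h1, h2, h3⟩ := c.proj_mul_central hq hqs hqq hz hzs hzz
  refine ⟨q * z, z, h1, h2, h3, h0, by rw [← mul_assoc, hpq], hz, hzs, hzz,
    by rw [mul_assoc, hzz], by rw [c.tau_mul hz, ht]⟩

lemma exists_piece (c : Ctx M Z A e) {p} (hp : p ∈ A) (hps : star p = p) (hpp : p * p = p)
    (hp0 : p ≠ 0) : ∃ j, Piece Z A e p j := by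
  obtain ⟨z, hz, hz'⟩ := c.spec (c.A_le p hp) hpp hps
  have : ∃ j, p * z j ≠ 0 := by
    by_contra! h
    exact hp0 (hz' p (c.A_le p hp) h)
  obtain ⟨j, hj⟩ := this
  obtain ⟨h1, h2, h3, h4⟩ := hz j
  exact ⟨j, c.piece_of hp hps hpp hpp h1 h2 h3 h4 hj⟩

/-- In a minimal piece every projection of `A` is a central cut. -/
lemma minimal_piece (c : Ctx M Z A e) {p} (hp : p ∈ A) (hps : star p = p) (hpp : p * p = p)
    (hp0 : p ≠ 0) : ∃ (k : ℕ) (q z : ℋ →L[ℂ] ℋ), k ≠ 0 ∧ q ∈ A ∧ star q = q ∧ q * q = q ∧ q ≠ 0 ∧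
      p * q = q ∧ z ∈ Z ∧ q * z = q ∧ tau e q = (k : ℂ) • z ∧
      ∀ r ∈ A, star r = r → r * r = r → q * r = r → ∃ w ∈ Z, r = q * w := by
  classical
  have hex := c.exists_piece hp hps hpp hp0
  obtain ⟨q, z, hq, hqs, hqq, hq0, hpq, hz, hzs, hzz, hqz, hqt⟩ := Nat.find_spec hex
  have hmin : ∀ j, Piece Z A e p j → Nat.find hex ≤ j := fun j hj => Nat.find_min' hex hj
  generalize Nat.find hex = k at hqt hmin
  have hk : k ≠ 0 := by
    rintro rfl
    apply hq0
    apply c.tau_faithful0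
    rw [hqs, hqq, hqt]; simp
  refine ⟨k, q, z, hk, hq, hqs, hqq, hq0, hpq, hz, hqz, hqt, ?_⟩
  intro r hr hrs hrr hqr
  obtain ⟨w, hw, hw'⟩ := c.spec (c.A_le r hr) hrr hrs
  have hrq : r * q = r := by rw [c.A_comm r hr q hq, hqr]
  have h0 : r * w 0 = 0 := by
    obtain ⟨h1, h2, h3, h4⟩ := hw 0
    obtain ⟨g1, g2, g3⟩ := c.proj_mul_central hr hrs hrr h1 h2 h3
    apply c.tau_faithful0
    rw [g2, g3, c.tau_mul h1, h4]; simp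
  have hj : ∀ j, j ≠ 0 → r * w j = q * w j := by
    intro j hj
    obtain ⟨h1, h2, h3, h4⟩ := hw j
    by_cases hrw : r * w j = 0
    · have : (j : ℂ) • w j = 0 := by
        rw [← h4, ← c.tau_mul h1, hrw]; simp [tau, ent]
      have hw0 : w j = 0 := by
        rcases smul_eq_zero.1 this with h | h
        · exact absurd (by exact_mod_cast h) hj
        · exact h
      rw [hw0]; simp
    · have hkj : k ≤ j := hmin j (c.piece_of hr hrs hrr (by rw [← hqr, ← mul_assoc, hpq])
        h1 h2 h3 h4 hrw)
      have hrz : r * z = r := by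
        rw [← hrq, mul_assoc, hqz]
      have hzw : z * w j = w j := by
        have e1 : (j : ℂ) • (z * w j) = (j : ℂ) • w j := by
          rw [← h4, ← mul_smul_comm, ← h4, ← mul_assoc, c.Z_comm z hz _ (c.tau_Z (c.A_le r hr)),
            ← c.tau_mul hz, hrz]
        have hj' : (j : ℂ) ≠ 0 := by exact_mod_cast hj
        exact smul_right_injective _ hj' e1
      have hd : (q - r) ∈ A := sub_mem hq hr
      have hds : star (q - r) = q - r := by rw [star_sub, hqs, hrs]
      have hdd : (q - r) * (q - r) = q - r := by
        rw [sub_mul, mul_sub, mul_sub, hqq, hqr, hrq, hrr]; abel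
      obtain ⟨g1, g2, g3⟩ := c.proj_mul_central hd hds hdd h1 h2 h3
      have : (q - r) * w j = 0 := by
        apply c.tau_faithful
        intro v
        have ht : tau e ((q - r) * w j) = ((k : ℂ) - j) • w j := by
          rw [c.tau_mul h1, tau_sub, sub_mul, h4, hqt, smul_mul_assoc, hzw, sub_smul]
        have hin : inner ℂ v (w j v) = inner ℂ (w j v) (w j v) := by
          have h5 : w j v = star (w j) (w j v) := by
            rw [h2]; exact (DFunLike.congr_fun h3 v).symm
          nth_rewrite 1 [h5]
          exact ContinuousLinearMap.adjoint_inner_right (w j) v (w j v)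
        have hcast : ((k : ℂ) - j) = (((k : ℝ) - j : ℝ) : ℂ) := by push_cast; rfl
        rw [g2, g3, ht, smul_apply, inner_smul_right, hin, inner_self_eq_norm_sq_to_K, hcast]
        have hkj' : (k : ℝ) - j ≤ 0 := by
          have : (k : ℝ) ≤ j := by exact_mod_cast hkj
          linarith
        have : RCLike.re ((((k : ℝ) - j : ℝ) : ℂ) * (((‖w j v‖ : ℝ) : ℂ) ^ 2)) =
            ((k : ℝ) - j) * ‖w j v‖ ^ 2 := by
          rw [← Complex.ofReal_pow, ← Complex.ofReal_mul]
          exact Complex.ofReal_re _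
        refine le_of_eq_of_le this ?_
        exact mul_nonpos_of_nonpos_of_nonneg hkj' (by positivity)
      rw [sub_mul, sub_eq_zero] at this
      exact this.symm
  refine ⟨1 - w 0, sub_mem (one_mem _) (hw 0).1, ?_⟩
  rw [← sub_eq_zero]
  apply hw' _ (c.A_le _ (sub_mem hr (mul_mem hq (sub_mem (one_mem _) (c.Z_A (hw 0).1)))))
  intro j
  by_cases hj0 : j = 0
  · subst hj0
    rw [sub_mul, h0, mul_assoc, sub_mul, one_mul, (hw 0).2.2.1]; simp
  · have hww : w 0 * w j = 0 := by
      have e1 : (j : ℂ) • (w 0 * w j) = 0 := by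
        rw [← mul_smul_comm, ← (hw j).2.2.2, ← mul_assoc,
          c.Z_comm _ (hw 0).1 _ (c.tau_Z (c.A_le r hr)), (hw 0).2.2.2]
        simp
      rcases smul_eq_zero.1 e1 with h | h
      · exact absurd (by exact_mod_cast h) hj0
      · exact h
    rw [sub_mul, hj j hj0, mul_assoc, sub_mul, one_mul, hww, sub_zero, sub_self]

/-- abelian projections -/
structure IsAb (M A : Subalgebra ℂ (ℋ →L[ℂ] ℋ)) (q : ℋ →L[ℂ] ℋ) : Prop where
  mem : q ∈ A
  sa : star q = q
  idem : q * q = q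
  ab : ∀ x ∈ M, q * x * q ∈ A

lemma exists_ab (c : Ctx M Z A e) {p} (hp : p ∈ A) (hps : star p = p) (hpp : p * p = p)
    (hp0 : p ≠ 0) : ∃ q, IsAb M A q ∧ q ≠ 0 ∧ p * q = q := by
  obtain ⟨k, q, z, hk, hq, hqs, hqq, hq0, hpq, hz, hqz, hqt, hmin⟩ :=
    c.minimal_piece hp hps hpp hp0
  have hk' : (k : ℂ) ≠ 0 := by exact_mod_cast hk
  refine ⟨q, ⟨hq, hqs, hqq, ?_⟩, hq0, hpq⟩
  -- selfadjoint elements of A q are central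
  have key : ∀ a ∈ A, star a = a → ∃ w ∈ Z, a * q = w * q := by
    intro a ha has
    have haq : a * q ∈ A := mul_mem ha hq
    have hac := c.A_comm a ha q hq
    have htZ : tau e (a * q) ∈ Z := c.tau_Z (c.A_le _ haq)
    have hwZ : (k : ℂ)⁻¹ • tau e (a * q) ∈ Z := Z.smul_mem htZ _
    refine ⟨(k : ℂ)⁻¹ • tau e (a * q), hwZ, ?_⟩
    rw [← sub_eq_zero]
    have hcen : ((k : ℂ)⁻¹ • tau e (a * q)) * q = q * ((k : ℂ)⁻¹ • tau e (a * q)) :=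
      c.Z_central hwZ (c.A_le _ hq)
    have hbA : a * q - ((k : ℂ)⁻¹ • tau e (a * q)) * q ∈ A :=
      sub_mem haq (mul_mem (c.Z_A hwZ) hq)
    have hbs : star (a * q - ((k : ℂ)⁻¹ • tau e (a * q)) * q) =
        a * q - ((k : ℂ)⁻¹ • tau e (a * q)) * q := by
      rw [star_sub, star_mul, star_mul, hqs, has, star_smul, ← c.tau_star, star_mul, hqs, has,
        ← hac, hcen]
      simp
    have hbq : (a * q - ((k : ℂ)⁻¹ • tau e (a * q)) * q) * q =
        a * q - ((k : ℂ)⁻¹ • tau e (a * q)) * q := by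
      rw [sub_mul, mul_assoc, mul_assoc, hqq]
    have hbt : tau e (a * q - ((k : ℂ)⁻¹ • tau e (a * q)) * q) = 0 := by
      rw [tau_sub, hcen, c.tau_mul hwZ, hqt, smul_mul_smul_comm, mul_inv_cancel₀ hk', one_smul,
        c.Z_comm z hz _ htZ, ← c.tau_mul hz, mul_assoc, hqz, sub_self]
    generalize a * q - ((k : ℂ)⁻¹ • tau e (a * q)) * q = b at hbA hbs hbq hbt
    obtain ⟨h, hhs, hhh, ⟨d, hd⟩, hhc⟩ := exists_abs b hbs
    have hhA : h ∈ A := by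
      apply c.A_max
      · apply c.M_cc
        intro T hT
        exact (hhc T (hT _ (c.A_le _ (mul_mem hbA hbA)))).symm
      · intro x hx
        exact (hhc x (c.A_comm _ (mul_mem hbA hbA) x hx)).symm
    have hhq : h * q = h := by
      have : h * (1 - q) = 0 := by
        apply star_mul_self_eq_zero'
        rw [star_mul, hhs, mul_assoc, ← mul_assoc h, hhh, mul_assoc b, mul_sub b, hbq]
        simp
      rw [mul_sub, mul_one, sub_eq_zero] at this
      exact this.symm
    obtain ⟨K, hK, hKs, hKK, hK0, hK1⟩ := c.kerproj_A {h - b}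
      (by rintro _ rfl; exact sub_mem hhA hbA)
    have hK0 := hK0 _ rfl
    have hqK := c.A_comm q hq K hK
    obtain ⟨w, hw, hqw⟩ := hmin (q * K) (mul_mem hq hK) (by rw [star_mul, hKs, hqs, hqK])
      (by rw [mul_assoc, ← mul_assoc K, ← hqK, mul_assoc, hKK, ← mul_assoc, hqq])
      (by rw [← mul_assoc, hqq])
    have hbh := c.A_comm b hbA h hhA
    have e1 : K * (h + b) = h + b := by
      apply hK1
      rintro _ rfl
      rw [sub_mul, mul_add, mul_add, hhh, hbh]; abel
    have e2 : (h + b) * w = h + b := by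
      have hq1 : (h + b) * q = h + b := by rw [add_mul, hhq, hbq]
      calc (h + b) * w = (h + b) * q * w := by rw [hq1]
        _ = (h + b) * K := by rw [mul_assoc, ← hqw, ← mul_assoc, hq1]
        _ = h + b := by rw [← c.A_comm K hK _ (add_mem hhA hbA), e1]
    have e3 : (h - b) * w = 0 := by
      have hq1 : (h - b) * q = h - b := by rw [sub_mul, hhq, hbq]
      calc (h - b) * w = (h - b) * q * w := by rw [hq1]
        _ = (h - b) * K := by rw [mul_assoc, ← hqw, ← mul_assoc, hq1]
        _ = 0 := hK0
    have t1 : tau e (b * w) = 0 := by rw [c.tau_mul hw, hbt, zero_mul]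
    have t2 : tau e (h * w) = 0 := by
      rw [sub_mul, sub_eq_zero] at e3
      rw [e3, t1]
    have t3 : tau e h = 0 := by
      have := congrArg (tau e) e2
      rw [add_mul, tau_add, tau_add, t1, t2, hbt] at this
      simpa using this.symm
    have hd0 : d = 0 := c.tau_faithful0 d (by rw [← hd, t3])
    have hh0 : h = 0 := by rw [hd, hd0, mul_zero]
    apply star_mul_self_eq_zero'
    rw [hbs, ← hhh, hh0, mul_zero]
  have key2 : ∀ x ∈ M, ∀ a ∈ A, star a = a → a * (q * x * q) = q * x * q * a := by
    intro x hx a ha has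
    obtain ⟨w, hw, haw⟩ := key a ha has
    have hac := c.A_comm a ha q hq
    have hwc : w * (q * x * q) = q * x * q * w :=
      c.Z_central hw (mul_mem (mul_mem (c.A_le q hq) hx) (c.A_le q hq))
    calc a * (q * x * q) = a * q * (x * q) := by simp only [mul_assoc]
      _ = w * (q * x * q) := by rw [haw]; simp only [mul_assoc]
      _ = q * x * (q * w) := by rw [hwc]; simp only [mul_assoc]
      _ = q * x * (q * a) := by rw [← hac, haw, c.Z_central hw (c.A_le q hq)]
      _ = q * x * q * a := by simp only [mul_assoc]
  intro x hx
  apply c.A_max _ (mul_mem (mul_mem (c.A_le q hq) hx) (c.A_le q hq))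
  intro a ha
  have f1 := key2 x hx (a + star a) (add_mem ha (c.A_star a ha)) (by simp [add_comm])
  have f2 := key2 x hx (Complex.I • (a - star a))
    (A.smul_mem (sub_mem ha (c.A_star a ha)) _) (by simp [sub_eq_add_neg, add_comm])
  rw [smul_mul_assoc, mul_smul_comm] at f2
  have f3 := smul_right_injective _ Complex.I_ne_zero f2
  rw [add_mul, mul_add] at f1
  simp only [sub_mul, mul_sub] at f3
  have f4 : (2 : ℂ) • (a * (q * x * q)) = (2 : ℂ) • (q * x * q * a) := by
    rw [two_smul, two_smul]
    have f5 := congrArg₂ (fun s t => s + t) f1 f3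
    calc a * (q * x * q) + a * (q * x * q) = (a * (q * x * q) + star a * (q * x * q)) +
          (a * (q * x * q) - star a * (q * x * q)) := by abel
      _ = _ := f5
      _ = q * x * q * a + q * x * q * a := by abel
  exact smul_right_injective _ (two_ne_zero) f4

/-- normalizing unitaries -/
def Nrm (M A : Subalgebra ℂ (ℋ →L[ℂ] ℋ)) (u : ℋ →L[ℂ] ℋ) : Prop :=
  u ∈ M ∧ u ∈ unitary (ℋ →L[ℂ] ℋ) ∧
    (fun a => u * a * star u) '' (A : Set (ℋ →L[ℂ] ℋ)) = A

lemma nrm_of (c : Ctx M Z A e) {u} (hu : u ∈ M) (huu : u ∈ unitary (ℋ →L[ℂ] ℋ))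
    (h1 : ∀ a ∈ A, u * a * star u ∈ A) (h2 : ∀ a ∈ A, star u * a * u ∈ A) : Nrm M A u := by
  refine ⟨hu, huu, Set.Subset.antisymm ?_ ?_⟩
  · rintro _ ⟨a, ha, rfl⟩
    exact h1 a ha
  · intro a ha
    refine ⟨star u * a * u, h2 a ha, ?_⟩
    have := huu.2
    calc u * (star u * a * u) * star u = (u * star u) * a * (u * star u) := by
          simp only [mul_assoc]
      _ = a := by rw [this, one_mul, mul_one]

lemma comm_A_sa (c : Ctx M Z A e) {T} (hT : ∀ u, Nrm M A u → u * T = T * u) {a} (ha : a ∈ A)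
    (has : star a = a) : a * T = T * a := by
  have hpos : (0 : ℝ) < ‖a‖ + 1 := by positivity
  obtain ⟨u, hu, hua, huc⟩ := exists_unitary (((‖a‖ + 1 : ℝ) : ℂ)⁻¹ • a)
    (by rw [star_smul, has]; simp) (by
      rw [norm_smul, norm_inv, Complex.norm_real, Real.norm_of_nonneg hpos.le, inv_mul_le_one₀ hpos]
      linarith)
  have huA : u ∈ A := by
    apply c.A_max
    · apply c.M_cc
      intro S hS
      exact (huc S (hS _ (c.A_le _ (A.smul_mem ha _)))).symm
    · intro x hx
      exact (huc x (c.A_comm _ (A.smul_mem ha _) x hx)).symm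
  have hsA := c.A_star u huA
  have n1 : Nrm M A u := c.nrm_of (c.A_le u huA) hu
    (fun x hx => mul_mem (mul_mem huA hx) hsA) (fun x hx => mul_mem (mul_mem hsA hx) huA)
  have n2 : Nrm M A (star u) := c.nrm_of (c.A_le _ hsA) (Unitary.star_mem hu)
    (fun x hx => by rw [star_star]; exact mul_mem (mul_mem hsA hx) huA)
    (fun x hx => by rw [star_star]; exact mul_mem (mul_mem huA hx) hsA)
  have h1 : (u + star u) * T = T * (u + star u) := by
    rw [add_mul, mul_add, hT u n1, hT _ n2]
  rw [hua, smul_smul, smul_mul_assoc, mul_smul_comm] at h1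
  refine smul_right_injective _ ?_ h1
  have : ((‖a‖ + 1 : ℝ) : ℂ) ≠ 0 := by exact_mod_cast hpos.ne'
  exact mul_ne_zero two_ne_zero (inv_ne_zero this)

/-- off-diagonal corners between orthogonal abelian projections -/
lemma comm_corner (c : Ctx M Z A e) {T} (hT : ∀ u, Nrm M A u → u * T = T * u) {p q}
    (hp : IsAb M A p) (hq : IsAb M A q) (hpq : p * q = 0) {x} (hx : x ∈ M) :
    (q * x * p) * T = T * (q * x * p) := by
  have hqp : q * p = 0 := by rw [c.A_comm q hq.mem p hp.mem, hpq]
  have hpM := c.A_le _ hp.mem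
  have hqM := c.A_le _ hq.mem
  obtain ⟨s, hsdef⟩ : ∃ s, s = q * x * p + p * star x * q := ⟨_, rfl⟩
  have hsM : s ∈ M := by
    rw [hsdef]
    exact add_mem (mul_mem (mul_mem hqM hx) hpM) (mul_mem (mul_mem hpM (c.M_star x hx)) hqM)
  have hss : star s = s := by
    rw [hsdef]; simp only [star_add, star_mul, hp.sa, hq.sa, star_star, mul_assoc]
    rw [add_comm]
  have hqsp : q * s * p = q * x * p := by
    rw [hsdef, mul_add, add_mul]
    have e1 : q * (q * x * p) * p = (q * q) * x * (p * p) := by simp only [mul_assoc]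
    have e2 : q * (p * star x * q) * p = (q * p) * star x * (q * p) := by simp only [mul_assoc]
    rw [e1, e2, hq.idem, hp.idem, hqp]; simp
  have hpsp : p * s * p = 0 := by
    rw [hsdef, mul_add, add_mul]
    have e1 : p * (q * x * p) * p = (p * q) * x * (p * p) := by simp only [mul_assoc]
    have e2 : p * (p * star x * q) * p = (p * p) * star x * (q * p) := by simp only [mul_assoc]
    rw [e1, e2, hqp, hpq]; simp
  have hqsq : q * s * q = 0 := by
    rw [hsdef, mul_add, add_mul]
    have e1 : q * (q * x * p) * q = (q * q) * x * (p * q) := by simp only [mul_assoc]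
    have e2 : q * (p * star x * q) * q = (q * p) * star x * (q * q) := by simp only [mul_assoc]
    rw [e1, e2, hqp, hpq]; simp
  have hsr : s * (p + q) = s := by
    rw [hsdef]
    have e1 : (q * x * p + p * star x * q) * (p + q) = q * x * (p * p) + q * x * (p * q) +
      (p * star x * (q * p) + p * star x * (q * q)) := by
        simp only [mul_assoc, add_mul, mul_add]; abel
    rw [e1, hp.idem, hq.idem, hpq, hqp]; simp
  have hs2A : s * s ∈ A := by
    have e1 : s * s = p * (star x * q * x) * p + q * (x * p * star x) * q := by
      have e2 : s * s = q * x * (p * q) * x * p + q * x * (p * p) * star x * q +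
        (p * star x * (q * q) * x * p + p * star x * (q * p) * star x * q) := by
        rw [hsdef]; simp only [mul_assoc, add_mul, mul_add]; abel
      rw [e2, hpq, hqp, hp.idem, hq.idem]
      simp only [mul_assoc, mul_zero, zero_mul, zero_add, add_zero]
      rw [add_comm]
    rw [e1]
    have hxs := c.M_star x hx
    exact add_mem (hp.ab _ (mul_mem (mul_mem hxs hqM) hx)) (hq.ab _ (mul_mem (mul_mem hx hpM) hxs))
  obtain ⟨h, hhs, hhh, -, hhc⟩ := exists_abs s hss
  have hhA : h ∈ A := by
    apply c.A_max
    · apply c.M_cc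
      intro S hS
      exact (hhc S (hS _ (c.A_le _ hs2A))).symm
    · intro y hy
      exact (hhc y (c.A_comm _ hs2A y hy)).symm
  have hhM := c.A_le h hhA
  have hhs' : h * s = s * h := hhc s (by simp only [mul_assoc])
  obtain ⟨N, hN, hNs, hNN, hN0, hN1, hNc⟩ := c.kerproj_M (s - h) (sub_mem hsM hhM)
  -- kernel of h
  obtain ⟨K, hK, hKs, hKK, hK0, hK1⟩ := c.kerproj_A {h} (by rintro _ rfl; exact hhA)
  have hK0 := hK0 _ rfl
  have hKM := c.A_le K hK
  have hsK : s * K = 0 := by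
    apply star_mul_self_eq_zero'
    rw [star_mul, hss, mul_assoc, ← mul_assoc s, ← hhh, mul_assoc h, hK0]; simp
  have hNK : N * K = K := hN1 K (by rw [sub_mul, hsK, hK0, sub_zero])
  have hKN : K * N = K := by
    have := congrArg star hNK
    rwa [star_mul, hNs, hKs] at this
  obtain ⟨u, hu⟩ : ∃ u, u = (2 : ℂ) • N - 1 := ⟨_, rfl⟩
  have hus : star u = u := by
    rw [hu, star_sub, star_smul, hNs]; simp
  have huu : u * u = 1 := by
    rw [hu, two_smul, sub_mul, mul_sub, mul_add, add_mul, hNN, mul_one, one_mul]; abel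
  have huM : u ∈ M := by
    rw [hu]; exact sub_mem (M.smul_mem hN _) (one_mem _)
  have huK : u * K = K := by
    rw [hu, sub_mul, smul_mul_assoc, hNK, two_smul, one_mul]; abel
  have hKu : K * u = K := by
    rw [hu, mul_sub, mul_smul_comm, hKN, two_smul, mul_one]; abel
  have hush : u * s = h := by
    have a1 : N * (s + h) = s + h := hN1 _ (by
      rw [sub_mul, mul_add, mul_add, hhh, hhs']; abel)
    have a2 : N * (s - h) = 0 := by
      have := congrArg star hN0
      rwa [star_mul, star_sub, hNs, hss, hhs, star_zero] at this
    have a3 : (2 : ℂ) • (N * s) = s + h := by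
      rw [two_smul]
      calc N * s + N * s = N * (s + h) + N * (s - h) := by rw [mul_add, mul_sub]; abel
        _ = s + h := by rw [a1, a2, add_zero]
    rw [hu, sub_mul, smul_mul_assoc, a3, one_mul]; abel
  have hsu : s = u * h := by rw [← hush, ← mul_assoc, huu, one_mul]
  -- E = 1 - K
  obtain ⟨E, hE⟩ : ∃ E, E = 1 - K := ⟨_, rfl⟩
  have hEA : E ∈ A := by rw [hE]; exact sub_mem (one_mem _) hK
  have hEM := c.A_le E hEA
  have hEs : star E = E := by rw [hE, star_sub, hKs, star_one]
  have hEE : E * E = E := by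
    rw [hE, sub_mul, mul_sub, mul_sub, hKK]; simp
  have hEu : E * u = u * E := by rw [hE, sub_mul, mul_sub, hKu, huK]; simp
  have hyE : ∀ y, y * h = 0 → y * E = 0 := by
    intro y hy
    have h1 : h * star y = 0 := by
      have := congrArg star hy
      rwa [star_mul, hhs, star_zero] at this
    have h2 := congrArg star (hK1 (star y) (by rintro _ rfl; exact h1))
    rw [star_mul, star_star, hKs] at h2
    rw [hE, mul_sub, h2]; simp
  have hEpq : (p + q) * E = E := by
    have h1 : h * (1 - (p + q)) = 0 := by
      apply star_mul_self_eq_zero'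
      rw [star_mul, hhs, mul_assoc, ← mul_assoc h, hhh, mul_assoc s, mul_sub s, hsr]; simp
    have h2 : (1 - (p + q)) * h = 0 := by
      rw [c.A_comm _ (sub_mem (one_mem _) (add_mem hp.mem hq.mem)) h hhA, h1]
    have h3 := hyE _ h2
    rw [sub_mul, one_mul, sub_eq_zero] at h3
    exact h3.symm
  have hdiag : ∀ r, r ∈ A → r * s * r = 0 → r * u * r * E = 0 := by
    intro r hr h0
    apply hyE
    rw [mul_assoc (r * u), c.A_comm r hr h hhA, ← mul_assoc, mul_assoc r, ← hsu, h0]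
  have hpE := c.A_comm p hp.mem E hEA
  have hqE := c.A_comm q hq.mem E hEA
  obtain ⟨v, hv⟩ : ∃ v, v = u * E := ⟨_, rfl⟩
  have hvM : v ∈ M := by rw [hv]; exact mul_mem huM hEM
  have hvs : star v = v := by rw [hv, star_mul, hEs, hus, hEu]
  have hvl : (p + q) * v = v := by
    rw [hv, ← hEu, ← mul_assoc, hEpq]
  have hvr : v * (p + q) = v := by
    have := congrArg star hvl
    rwa [star_mul, star_add, hp.sa, hq.sa, hvs] at this
  have hpvp : p * v * p = 0 := by
    have := hdiag p hp.mem hpsp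
    rw [mul_assoc, hpE] at this
    rw [hv]; simpa only [mul_assoc] using this
  have hqvq : q * v * q = 0 := by
    have := hdiag q hq.mem hqsq
    rw [mul_assoc, hqE] at this
    rw [hv]; simpa only [mul_assoc] using this
  have hvp : v * p = q * v * p := by
    calc v * p = (p + q) * v * p := by rw [hvl]
      _ = q * v * p := by rw [add_mul, add_mul, hpvp, zero_add]
  have hvq : v * q = p * v * q := by
    calc v * q = (p + q) * v * q := by rw [hvl]
      _ = p * v * q := by rw [add_mul, add_mul, hqvq, add_zero]
  have hpv : p * v = p * v * q := by
    have := congrArg star hvp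
    simpa only [star_mul, hp.sa, hq.sa, hvs, mul_assoc] using this
  have hqv : q * v = q * v * p := by
    have := congrArg star hvq
    simpa only [star_mul, hp.sa, hq.sa, hvs, mul_assoc] using this
  have hconj : ∀ a ∈ A, u * a * u ∈ A := by
    intro a ha
    have hap := c.A_comm a ha p hp.mem
    have haq := c.A_comm a ha q hq.mem
    have haM := c.A_le a ha
    have e1 : u * a * u = v * a * v + a * K := by
      have haE := c.A_comm a ha E hEA
      have haK := c.A_comm a ha K hK
      have hEK : E + K = 1 := by rw [hE]; abel
      have a1 : v * a * v = u * (a * E) * u := by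
        have : v * a * v = u * (E * a) * (u * E) := by rw [hv]; simp only [mul_assoc]
        rw [this, ← haE, ← hEu]
        calc u * (a * E) * (E * u) = u * (a * (E * E)) * u := by simp only [mul_assoc]
          _ = _ := by rw [hEE]
      have a2 : a * K = u * (a * K) * u := by
        calc a * K = K * a := haK
          _ = u * K * a := by rw [huK]
          _ = u * (a * K) := by rw [mul_assoc, haK]
          _ = u * (a * K) * u := by rw [mul_assoc, mul_assoc, hKu]
      rw [a1, a2, ← add_mul, ← mul_add, ← mul_add, hEK, mul_one]
    have e2 : v * a * v = p * (v * q * a * q * v) * p + q * (v * p * a * p * v) * q := by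
      have a1 : v * a * v = v * (p * a) * v + v * (q * a) * v := by
        rw [← add_mul, ← mul_add, ← add_mul, ← mul_assoc, hvr]
      have a2 : v * (p * a) * v = q * (v * p * a * p * v) * q := by
        have b1 : p * a = p * a * p := by rw [mul_assoc, hap, ← mul_assoc, hp.idem]
        rw [b1]
        calc v * (p * a * p) * v = (v * p) * a * (p * v) := by simp only [mul_assoc]
          _ = (q * v * p) * a * (p * v * q) := by rw [← hvp, ← hpv]
          _ = _ := by simp only [mul_assoc]
      have a3 : v * (q * a) * v = p * (v * q * a * q * v) * p := by
        have b1 : q * a = q * a * q := by rw [mul_assoc, haq, ← mul_assoc, hq.idem]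
        rw [b1]
        calc v * (q * a * q) * v = (v * q) * a * (q * v) := by simp only [mul_assoc]
          _ = (p * v * q) * a * (q * v * p) := by rw [← hvq, ← hqv]
          _ = _ := by simp only [mul_assoc]
      rw [a1, a2, a3, add_comm]
    rw [e1, e2]
    refine add_mem (add_mem (hp.ab _ ?_) (hq.ab _ ?_)) (mul_mem ha hK)
    · exact mul_mem (mul_mem (mul_mem (mul_mem hvM hqM) haM) hqM) hvM
    · exact mul_mem (mul_mem (mul_mem (mul_mem hvM hpM) haM) hpM) hvM
  have hnu : Nrm M A u := c.nrm_of huM (by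
      rw [Unitary.mem_iff, hus]; exact ⟨huu, huu⟩)
    (by rw [hus]; exact hconj) (by rw [hus]; exact hconj)
  have c1 : Commute u T := hT u hnu
  have c2 : Commute h T := c.comm_A_sa hT hhA hhs
  have c3 : Commute s T := by rw [hsu]; exact c1.mul_left c2
  have c4 : Commute p T := c.comm_A_sa hT hp.mem hp.sa
  have c5 : Commute q T := c.comm_A_sa hT hq.mem hq.sa
  have c6 : Commute (q * s * p) T := (c5.mul_left c3).mul_left c4
  rw [hqsp] at c6
  exact c6.eq

lemma comm_A (c : Ctx M Z A e) {T} (hT : ∀ u, Nrm M A u → u * T = T * u) {a} (ha : a ∈ A) :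
    a * T = T * a := by
  have f1 := c.comm_A_sa hT (add_mem ha (c.A_star a ha)) (by simp [add_comm])
  have f2 := c.comm_A_sa hT (a := Complex.I • (a - star a))
    (A.smul_mem (sub_mem ha (c.A_star a ha)) _) (by simp [sub_eq_add_neg, add_comm])
  rw [smul_mul_assoc, mul_smul_comm] at f2
  have f3 := smul_right_injective _ Complex.I_ne_zero f2
  rw [add_mul, mul_add] at f1
  simp only [sub_mul, mul_sub] at f3
  have f4 : (2 : ℂ) • (a * T) = (2 : ℂ) • (T * a) := by
    rw [two_smul, two_smul]
    have f5 := congrArg₂ (fun s t => s + t) f1 f3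
    calc a * T + a * T = (a * T + star a * T) + (a * T - star a * T) := by abel
      _ = _ := f5
      _ = T * a + T * a := by abel
  exact smul_right_injective _ (two_ne_zero) f4

lemma ab_mul (c : Ctx M Z A e) {p r} (hp : IsAb M A p) (hr : r ∈ A) (hrs : star r = r)
    (hrr : r * r = r) : IsAb M A (p * r) := by
  have hc := c.A_comm p hp.mem r hr
  refine ⟨mul_mem hp.mem hr, by rw [star_mul, hrs, hp.sa, hc], ?_, ?_⟩
  · rw [mul_assoc, ← mul_assoc r, ← hc, mul_assoc, hrr, ← mul_assoc, hp.idem]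
  · intro x hx
    have : p * r * x * (p * r) = p * (r * x * r) * p := by
      rw [hc, ← hc]; nth_rewrite 2 [hc]; simp only [mul_assoc]
    rw [this]
    exact hp.ab _ (mul_mem (mul_mem (c.A_le r hr) hx) (c.A_le r hr))

lemma comm_corner' (c : Ctx M Z A e) {T} (hT : ∀ u, Nrm M A u → u * T = T * u) {p q}
    (hp : IsAb M A p) (hq : IsAb M A q) {x} (hx : x ∈ M) :
    (q * x * p) * T = T * (q * x * p) := by
  have hc := c.A_comm p hp.mem q hq.mem
  have hpc : (1 - p) ∈ A := sub_mem (one_mem _) hp.mem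
  have hqc : (1 - q) ∈ A := sub_mem (one_mem _) hq.mem
  have hp' := c.ab_mul hp hqc (by rw [star_sub, hq.sa, star_one])
    (by rw [sub_mul, mul_sub, mul_sub, hq.idem]; simp)
  have hq' := c.ab_mul hq hpc (by rw [star_sub, hp.sa, star_one])
    (by rw [sub_mul, mul_sub, mul_sub, hp.idem]; simp)
  have hqp := c.ab_mul hq hp.mem hp.sa hp.idem
  have o1 : (p * (1 - q)) * q = 0 := by
    rw [mul_assoc, sub_mul, hq.idem]; simp
  have o2 : (q * p) * (q * (1 - p)) = 0 := by
    rw [c.A_comm q hq.mem (1 - p) hpc, mul_assoc, ← mul_assoc p, mul_sub, hp.idem]; simp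
  have e1 : q * x * p = q * x * (p * (1 - q)) + (q * (1 - p)) * x * (q * p) +
      (q * p) * x * (q * p) := by
    rw [← hc]
    have : (q * (1 - p)) * x * (p * q) + (p * q) * x * (p * q) = q * x * (p * q) := by
      rw [← add_mul, ← add_mul, hc, mul_sub]; simp
    rw [add_assoc, this, ← mul_add, mul_sub]; simp
  have t1 : Commute (q * x * (p * (1 - q))) T := c.comm_corner hT hp' hq o1 hx
  have t2 : Commute ((q * (1 - p)) * x * (q * p)) T := c.comm_corner hT hqp hq' o2 hx
  have t3 : Commute ((q * p) * x * (q * p)) T := c.comm_A hT (hqp.ab x hx)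
  rw [e1]
  exact ((t1.add_left t2).add_left t3).eq

lemma joint (c : Ctx M Z A e) (y : ℋ →L[ℂ] ℋ) (hy : ∀ q, IsAb M A q → q * y = 0) : y = 0 := by
  obtain ⟨P, hP, hPs, hPP, hP0, hP1⟩ := c.kerproj_A {q | IsAb M A q} (fun q hq => hq.mem)
  by_cases h0 : P = 0
  · rw [← hP1 y hy, h0, zero_mul]
  · obtain ⟨q, hq, hq0, hPq⟩ := c.exists_ab hP hPs hPP h0
    exact absurd (by rw [← hPq, c.A_comm P hP q hq.mem, hP0 q hq]) hq0

lemma main (c : Ctx M Z A e) {T} (hT : ∀ u, Nrm M A u → u * T = T * u) {x} (hx : x ∈ M) :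
    x * T = T * x := by
  have h1 : ∀ p q, IsAb M A p → IsAb M A q → q * ((x * T - T * x) * p) = 0 := by
    intro p q hp hq
    have h := c.comm_corner' hT hp hq hx
    have hpT := c.comm_A hT hp.mem
    have hqT := c.comm_A hT hq.mem
    have : q * ((x * T - T * x) * p) = q * x * (T * p) - (q * T) * x * p := by
      simp only [sub_mul, mul_sub, mul_assoc]
    rw [this, ← hpT, hqT, ← mul_assoc, h]
    simp only [mul_assoc, sub_self]
  have h2 : ∀ p, IsAb M A p → p * star (x * T - T * x) = 0 := by
    intro p hp
    have := congrArg star (c.joint _ fun q hq => h1 p q hp hq)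
    rwa [star_mul, hp.sa, star_zero] at this
  have h3 := c.joint _ h2
  rw [star_eq_zero, sub_eq_zero] at h3
  exact h3

end Ctx

end RegMasa


/-- The von Neumann algebra generated by a set of operators: the double
commutant of S ∪ S*. -/
def vNgen {ℋ : Type*} [NormedAddCommGroup ℋ] [InnerProductSpace ℂ ℋ]
    [CompleteSpace ℋ] (S : Set (ℋ →L[ℂ] ℋ)) : Set (ℋ →L[ℂ] ℋ) :=
  Set.centralizer (Set.centralizer (S ∪ star '' S))

/-- let Z be an abelian countably decomposable von Neumann
algebra and M = Z ⊗ Mₙ(ℂ) (realized on a Hilbert space ℋ: M is the von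
Neumann algebra generated by Z together with a system of n×n matrix units
commuting with Z).  If A is a maximal abelian self-adjoint subalgebra of M,
then M is generated by the normalizer of A, i.e. A is regular in M. -/
theorem stmt_14 (ℋ : Type*) [NormedAddCommGroup ℋ] [InnerProductSpace ℂ ℋ]
    [CompleteSpace ℋ] (M Z : Set (ℋ →L[ℂ] ℋ))
    (hMvN : M = Set.centralizer (Set.centralizer M))
    (hMstar : ∀ x ∈ M, star x ∈ M)
    (hZvN : Z = Set.centralizer (Set.centralizer Z))
    (hZstar : ∀ z ∈ Z, star z ∈ Z)
    (hZM : Z ⊆ M)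
    (hZab : ∀ z ∈ Z, ∀ z' ∈ Z, z * z' = z' * z)
    (hZcd : ∀ P : Set (ℋ →L[ℂ] ℋ), P ⊆ Z →
      (∀ p ∈ P, p ≠ 0 ∧ star p = p ∧ p * p = p) →
      (∀ p ∈ P, ∀ q ∈ P, p ≠ q → p * q = 0) → P.Countable)
    (n : ℕ) (hn : 0 < n)
    -- matrix units implementing M = Z ⊗ Mₙ(ℂ)
    (e : Fin n → Fin n → (ℋ →L[ℂ] ℋ)) (he : ∀ i j, e i j ∈ M)
    (hesum : ∑ i, e i i = 1) (hestar : ∀ i j, star (e i j) = e j i)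
    (hemul : ∀ i j k l, e i j * e k l = if j = k then e i l else 0)
    (hZe : ∀ z ∈ Z, ∀ i j, z * e i j = e i j * z)
    (hMgen : M = vNgen (Z ∪ {x | ∃ i j, x = e i j}))
    -- A a maximal abelian self-adjoint subalgebra of M
    (A : Set (ℋ →L[ℂ] ℋ)) (hAM : A ⊆ M) (hAstar : ∀ a ∈ A, star a ∈ A)
    (hmasa : A = {x ∈ M | ∀ a ∈ A, a * x = x * a}) :
    M = vNgen {u : ℋ →L[ℂ] ℋ | u ∈ M ∧ u ∈ unitary (ℋ →L[ℂ] ℋ) ∧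
      (fun a => u * a * star u) '' A = A} := by
  classical
  let M' : Subalgebra ℂ (ℋ →L[ℂ] ℋ) := Subalgebra.centralizer ℂ (Set.centralizer M)
  let Z' : Subalgebra ℂ (ℋ →L[ℂ] ℋ) := Subalgebra.centralizer ℂ (Set.centralizer Z)
  let A' : Subalgebra ℂ (ℋ →L[ℂ] ℋ) := M' ⊓ Subalgebra.centralizer ℂ A
  have hM : ∀ x, x ∈ M' ↔ x ∈ M := fun x => by
    conv_rhs => rw [hMvN]
    rfl
  have hZ : ∀ x, x ∈ Z' ↔ x ∈ Z := fun x => by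
    conv_rhs => rw [hZvN]
    rfl
  have hA : ∀ x, x ∈ A' ↔ x ∈ A := fun x => by
    conv_rhs => rw [hmasa]
    change (x ∈ M' ∧ ∀ a ∈ A, a * x = x * a) ↔ _
    rw [hM]
    rfl
  have hA' : (A' : Set (ℋ →L[ℂ] ℋ)) = A := Set.ext hA
  have hmax : ∀ x, x ∈ A ↔ x ∈ M ∧ ∀ a ∈ A, a * x = x * a := fun x => by
    conv_lhs => rw [hmasa]
    rfl
  have c : RegMasa.Ctx M' Z' A' e := by
    refine ⟨?_, ?_, ?_, ?_, ?_, ?_, ?_, hesum, hestar, hemul, ?_, ?_, ?_, ?_, ?_, ?_⟩ <;>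
      simp only [hM, hZ, hA]
    · intro x hx
      rw [hMvN]
      exact fun T hT => hx T hT
    · exact hMstar
    · intro x hx
      rw [hZvN]
      exact fun T hT => hx T hT
    · exact hZstar
    · exact fun x hx => hZM hx
    · exact hZab
    · exact he
    · exact hZe
    · intro T h1 h2 m hm
      rw [hMgen] at hm
      refine (hm T ?_).symm
      rintro y ((hy | ⟨i, j, rfl⟩) | ⟨y, (hy | ⟨i, j, rfl⟩), rfl⟩)
      · exact h1 y hy
      · exact h2 i j
      · exact h1 _ (hZstar y hy)
      · rw [hestar]; exact h2 j i
    · exact fun x hx => hAM hx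
    · exact hAstar
    · exact fun x hx y hy => ((hmax y).1 hy).2 x hx
    · exact fun x hx h => (hmax x).2 ⟨hx, h⟩
  apply Set.Subset.antisymm
  · intro x hx T hT
    refine (c.main (T := T) ?_ ((hM x).2 hx)).symm
    rintro u ⟨h1, h2, h3⟩
    rw [hA'] at h3
    exact hT u (Or.inl ⟨(hM u).1 h1, h2, h3⟩)
  · intro x hx
    rw [hMvN]
    intro T hT
    refine hx T ?_
    rintro y (⟨hy, -⟩ | ⟨y, ⟨hy, -⟩, rfl⟩)
    · exact hT y hy
    · exact hT _ (hMstar y hy)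
end

section
/- Let N_0 be a countably decomposable von Neumann algebra, N = M_n(N_0) the algebra of n×n matrices over N_0, and S an abelian self-adjoint subset of N. Then there exists a unitary u ∈ N such that u a u^{-1} is a diagonal matrix (all nonzero entries on the diagonal) for every a ∈ S. -/
namespace KD

/-- `p` is a self-adjoint idempotent. -/
def Pj {R : Type*} [Ring R] [StarRing R] (p : R) : Prop := star p = p ∧ p * p = p

/-- `p` is the range projection of the set `X`. -/
def IsRp {R : Type*} [Ring R] [StarRing R] (p : R) (X : Set R) : Prop :=
  Pj p ∧ (∀ x ∈ X, p * x = x) ∧ ∀ y, (∀ x ∈ X, y * x = 0) → y * p = 0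

/-- The facts about `B(K)` used below. -/
class KAx (R : Type*) [Ring R] [StarRing R] : Prop where
  proper : ∀ x : R, star x * x = 0 → x = 0
  rng : ∀ X : Set R, ∃ p, IsRp p X
  iso : ∀ (S : Set (R × R)) (p : R), IsRp p (Prod.fst '' S) →
    (∀ s ∈ S, ∀ t ∈ S, star s.1 * t.1 = star s.2 * t.2) →
    ∃ w, (∀ s ∈ S, w * s.1 = s.2) ∧ star w * w = p
  sqrt : ∀ x : R, ∃ a : R, star a = a ∧ a * a = star x * x ∧
    ∀ t, t * (star x * x) = (star x * x) * t → t * a = a * t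
  spec : ∀ x a : R, (∀ p, Pj p → (∀ t, t * a = a * t → t * star a = star a * t → t * p = p * t) →
    x * p = p * x) → x * a = a * x

section alg

set_option linter.unusedSectionVars false

variable {R : Type*} [Ring R] [StarRing R]

/-- Double commutant property. -/
structure IsVN (N : Subring R) : Prop where
  star_mem : ∀ {x}, x ∈ N → star x ∈ N
  dc : ∀ {x}, (∀ t, (∀ y ∈ N, t * y = y * t) → t * x = x * t) → x ∈ N

/-- Subequivalence of projections relative to `N`. -/
def Sq (N : Subring R) (e f : R) : Prop := ∃ v ∈ N, star v * v = e ∧ f * v = v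

/-- Central projections of `N`. -/
def Cent (N : Subring R) (z : R) : Prop := Pj z ∧ z ∈ N ∧ ∀ a ∈ N, z * a = a * z

theorem asc {a b c : R} (h : a * b = c) (x : R) : a * (b * x) = c * x := by
  rw [← mul_assoc, h]

theorem asc0 {a b : R} (h : a * b = 0) (x : R) : a * (b * x) = 0 := by
  rw [← mul_assoc, h, zero_mul]

theorem Pj.one_sub {p : R} (h : Pj p) : Pj (1 - p) :=
  ⟨by simp [h.1], by simp [mul_sub, sub_mul, h.2]⟩

theorem Pj.zero : Pj (0 : R) := ⟨by simp, by simp⟩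
theorem Pj.one : Pj (1 : R) := ⟨by simp, by simp⟩

/-- flip: `a * b = b` with both self-adjoint -/
theorem flp {a b : R} (ha : star a = a) (hb : star b = b) (h : a * b = b) : b * a = b := by
  have := congrArg star h
  rwa [star_mul, ha, hb] at this

theorem flp0 {a b : R} (ha : star a = a) (hb : star b = b) (h : a * b = 0) : b * a = 0 := by
  have := congrArg star h
  rwa [star_mul, ha, hb, star_zero] at this

theorem Pj.sub {p e : R} (hp : Pj p) (he : Pj e) (h : p * e = e) : Pj (p - e) := by
  have h' := flp hp.1 he.1 h
  exact ⟨by simp [hp.1, he.1], by simp [mul_sub, sub_mul, hp.2, he.2, h, h']⟩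

theorem Pj.add {p e : R} (hp : Pj p) (he : Pj e) (h : p * e = 0) : Pj (p + e) := by
  have h' := flp0 hp.1 he.1 h
  exact ⟨by simp [hp.1, he.1], by simp [mul_add, add_mul, hp.2, he.2, h, h']⟩

theorem Pj.mul {p e : R} (hp : Pj p) (he : Pj e) (h : p * e = e * p) : Pj (p * e) := by
  refine ⟨by rw [star_mul, hp.1, he.1, h], ?_⟩
  calc p * e * (p * e) = p * (e * p) * e := by simp only [mul_assoc]
    _ = (p * p) * (e * e) := by rw [← h]; simp only [mul_assoc]
    _ = p * e := by rw [hp.2, he.2]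

/-- if `star t, t` both satisfy `p t p = t p` then commute -/
theorem comm_of_inv {p t : R} (hp : Pj p) (h1 : p * (t * p) = t * p)
    (h2 : p * (star t * p) = star t * p) : t * p = p * t := by
  have := congrArg star h2
  simp only [star_mul, star_star, hp.1, mul_assoc] at this
  rw [← h1, this]

theorem IsRp.comm {p : R} {X : Set R} (h : IsRp p X) {t : R} (h1 : ∀ x ∈ X, p * (t * x) = t * x)
    (h2 : ∀ x ∈ X, p * (star t * x) = star t * x) : t * p = p * t := by
  have aux : ∀ t : R, (∀ x ∈ X, p * (t * x) = t * x) → p * (t * p) = t * p := by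
    intro t ht
    have := h.2.2 (p * t - t) (fun x hx => by rw [sub_mul, mul_assoc, ht x hx, sub_self])
    rw [sub_mul, mul_assoc, sub_eq_zero] at this
    exact this
  exact comm_of_inv h.1 (aux t h1) (aux _ h2)

theorem IsRp.fix {p : R} {X : Set R} (h : IsRp p X) {y : R} (h1 : ∀ x ∈ X, y * x = x) :
    y * p = p := by
  have := h.2.2 (y - 1) (fun x hx => by rw [sub_mul, h1 x hx, one_mul, sub_self])
  rwa [sub_mul, one_mul, sub_eq_zero] at this

theorem IsRp.uniq {p q : R} {X : Set R} (h : IsRp p X) (h' : IsRp q X) : p = q := by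
  have h1 := h.fix h'.2.1
  have h2 := h'.fix h.2.1
  rw [← h2, flp h'.1.1 h.1.1 h1] 

theorem IsRp.mem {N : Subring R} (hN : IsVN N) {p : R} {X : Set R} (h : IsRp p X)
    (hX : ∀ x ∈ X, x ∈ N) : p ∈ N := by
  apply hN.dc
  intro t ht
  have ht' : ∀ y ∈ N, star t * y = y * star t := by
    intro y hy
    have := congrArg star (ht _ (hN.star_mem hy))
    simpa using this.symm
  refine h.comm ?_ ?_
  · intro x hx; rw [ht x (hX x hx), ← mul_assoc, h.2.1 x hx]
  · intro x hx; rw [ht' x (hX x hx), ← mul_assoc, h.2.1 x hx]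

variable [KAx R]

theorem pi_right {v e : R} (he : Pj e) (h : star v * v = e) : v * e = v := by
  have := KAx.proper (v * e - v) (by
    simp only [star_sub, star_mul, he.1, mul_sub, sub_mul, mul_assoc, h, asc h, he.2]; simp)
  rwa [sub_eq_zero] at this

theorem pi_left {v e : R} (he : Pj e) (h : star v * v = e) : e * star v = star v := by
  have := congrArg star (pi_right he h)
  rwa [star_mul, he.1] at this

theorem pj_range {v e : R} (he : Pj e) (h : star v * v = e) : Pj (v * star v) :=
  ⟨by simp, by rw [mul_assoc, asc h, pi_left he h]⟩

theorem eq_zero_of_star {v : R} (h : v * star v = 0) : v = 0 := by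
  have := KAx.proper (star v) (by simpa using h)
  simpa using this

theorem iso_mem {N : Subring R} (hN : IsVN N) (S : Set (R × R)) (p : R)
    (hp : IsRp p (Prod.fst '' S))
    (h : ∀ s ∈ S, ∀ t ∈ S, star s.1 * t.1 = star s.2 * t.2)
    (hm : ∀ s ∈ S, s.1 ∈ N ∧ s.2 ∈ N) :
    ∃ w ∈ N, (∀ s ∈ S, w * s.1 = s.2) ∧ star w * w = p ∧ IsRp (w * star w) (Prod.snd '' S) := by
  obtain ⟨w, hw, hwp⟩ := KAx.iso S p hp h
  have hwr := pi_right hp.1 hwp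
  refine ⟨w, ?_, hw, hwp, pj_range hp.1 hwp, ?_, ?_⟩
  · apply hN.dc
    intro t ht
    have hpN : p ∈ N := hp.mem hN (by rintro _ ⟨s, hs, rfl⟩; exact (hm s hs).1)
    have := hp.2.2 (t * w - w * t) (by
      rintro _ ⟨s, hs, rfl⟩
      rw [sub_mul, mul_assoc, hw s hs, mul_assoc, ht _ (hm s hs).1, asc (hw s hs),
        ht _ (hm s hs).2, sub_self])
    rwa [sub_mul, mul_assoc, hwr, mul_assoc, ht p hpN, asc hwr, sub_eq_zero] at this
  · rintro _ ⟨s, hs, rfl⟩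
    rw [← hw s hs, mul_assoc, asc hwp, hp.2.1 _ ⟨s, hs, rfl⟩]
  · intro y hy
    have := hp.2.2 (y * w) (by
      rintro _ ⟨s, hs, rfl⟩
      rw [mul_assoc, hw s hs]; exact hy _ ⟨s, hs, rfl⟩)
    rw [mul_assoc, hwr] at this
    rw [← mul_assoc, this, zero_mul]

theorem polar {N : Subring R} (hN : IsVN N) {x : R} (hx : x ∈ N) :
    ∃ w ∈ N, IsRp (star w * w) {star x} ∧ IsRp (w * star w) {x} := by
  obtain ⟨a, ha, haa, hac⟩ := KAx.sqrt x
  obtain ⟨s, hs⟩ := KAx.rng {star x}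
  have key : ∀ y, y * star x = 0 ↔ y * a = 0 := by
    intro y
    constructor
    · intro h
      apply eq_zero_of_star
      rw [star_mul, ha, mul_assoc, asc haa, ← mul_assoc, ← mul_assoc, h]; simp
    · intro h
      apply eq_zero_of_star
      rw [star_mul, star_star, mul_assoc, ← mul_assoc (star x), ← haa, ← mul_assoc,
        ← mul_assoc, h]; simp
  have hsa : IsRp s {a} := by
    refine ⟨hs.1, ?_, ?_⟩
    · rintro _ rfl
      have := (key (s - 1)).1 (by rw [sub_mul, hs.2.1 _ rfl, one_mul, sub_self])
      rwa [sub_mul, one_mul, sub_eq_zero] at this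
    · intro y hy
      refine hs.2.2 y ?_
      rintro _ rfl
      exact (key y).2 (hy a rfl)
  have haN : a ∈ N := hN.dc (fun t ht => hac t (ht _ (N.mul_mem (hN.star_mem hx) hx)))
  obtain ⟨w, hwN, _, hw2, hw3⟩ := iso_mem hN {(a, x)} s (by simpa using hsa)
    (by simp [ha, haa]) (by simp [haN, hx])
  exact ⟨w, hwN, by rwa [hw2], by simpa using hw3⟩

end alg

end KD
namespace KD

section alg2

set_option linter.unusedSectionVars false

variable {R : Type*} [Ring R] [StarRing R] [KAx R]

theorem sum_iso {N : Subring R} (hN : IsVN N) {ι : Type*} (v : ι → R) (hv : ∀ i, v i ∈ N)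
    (ho : ∀ i j, i ≠ j → star (v i) * v j = 0 ∧ v i * star (v j) = 0) (hp : ∀ i, Pj (star (v i) * v i)) :
    ∃ w ∈ N, (∀ i, w * (star (v i) * v i) = v i) ∧
      IsRp (star w * w) (Set.range fun i => star (v i) * v i) ∧
      IsRp (w * star w) (Set.range v) := by
  obtain ⟨p, hpr⟩ := KAx.rng (Set.range fun i => star (v i) * v i)
  obtain ⟨w, hwN, h1, h2, h3⟩ := iso_mem hN (Set.range fun i => (star (v i) * v i, v i)) p
    (by rw [← Set.range_comp]; exact hpr)
    (by
      rintro _ ⟨i, rfl⟩ _ ⟨j, rfl⟩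
      by_cases hij : i = j
      · subst hij
        simp only [(hp i).1, (hp i).2]
      · simp only [(hp i).1, (ho i j hij).1, mul_assoc, asc0 (ho i j hij).2, mul_zero])
    (by
      rintro _ ⟨i, rfl⟩
      exact ⟨N.mul_mem (hN.star_mem (hv i)) (hv i), hv i⟩)
  refine ⟨w, hwN, fun i => h1 _ ⟨i, rfl⟩, by rwa [h2], ?_⟩
  rwa [← Set.range_comp] at h3

theorem Sq.trans {N : Subring R} {e f g : R} (h : Sq N e f) (h' : Sq N f g) : Sq N e g := by
  obtain ⟨v, hv, h1, h2⟩ := h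
  obtain ⟨w, hw, h3, h4⟩ := h'
  refine ⟨w * v, N.mul_mem hw hv, ?_, ?_⟩
  · rw [star_mul, mul_assoc, asc h3, h2, h1]
  · rw [← mul_assoc, h4]

theorem Sq.of_le {N : Subring R} {e f : R} (he : Pj e) (hm : e ∈ N) (h : f * e = e) : Sq N e f :=
  ⟨e, hm, by rw [he.1, he.2], h⟩

theorem Sq.mono {N : Subring R} {e f g : R} (h : Sq N e f) (hg : g * f = f) : Sq N e g := by
  obtain ⟨v, hv, h1, h2⟩ := h
  exact ⟨v, hv, h1, by rw [← h2, ← mul_assoc, hg]⟩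

theorem Cent.pj {N : Subring R} {z : R} (h : Cent N z) : Pj z := h.1
theorem Cent.mem {N : Subring R} {z : R} (h : Cent N z) : z ∈ N := h.2.1
theorem Cent.comm {N : Subring R} {z : R} (h : Cent N z) {a : R} (ha : a ∈ N) : z * a = a * z :=
  h.2.2 a ha

theorem Cent.one {N : Subring R} : Cent N 1 := ⟨Pj.one, N.one_mem, fun a _ => by simp⟩

theorem Cent.one_sub {N : Subring R} {z : R} (h : Cent N z) : Cent N (1 - z) :=
  ⟨h.1.one_sub, N.sub_mem N.one_mem h.2.1, fun a ha => by
    rw [sub_mul, mul_sub, h.comm ha, one_mul, mul_one]⟩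

theorem Cent.mul {N : Subring R} {z y : R} (h : Cent N z) (h' : Cent N y) : Cent N (z * y) :=
  ⟨h.1.mul h'.1 (h.comm h'.mem), N.mul_mem h.mem h'.mem, fun a ha => by
    rw [mul_assoc, h'.comm ha, ← mul_assoc, h.comm ha, mul_assoc]⟩

theorem Cent.sub {N : Subring R} {z y : R} (h : Cent N z) (h' : Cent N y) (hzy : z * y = y) :
    Cent N (z - y) :=
  ⟨h.1.sub h'.1 hzy, N.sub_mem h.mem h'.mem, fun a ha => by
    rw [sub_mul, mul_sub, h.comm ha, h'.comm ha]⟩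

theorem Cent.pj_mul {N : Subring R} {z e : R} (h : Cent N z) (he : Pj e) (hm : e ∈ N) :
    Pj (z * e) := h.1.mul he (h.comm hm)

theorem Sq.cmul {N : Subring R} {e f z : R} (h : Sq N e f) (hz : Cent N z) :
    Sq N (z * e) (z * f) := by
  obtain ⟨v, hv, h1, h2⟩ := h
  have hc := hz.comm hv
  have hc' : star v * z = z * star v := by
    have := congrArg star hc
    rwa [star_mul, star_mul, hz.1.1] at this
  refine ⟨z * v, N.mul_mem hz.mem hv, ?_, ?_⟩
  · rw [star_mul, hz.1.1, mul_assoc, asc hz.1.2, ← mul_assoc, hc', mul_assoc, h1]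
  · rw [mul_assoc, hc, asc h2, ← hc, asc hz.1.2]

theorem sum_sq {N : Subring R} (hN : IsVN N) {ι : Type*} {p f : ι → R} {P F : R}
    (hp : ∀ i, Pj (p i)) (hf : ∀ i, Pj (f i)) (hpo : ∀ i j, i ≠ j → p i * p j = 0)
    (hfo : ∀ i j, i ≠ j → f i * f j = 0) (h : ∀ i, Sq N (p i) (f i))
    (hP : IsRp P (Set.range p)) (hF : ∀ i, F * f i = f i) : Sq N P F := by
  choose v hv h1 h2 using h
  obtain ⟨w, hwN, hw1, hw2, hw3⟩ := sum_iso hN v hv (by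
    intro i j hij
    constructor
    · rw [← h2 i, ← h2 j, star_mul, (hf i).1, mul_assoc, asc0 (hfo i j hij), mul_zero]
    · rw [← pi_right (hp i) (h1 i), ← pi_left (hp j) (h1 j), mul_assoc, asc0 (hpo i j hij),
        mul_zero]) (by intro i; rw [h1]; exact hp i)
  simp only [h1] at hw2
  have e := hw2.uniq hP
  refine ⟨w, hwN, e, ?_⟩
  have : F * (w * star w) = w * star w := hw3.fix (by
    rintro _ ⟨i, rfl⟩
    rw [← h2 i, ← mul_assoc, hF])
  rw [← pi_right hP.1 e, ← e, ← mul_assoc w, ← mul_assoc F, this]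

theorem exists_max (Q : R → Prop) : ∃ V : Set R, (∀ v ∈ V, Q v ∧ v ≠ 0) ∧
    (∀ v ∈ V, ∀ w ∈ V, v ≠ w → star v * w = 0 ∧ v * star w = 0) ∧
    ∀ u, Q u → (∀ v ∈ V, star v * u = 0 ∧ v * star u = 0) → u = 0 := by
  obtain ⟨V, hV⟩ := zorn_subset {V : Set R | (∀ v ∈ V, Q v ∧ v ≠ 0) ∧
    (∀ v ∈ V, ∀ w ∈ V, v ≠ w → star v * w = 0 ∧ v * star w = 0)} (by
    intro c hc hch
    refine ⟨⋃₀ c, ⟨?_, ?_⟩, fun s hs => Set.subset_sUnion_of_mem hs⟩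
    · rintro v ⟨s, hs, hv⟩
      exact (hc hs).1 v hv
    · rintro v ⟨s, hs, hv⟩ w ⟨t, ht, hw⟩ hvw
      rcases hch.total hs ht with h | h
      · exact (hc ht).2 v (h hv) w hw hvw
      · exact (hc hs).2 v hv w (h hw) hvw)
  refine ⟨V, hV.prop.1, hV.prop.2, ?_⟩
  intro u hu ho
  by_contra hu0
  have : insert u V ⊆ V := hV.le_of_ge ⟨by
      rintro v (rfl | hv)
      · exact ⟨hu, hu0⟩
      · exact hV.prop.1 v hv, by
      rintro v (rfl | hv) w (rfl | hw) hvw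
      · exact absurd rfl hvw
      · have := ho w hw
        exact ⟨by simpa using congrArg star this.1, by simpa using congrArg star this.2⟩
      · exact ho v hv
      · exact hV.prop.2 v hv w hw hvw⟩ (Set.subset_insert _ _)
  exact hu0 (KAx.proper u (ho u (this (Set.mem_insert _ _))).1)

/-- version for projections -/
theorem exists_max_pj (Q : R → Prop) (hQ : ∀ p, Q p → Pj p) : ∃ V : Set R, (∀ v ∈ V, Q v ∧ v ≠ 0) ∧
    (∀ v ∈ V, ∀ w ∈ V, v ≠ w → v * w = 0) ∧
    ∀ u, Q u → (∀ v ∈ V, v * u = 0) → u = 0 := by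
  obtain ⟨V, h1, h2, h3⟩ := exists_max Q
  refine ⟨V, h1, ?_, ?_⟩
  · intro v hv w hw hvw
    have := (h2 v hv w hw hvw).1
    rwa [(hQ v (h1 v hv).1).1] at this
  · intro u hu h
    apply h3 u hu
    intro v hv
    rw [(hQ v (h1 v hv).1).1, (hQ u hu).1]
    exact ⟨h v hv, h v hv⟩

/-- range projection -/
noncomputable def rp (X : Set R) : R := (KAx.rng X).choose

theorem rp_spec (X : Set R) : IsRp (rp X) X := (KAx.rng X).choose_spec

/-- central support -/
noncomputable def cs (N : Subring R) (e : R) : R := rp {x | ∃ a ∈ N, x = a * e}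

theorem cs_ann {N : Subring R} {e y : R} (h : ∀ a ∈ N, y * (a * e) = 0) : y * cs N e = 0 :=
  (rp_spec _).2.2 y (by rintro _ ⟨a, ha, rfl⟩; exact h a ha)

theorem cs_mul {N : Subring R} {e : R} : cs N e * e = e :=
  (rp_spec {x | ∃ a ∈ N, x = a * e}).2.1 e ⟨1, N.one_mem, by simp⟩

theorem cs_cent {N : Subring R} (hN : IsVN N) {e : R} (he : e ∈ N) : Cent N (cs N e) := by
  refine ⟨(rp_spec _).1, (rp_spec _).mem hN (by rintro _ ⟨a, ha, rfl⟩; exact N.mul_mem ha he), ?_⟩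
  intro t ht
  have := (rp_spec {x | ∃ a ∈ N, x = a * e}).2.1
  exact ((rp_spec {x | ∃ a ∈ N, x = a * e}).comm (t := t)
    (by
      rintro _ ⟨a, ha, rfl⟩
      exact this _ ⟨t * a, N.mul_mem ht ha, by rw [mul_assoc]⟩)
    (by
      rintro _ ⟨a, ha, rfl⟩
      exact this _ ⟨star t * a, N.mul_mem (hN.star_mem ht) ha, by rw [mul_assoc]⟩)).symm

theorem cs_min {N : Subring R} {e z : R} (hz : Cent N z) (h : z * e = e) :
    z * cs N e = cs N e := by
  have : (z - 1) * cs N e = 0 := cs_ann (by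
    intro a ha
    rw [sub_mul, one_mul, ← mul_assoc, hz.comm ha, mul_assoc, h, sub_self])
  rwa [sub_mul, one_mul, sub_eq_zero] at this

theorem cs_zero {N : Subring R} {e z : R} (hz : Cent N z) (h : z * e = 0) :
    z * cs N e = 0 := cs_ann (by
    intro a ha
    rw [← mul_assoc, hz.comm ha, mul_assoc, h, mul_zero])

theorem cs_ne {N : Subring R} {e : R} (h : e ≠ 0) : cs N e ≠ 0 := by
  intro h0
  apply h
  rw [← cs_mul (N := N) (e := e), h0, zero_mul]

/-- from the polar decomposition: if `f N e ≠ 0` -/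
theorem polar_pair {N : Subring R} (hN : IsVN N) {e f a : R} (he : Pj e) (hf : Pj f) (hem : e ∈ N)
    (hfm : f ∈ N) (ha : a ∈ N) (h : f * (a * e) ≠ 0) :
    ∃ u ∈ N, u ≠ 0 ∧ Pj (star u * u) ∧ u * e = u ∧ f * u = u := by
  obtain ⟨u, huN, h1, h2⟩ := polar hN (x := f * (a * e)) (N.mul_mem hfm (N.mul_mem ha hem))
  have hr := pi_right h1.1 rfl
  have k1 : e * (star u * u) = star u * u := h1.fix (by
    rintro _ rfl
    simp only [star_mul, he.1, hf.1, mul_assoc, asc he.2])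
  have k2 : f * (u * star u) = u * star u := h2.fix (by
    rintro _ rfl
    rw [asc hf.2])
  refine ⟨u, huN, ?_, h1.1, ?_, ?_⟩
  · rintro rfl
    have := h2.2.1 _ rfl
    simp at this
    exact h this.symm
  · rw [← hr, mul_assoc, flp he.1 h1.1.1 k1]
  · rw [← hr, ← mul_assoc u, ← mul_assoc f, k2]

end alg2
end KD
namespace KD

section alg3

set_option linter.unusedSectionVars false

variable {R : Type*} [Ring R] [StarRing R] [KAx R]

theorem lemM {N A : Subring R} (hN : IsVN N) (hA : IsVN A) (hAN : A ≤ N) {r : R} (hr : Pj r)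
    (hrA : r ∈ A) {ι : Type*} (e : ι → R) (he : ∀ i, Pj (e i)) 
    (heo : ∀ i j, i ≠ j → e i * e j = 0) :
    ∃ w ∈ N, star w * w ∈ A ∧ Pj (star w * w) ∧ r * (star w * w) = star w * w ∧
      (∀ i, star w * e i * w ∈ A) ∧ (∀ i, e i * (w * star w) = (w * star w) * e i) ∧
      (∀ y, (∀ i, y * e i = 0) → y * w = 0) ∧
      ∀ i g, g ∈ A → Pj g → (r - star w * w) * g = g → Sq N g (e i - e i * (w * star w)) →
        g = 0 := by
  classical
  obtain ⟨V, hV1, hV2, hV3⟩ := exists_max (fun v : R => v ∈ N ∧ star v * v ∈ A ∧ Pj (star v * v) ∧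
    r * (star v * v) = star v * v ∧ ∃ i, e i * v = v)
  obtain ⟨w, hwN, hw1, hw2, hw3⟩ := sum_iso hN (fun v : V => (v : R)) (fun v => (hV1 v v.2).1.1)
    (fun v v' h => hV2 v v.2 v' v'.2 (fun h' => h (Subtype.ext h')))
    (fun v => (hV1 v v.2).1.2.2.1)
  have hwA : star w * w ∈ A := hw2.mem hA (by rintro _ ⟨v, rfl⟩; exact (hV1 v v.2).1.2.1)
  have hev : ∀ v ∈ V, ∀ i, e i * v = v ∨ e i * v = 0 := by
    intro v hv i
    obtain ⟨j, hj⟩ := (hV1 v hv).1.2.2.2.2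
    by_cases hij : i = j
    · subst hij; exact Or.inl hj
    · right; rw [← hj, asc0 (heo i j hij)]
  have hwv : ∀ v ∈ V, w * (star v * v) = v := fun v hv => hw1 ⟨v, hv⟩
  have hwwv : ∀ v ∈ V, (w * star w) * v = v := fun v hv => hw3.2.1 v ⟨⟨v, hv⟩, rfl⟩
  have hw2v : ∀ v ∈ V, (star w * w) * (star v * v) = star v * v :=
    fun v hv => hw2.2.1 _ ⟨⟨v, hv⟩, rfl⟩
  have hswv : ∀ v ∈ V, star w * v = star v * v := by
    intro v hv
    conv_lhs => rw [← hwv v hv]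
    rw [← mul_assoc, hw2v v hv]
  have hwr := pi_right hw2.1 rfl
  have hec : ∀ i, e i * (w * star w) = (w * star w) * e i := by
    intro i
    have : ∀ x ∈ Set.range (fun v : V => (v : R)), w * star w * (e i * x) = e i * x := by
      rintro _ ⟨v, rfl⟩
      rcases hev v v.2 i with h | h
      · rw [h, hwwv v v.2]
      · rw [h, mul_zero]
    exact hw3.comm this (by rw [(he i).1]; exact this)
  refine ⟨w, hwN, hwA, hw2.1, ?_, ?_, hec, ?_, ?_⟩
  · exact hw2.fix (by rintro _ ⟨v, rfl⟩; exact (hV1 v v.2).1.2.2.2.1)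
  · intro i
    apply hA.dc
    intro t ht
    have := hw2.2.2 (t * (star w * e i * w) - (star w * e i * w) * t) (by
      rintro _ ⟨v, rfl⟩
      dsimp only
      have hvA := (hV1 v v.2).1.2.1
      rw [sub_mul, mul_assoc _ t, ht _ hvA, mul_assoc t, mul_assoc _ w, hwv v v.2,
        ← mul_assoc _ _ t, mul_assoc _ w, hwv v v.2, mul_assoc]
      rcases hev v v.2 i with h | h
      · rw [h, hswv v v.2, ht _ hvA, sub_self]
      · rw [h]; simp)
    rw [sub_mul, mul_assoc _ t, ht _ hwA, mul_assoc t, mul_assoc _ w, hwr,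
        ← mul_assoc _ _ t, mul_assoc _ w, hwr, sub_eq_zero] at this
    exact this
  · intro y hy
    have := hw3.2.2 y (by
      rintro _ ⟨v, rfl⟩
      obtain ⟨j, hj⟩ := (hV1 v v.2).1.2.2.2.2
      dsimp only
      rw [← hj, asc0 (hy j)])
    rw [← hwr, ← mul_assoc w, ← mul_assoc y, this, zero_mul]
  · rintro i g hgA hg hrg ⟨u, huN, hu1, hu2⟩
    have hu : u = 0 := by
      apply hV3 u
      · refine ⟨huN, by rwa [hu1], by rwa [hu1], ?_, i, ?_⟩
        · rw [hu1, ← hrg, ← mul_assoc, mul_sub, hr.2, hw2.fix (y := r)]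
          rintro _ ⟨v, rfl⟩; exact (hV1 v v.2).1.2.2.2.1
        · rw [← hu2, ← mul_assoc, mul_sub, (he i).2, ← mul_assoc, (he i).2]
      · intro v hv
        constructor
        · have k : star v * (e i - e i * (w * star w)) = 0 := by
            have : w * star w * (e i * v) = e i * v := by
              rw [← mul_assoc, ← hec, mul_assoc, hwwv v hv]
            have := congrArg star this
            rw [star_mul, star_mul, star_mul w, star_star, (he i).1] at this
            rw [mul_sub, ← mul_assoc, this, sub_self]
          rw [← hu2, ← mul_assoc, k, zero_mul]
        · have hvp := (hV1 v hv).1.2.2.1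
          have k : (star v * v) * (r - star w * w) = 0 := by
            apply flp0 (by simp [hr.1]) hvp.1
            rw [sub_mul, hw2v v hv, (hV1 v hv).1.2.2.2.1, sub_self]
          rw [← pi_right hvp rfl, ← pi_left hg hu1, ← hrg, mul_assoc, ← mul_assoc (star v * v),
            ← mul_assoc (star v * v), k]
          simp
    rw [← hu1, hu, mul_zero]

theorem compare {N : Subring R} (hN : IsVN N) {e f : R} (he : Pj e) (hf : Pj f) (hem : e ∈ N)
    (hfm : f ∈ N) : ∃ z, Cent N z ∧ Sq N (z * e) (z * f) ∧ Sq N ((1 - z) * f) ((1 - z) * e) := by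
  obtain ⟨w, hwN, hwA, hwp, hrw, -, hec, hy, hmax⟩ := lemM hN hN le_rfl he hem
    (fun _ : Unit => f) (fun _ => hf) (by intro i j h; exact absurd rfl h)
  have hfw : f * w = w := by
    have := hy (f - 1) (by intro _; rw [sub_mul, hf.2, one_mul, sub_self])
    rwa [sub_mul, one_mul, sub_eq_zero] at this
  have hwp' : Pj (w * star w) := pj_range hwp rfl
  have hfww : f * (w * star w) = w * star w := by rw [← mul_assoc, hfw]
  have hwwN : w * star w ∈ N := N.mul_mem hwN (hN.star_mem hwN)
  have he1 : Pj (e - star w * w) := he.sub hwp hrw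
  have hf1 : Pj (f - w * star w) := hf.sub hwp' hfww
  have hann : ∀ a ∈ N, (e - star w * w) * (a * (f - w * star w)) = 0 := by
    intro a ha
    by_contra h
    obtain ⟨u, huN, hu0, hup, hu1, hu2⟩ := polar_pair hN hf1 he1 (N.sub_mem hfm hwwN)
      (N.sub_mem hem hwA) ha h
    have hup' := pj_range hup rfl
    apply hu0
    apply eq_zero_of_star
    refine hmax () (u * star u) (N.mul_mem huN (hN.star_mem huN)) hup'
      (by rw [← mul_assoc, hu2]) ⟨star u, hN.star_mem huN, by simp, ?_⟩
    rw [hfww]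
    have := congrArg star hu1
    rwa [star_mul, hf1.1] at this
  have hc := cs_cent hN (N.sub_mem hfm hwwN)
  have h1 := cs_ann hann
  have h2 := cs_mul (N := N) (e := f - w * star w)
  set c := cs N (f - w * star w)
  refine ⟨c, hc, ?_, ?_⟩
  · have : Sq N (c * (star w * w)) (c * f) := Sq.cmul ⟨w, hwN, rfl, hfw⟩ hc
    have k : c * e = c * (star w * w) := by
      rw [← hc.comm (N.sub_mem hem hwA), mul_sub, sub_eq_zero] at h1
      exact h1
    rwa [k]
  · have : Sq N ((1 - c) * (w * star w)) ((1 - c) * e) := Sq.cmul ⟨star w, hN.star_mem hwN, by simp, by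
      have := congrArg (fun x => star (w * x)) (flp he.1 hwp.1 hrw)
      rw [← mul_assoc, pi_right hwp rfl, star_mul, he.1] at this
      exact this⟩ hc.one_sub
    have k : (1 - c) * f = (1 - c) * (w * star w) := by
      rw [← sub_eq_zero, ← mul_sub, sub_mul, h2, one_mul, sub_self]
    rwa [k]

theorem sq_add {N : Subring R} {e1 e2 f1 f2 : R} (he1 : Pj e1) (he2 : Pj e2)
    (hf1 : Pj f1) (h1 : Sq N e1 f1) (h2 : Sq N e2 f2) 
    (ho' : f1 * f2 = 0) (hf2 : Pj f2) : Sq N (e1 + e2) (f1 + f2) := by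
  obtain ⟨v, hv, h3, h4⟩ := h1
  obtain ⟨w, hw, h5, h6⟩ := h2
  have k1 : star v * w = 0 := by
    rw [← h4, ← h6, star_mul, hf1.1, mul_assoc, asc0 ho', mul_zero]
  have k2 : star w * v = 0 := by simpa using congrArg star k1
  refine ⟨v + w, N.add_mem hv hw, ?_, ?_⟩
  · rw [star_add, add_mul, mul_add, mul_add, h3, h5, k1, k2]; simp
  · have l1 : f1 * w = 0 := by rw [← h6, asc0 ho']
    have l2 : f2 * v = 0 := by rw [← h4, asc0 (flp0 hf1.1 hf2.1 ho')]
    rw [add_mul, mul_add, mul_add, h4, h6, l1, l2]; simp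

theorem half {N : Subring R} (hN : IsVN N) {F G : R} (hF : Pj F) (hG : Pj G) (hFm : F ∈ N)
    (hGm : G ∈ N) : ∃ w ∈ N, Pj (star w * w) ∧ Pj (w * star w) ∧
      G * (star w * w) = star w * w ∧ F * (w * star w) = w * star w ∧
      (G - star w * w) * F = 0 ∧ (F - w * star w) * G = 0 ∧
      (∀ y, y * G = y → y * F = 0 → y * (G - star w * w) = y) ∧
      (∀ y, y * F = y → y * G = 0 → y * (F - w * star w) = y) := by
  obtain ⟨w, hw, h1, h2⟩ := polar hN (N.mul_mem hFm hGm)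
  have k1 : G * (star w * w) = star w * w := h1.fix (by
    rintro _ rfl; rw [star_mul, hG.1, asc hG.2])
  have k2 : F * (w * star w) = w * star w := h2.fix (by
    rintro _ rfl; rw [asc hF.2])
  have m1 := h1.2.1 _ rfl
  rw [star_mul, hG.1, hF.1, ← mul_assoc, flp hG.1 h1.1.1 k1] at m1
  have m2 := h2.2.1 _ rfl
  rw [← mul_assoc, flp hF.1 h2.1.1 k2] at m2
  refine ⟨w, hw, h1.1, h2.1, k1, k2, ?_, ?_, ?_, ?_⟩
  · rw [sub_mul, m1, sub_self]
  · rw [sub_mul, m2, sub_self]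
  · intro y hy hy'
    rw [mul_sub, hy, h1.2.2 y, sub_zero]
    rintro _ rfl
    rw [star_mul, hF.1, hG.1, ← mul_assoc, hy, hy']
  · intro y hy hy'
    rw [mul_sub, hy, h2.2.2 y, sub_zero]
    rintro _ rfl
    rw [← mul_assoc, hy, hy']

theorem sa_eq {a b : R} (ha : star a = a) (hb : star b = b) (h1 : a * b = a) (h2 : b * a = b) :
    a = b := by
  have := congrArg star h1
  rw [star_mul, ha, hb, h2] at this
  exact this.symm

theorem PL {N : Subring R} (hN : IsVN N) {E F G H : R} (hE : Pj E) (hF : Pj F) (hG : Pj G)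
    (hH : Pj H) (hEm : E ∈ N) (hFm : F ∈ N) (hGm : G ∈ N) (hHm : H ∈ N)
    (hEF : E * F = 0) (hGH : G * H = 0) (hs : E + F = G + H) :
    ∃ z, Cent N z ∧ Sq N (z * G) (z * F) ∧ Sq N ((1 - z) * H) ((1 - z) * E) := by
  have hFE := flp0 hE.1 hF.1 hEF
  have hHG := flp0 hG.1 hH.1 hGH
  obtain ⟨w, hw, a1, a2, a3, a4, a5, a6, a7, a8⟩ := half hN hF hG hFm hGm
  obtain ⟨u, hu, b1, b2, b3, b4, b5, b6, b7, b8⟩ := half hN hE hH hEm hHm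
  have wm1 : star w * w ∈ N := N.mul_mem (hN.star_mem hw) hw
  have wm2 : w * star w ∈ N := N.mul_mem hw (hN.star_mem hw)
  have hm := hG.sub a1 a3
  have hm' := hF.sub a2 a4
  have hn := hH.sub b1 b3
  have hn' := hE.sub b2 b4
  have mG := flp hG.1 hm.1 (show G * (G - star w * w) = G - star w * w by rw [mul_sub, hG.2, a3])
  have mF := flp hF.1 hm'.1 (show F * (F - w * star w) = F - w * star w by rw [mul_sub, hF.2, a4])
  have nH := flp hH.1 hn.1 (show H * (H - star u * u) = H - star u * u by rw [mul_sub, hH.2, b3])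
  have nE := flp hE.1 hn'.1 (show E * (E - u * star u) = E - u * star u by rw [mul_sub, hE.2, b4])
  have mm1 : G - star w * w ∈ N := N.sub_mem hGm wm1
  have mm2 : F - w * star w ∈ N := N.sub_mem hFm wm2
  have eF : F = w * star w + (F - w * star w) := by abel
  have eG : G = star w * w + (G - star w * w) := by abel
  have eH : H = star u * u + (H - star u * u) := by abel
  have eE : E = u * star u + (E - u * star u) := by abel
  have ow : (w * star w) * (F - w * star w) = 0 := by
    rw [mul_sub, flp hF.1 a2.1 a4, a2.2, sub_self]
  have ou : (u * star u) * (E - u * star u) = 0 := by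
    rw [mul_sub, flp hE.1 b2.1 b4, b2.2, sub_self]
  generalize G - star w * w = m at *
  generalize F - w * star w = m' at *
  generalize H - star u * u = n at *
  generalize E - u * star u = n' at *
  have e1 : m' = n := by
    have x1 : m' * E = 0 := by rw [← mF, mul_assoc, hFE, mul_zero]
    have x2 : m' * H = m' := by
      have := congrArg (m' * ·) hs
      simpa [mul_add, x1, mF, a6] using this.symm
    have y1 : n * G = 0 := by rw [← nH, mul_assoc, hHG, mul_zero]
    have y2 : n * F = n := by
      have := congrArg (n * ·) hs
      simpa [mul_add, b5, y1, nH] using this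
    exact sa_eq hm'.1 hn.1 (b7 _ x2 x1) (a8 _ y2 y1)
  have e2 : m = n' := by
    have x1 : m * H = 0 := by rw [← mG, mul_assoc, hGH, mul_zero]
    have x2 : m * E = m := by
      have := congrArg (m * ·) hs
      simpa [mul_add, x1, mG, a5] using this
    have y1 : n' * F = 0 := by rw [← nE, mul_assoc, hEF, mul_zero]
    have y2 : n' * G = n' := by
      have := congrArg (n' * ·) hs
      simpa [mul_add, b6, y1, nE] using this.symm
    exact sa_eq hm.1 hn'.1 (b8 _ x2 x1) (a7 _ y2 y1)
  subst e1 e2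
  have orth : ∀ {z p q : R}, Cent N z → p ∈ N → p * q = 0 → (z * p) * (z * q) = 0 := by
    intro z p q hz hp hpq
    rw [hz.comm hp, mul_assoc, asc hz.1.2, ← mul_assoc, ← hz.comm hp, mul_assoc, hpq, mul_zero]
  obtain ⟨z, hz, c1, c2⟩ := compare hN hm hm' mm1 mm2
  refine ⟨z, hz, ?_, ?_⟩
  · rw [eF, eG, mul_add, mul_add]
    refine sq_add (hz.pj_mul a1 wm1) (hz.pj_mul hm mm1) (hz.pj_mul a2 wm2)
      (Sq.cmul ⟨w, hw, rfl, by rw [mul_assoc, pi_right a1 rfl]⟩ hz) c1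
      (orth hz wm2 ow) (hz.pj_mul hm' mm2)
  · have um1 : star u * u ∈ N := N.mul_mem (hN.star_mem hu) hu
    have um2 : u * star u ∈ N := N.mul_mem hu (hN.star_mem hu)
    have hz' := hz.one_sub
    rw [eH, eE, mul_add, mul_add]
    refine sq_add (hz'.pj_mul b1 um1) (hz'.pj_mul hm' mm2) (hz'.pj_mul b2 um2)
      (Sq.cmul ⟨u, hu, rfl, by rw [mul_assoc, pi_right b1 rfl]⟩ hz') c2
      (orth hz' um2 ou) (hz'.pj_mul hm mm1)

theorem SB1 {N : Subring R} (hN : IsVN N) {e f y : R} (he : Pj e) (hf : Pj f) (hem : e ∈ N)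
    (hfm : f ∈ N) (hfe : e * f = f) (hy : y ∈ N) (h1 : star y * y = e) (h2 : f * y = y) :
    ∃ u ∈ N, star u * u = e ∧ u * star u = f := by
  have hr := he.sub hf hfe
  have ye := pi_right he h1
  have ey : e * y = y := by rw [← h2, ← mul_assoc, hfe]
  have ery : (e - f) * y = 0 := by rw [sub_mul, ey, h2, sub_self]
  have hq := rp_spec (Set.range fun k : ℕ => y ^ k * (e - f))
  have hqN := hq.mem hN (by
    rintro _ ⟨k, rfl⟩; exact N.mul_mem (N.pow_mem hy k) (N.sub_mem hem hfm))
  set q := rp (Set.range fun k : ℕ => y ^ k * (e - f))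
  have her : e * (e - f) = e - f := by rw [mul_sub, he.2, hfe]
  have heyk : ∀ k : ℕ, e * (y ^ k * (e - f)) = y ^ k * (e - f) := by
    intro k
    cases k with
    | zero => simp [her]
    | succ k => rw [pow_succ', mul_assoc, asc ey]
  have heq : e * q = q := hq.fix (by rintro _ ⟨k, rfl⟩; exact heyk k)
  have hqe := flp he.1 hq.1.1 heq
  have hyqy : Pj (y * q * star y) := by
    refine ⟨by simp [hq.1.1, mul_assoc], ?_⟩
    simp only [mul_assoc, asc h1, asc heq, asc hq.1.2]
  have hq' : IsRp ((e - f) + y * q * star y) (Set.range fun k : ℕ => y ^ k * (e - f)) := by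
    refine ⟨hr.add hyqy (by rw [mul_assoc, asc0 ery]), ?_, ?_⟩
    · rintro _ ⟨k, rfl⟩
      cases k with
      | zero =>
        have : star y * (e - f) = 0 := by
          have := congrArg star ery
          rwa [star_mul, hr.1, star_zero] at this
        simp [add_mul, hr.2, mul_assoc, this]
      | succ k =>
        have := hq.2.1 _ ⟨k, rfl⟩
        simp only at this
        simp only [pow_succ', add_mul, mul_assoc, asc0 ery, asc h1, heyk, zero_add, this]
    · intro x hx
      have x1 := hx _ ⟨0, rfl⟩
      have x2 := hq.2.2 (x * y) (by
        rintro _ ⟨k, rfl⟩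
        have := hx _ ⟨k + 1, rfl⟩
        simpa [pow_succ', mul_assoc] using this)
      simp at x1
      rw [mul_add, x1, ← mul_assoc, ← mul_assoc, x2]; simp
  have E := hq.uniq hq'
  have E2 : y * q * star y = q - (e - f) := by rw [eq_sub_iff_add_eq, add_comm]; exact E.symm
  have qr : q * (e - f) = e - f := by simpa using hq.2.1 _ ⟨0, rfl⟩
  have qyq : q * (y * q) = y * q := by
    have : q * (y * q * star y) = y * q * star y := by rw [E2, mul_sub, hq.1.2, qr]
    have := congrArg (· * y) this
    simpa only [mul_assoc, h1, hqe] using this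
  have yqe : y * q * (e - q) = 0 := by rw [mul_assoc, mul_sub, hqe, hq.1.2, sub_self, mul_zero]
  have eyq : (e - q) * (y * q) = 0 := by rw [sub_mul, qyq, asc ey, sub_self]
  have hep := he.sub hq.1 heq
  have yqs : q * star y * (e - q) = 0 := by
    have := congrArg star eyq
    simpa only [star_mul, hq.1.1, hep.1, star_zero] using this
  refine ⟨y * q + (e - q), N.add_mem (N.mul_mem hy hqN) (N.sub_mem hem hqN), ?_, ?_⟩
  · simp only [star_add, star_mul, hq.1.1, hep.1, add_mul, mul_add, eyq, yqs, hep.2]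
    rw [mul_assoc, asc h1, heq, hq.1.2]; abel
  · have : (e - q) * (q * star y) = 0 := by rw [← mul_assoc, sub_mul, heq, hq.1.2]; simp
    simp only [star_add, star_mul, hq.1.1, hep.1, add_mul, mul_add, yqe, this, hep.2]
    rw [mul_assoc, asc hq.1.2, ← mul_assoc, E2]; abel

theorem SB {N : Subring R} (hN : IsVN N) {e f : R} (he : Pj e) (hf : Pj f) (hem : e ∈ N)
    (h : Sq N e f) (h' : Sq N f e) : ∃ u ∈ N, star u * u = e ∧ u * star u = f := by
  obtain ⟨v, hv, h1, h2⟩ := h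
  obtain ⟨w, hw, h3, h4⟩ := h'
  have hws := hN.star_mem hw
  obtain ⟨u, hu, h5, h6⟩ := SB1 hN he (pj_range hf h3) hem (N.mul_mem hw hws) (y := w * v)
    (by rw [← mul_assoc, h4]) (N.mul_mem hw hv)
    (by rw [star_mul, mul_assoc, asc h3, h2, h1]) (by rw [mul_assoc, asc h3, h2])
  refine ⟨star w * u, N.mul_mem hws hu, ?_, ?_⟩
  · rw [star_mul, star_star, mul_assoc, ← mul_assoc w, ← h6, mul_assoc, h5, pi_right he h5, h5]
  · rw [star_mul, star_star, mul_assoc, ← mul_assoc u, h6, ← mul_assoc, ← mul_assoc, h3, mul_assoc, h3, hf.2]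

end alg3
end KD
namespace KD

section alg4

set_option linter.unusedSectionVars false
set_option linter.unusedVariables false

variable {R : Type*} [Ring R] [StarRing R] [KAx R]

/-- `A` is a masa in the countably decomposable algebra `N`. -/
structure Ctx (N A : Subring R) : Prop where
  hN : IsVN N
  hA : IsVN A
  hAN : A ≤ N
  hAc : ∀ x ∈ A, ∀ y ∈ A, x * y = y * x
  hm : ∀ x ∈ N, (∀ a ∈ A, x * a = a * x) → x ∈ A
  hcd : ∀ P : Set R, (∀ p ∈ P, Pj p ∧ p ∈ N ∧ p ≠ 0) →
    (∀ p ∈ P, ∀ q ∈ P, p ≠ q → p * q = 0) → P.Countable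

theorem Ctx.cent {N A : Subring R} (C : Ctx N A) {z : R} (hz : Cent N z) : z ∈ A :=
  C.hm z hz.mem (fun a ha => hz.comm (C.hAN ha))

theorem cent_rp {N : Subring R} (hN : IsVN N) {V : Set R} (hV : ∀ v ∈ V, Cent N v) :
    Cent N (rp V) := by
  have h := rp_spec V
  refine ⟨h.1, h.mem hN (fun v hv => (hV v hv).mem), fun t ht => ?_⟩
  refine (h.comm ?_ ?_).symm
  · intro v hv
    rw [← (hV v hv).comm ht, ← mul_assoc, h.2.1 v hv]
  · intro v hv
    rw [← (hV v hv).comm (hN.star_mem ht), ← mul_assoc, h.2.1 v hv]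

theorem lemB {N A : Subring R} (C : Ctx N A) {e G : R} {g : ℕ → R} (he : Pj e) (hem : e ∈ N)
    (hg : ∀ k, Pj (g k)) (ho : ∀ i j, i ≠ j → g i * g j = 0) (hs : ∀ k, Sq N e (g k))
    (hG : ∀ k, G * g k = g k) : Sq N (cs N e) G := by
  have hN := C.hN
  have hc := cs_cent hN hem
  obtain ⟨V, h1, h2, h3⟩ := exists_max_pj (fun h : R => Pj h ∧ h ∈ N ∧ cs N e * h = h ∧ Sq N h e)
    (fun p hp => hp.1)
  have hP := rp_spec V
  have hPN := hP.mem hN (fun v hv => (h1 v hv).1.2.1)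
  have hcP : cs N e * rp V = rp V := hP.fix (fun v hv => (h1 v hv).1.2.2.1)
  set P := rp V
  have hd := hc.pj.sub hP.1 hcP
  have key : (cs N e - P) * cs N e = 0 := by
    apply cs_ann
    intro a ha
    by_contra hne
    obtain ⟨u, huN, hu0, hup, hu1, hu2⟩ := polar_pair hN he hd hem (N.sub_mem hc.mem hPN) ha hne
    apply hu0
    apply eq_zero_of_star
    apply h3
    · refine ⟨pj_range hup rfl, N.mul_mem huN (hN.star_mem huN), ?_, star u, hN.star_mem huN,
        by simp, ?_⟩
      · rw [← mul_assoc, ← hu2, ← mul_assoc, mul_sub, hcP, hc.pj.2]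
      · have := congrArg star hu1
        rwa [star_mul, he.1] at this
    · intro v hv
      have hv1 := (h1 v hv).1
      rw [← mul_assoc, ← hu2, ← mul_assoc, mul_sub, flp hc.pj.1 hv1.1.1 hv1.2.2.1,
        flp hP.1.1 hv1.1.1 (hP.2.1 v hv), sub_self]
      simp
  rw [sub_mul, hc.pj.2, flp hc.pj.1 hP.1.1 hcP, sub_eq_zero] at key
  have hVc : V.Countable := C.hcd V (fun v hv => ⟨(h1 v hv).1.1, (h1 v hv).1.2.1, (h1 v hv).2⟩) h2
  have := hVc.to_subtype
  obtain ⟨f, hf⟩ := exists_injective_nat V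
  refine sum_sq hN (p := fun v : V => (v : R)) (f := fun v : V => g (f v))
    (fun v => (h1 v v.2).1.1) (fun v => hg _)
    (fun v w h => h2 v v.2 w w.2 (fun h' => h (Subtype.ext h')))
    (fun v w h => ho _ _ (fun h' => h (hf h')))
    (fun v => (h1 v v.2).1.2.2.2.trans (hs _)) ?_ (fun v => hG _)
  rw [key, Subtype.range_coe]
  exact hP

/-- abelian, relative to the masa -/
def AbA (N A : Subring R) (g : R) : Prop := ∀ a ∈ N, g * (a * g) ∈ A

theorem nonab {N A : Subring R} (C : Ctx N A) {g0 : R} (hg : Pj g0) (hgA : g0 ∈ A)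
    (h : ¬ AbA N A g0) : ∃ h ∈ A, Pj h ∧ g0 * h = h ∧ ∃ a ∈ N, h * (a * (g0 - h)) ≠ 0 := by
  unfold AbA at h
  push Not at h
  obtain ⟨a, ha, hx⟩ := h
  have hgN := C.hAN hgA
  have hxN : g0 * (a * g0) ∈ N := N.mul_mem hgN (N.mul_mem ha hgN)
  have xg : g0 * (a * g0) * g0 = g0 * (a * g0) := by simp only [mul_assoc, hg.2]
  have gx : g0 * (g0 * (a * g0)) = g0 * (a * g0) := by simp only [asc hg.2]
  generalize g0 * (a * g0) = x at *
  have : ∃ b ∈ A, x * b ≠ b * x := by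
    by_contra hne
    push Not at hne
    exact hx (C.hm x hxN hne)
  obtain ⟨b, hb, hxb⟩ := this
  have : ∃ p, Pj p ∧ p ∈ A ∧ x * p ≠ p * x := by
    by_contra hne
    push Not at hne
    apply hxb
    apply KAx.spec
    intro p hp hp'
    apply hne p hp
    apply C.hA.dc
    intro t ht
    exact hp' t (ht b hb) (ht _ (C.hA.star_mem hb))
  obtain ⟨p, hp, hpA, hxp⟩ := this
  have hc := C.hAc _ hgA _ hpA
  refine ⟨g0 * p, A.mul_mem hgA hpA, hg.mul hp hc, asc hg.2 p, ?_⟩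
  by_contra hne
  push Not at hne
  have hh := hg.mul hp hc
  have gh : g0 * (g0 * p) = g0 * p := asc hg.2 p
  have k1 := hne x hxN
  have k2 := congrArg star (hne (star x) (C.hN.star_mem hxN))
  simp only [star_mul, star_sub, star_star, star_zero] at k2
  rw [← star_mul, hh.1, hg.1] at k2
  rw [mul_sub, xg, mul_sub, sub_eq_zero] at k1
  rw [sub_mul, sub_mul, mul_assoc, asc gx, sub_eq_zero, mul_assoc, ← k1] at k2
  apply hxp
  rwa [← mul_assoc, xg, hc, mul_assoc, gx] at k2

theorem lemH {N A : Subring R} (C : Ctx N A) {p : R} (hp : Pj p) (hpA : p ∈ A)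
    (hna : ∀ g ∈ A, Pj g → p * g = g → AbA N A g → g = 0) :
    ∃ g ∈ A, Pj g ∧ p * g = g ∧ ∀ z, Cent N z → (z * g = 0 → z * p = 0) ∧
      (z * (p - g) = 0 → z * p = 0) := by
  classical
  have hN := C.hN
  obtain ⟨V, h1, h2, h3⟩ := exists_max_pj (fun z : R => Cent N z ∧ ∃ g ∈ A, Pj g ∧ p * g = g ∧
    z * g = g ∧ ∀ y, Cent N y → (y * g = 0 → y * z = 0) ∧ (y * (z * p - g) = 0 → y * z = 0))
    (fun p hp => hp.1.1)
  have hq := rp_spec V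
  have hqc := cent_rp hN (V := V) (fun v hv => (h1 v hv).1.1)
  have hV : ∀ v : V, ∃ g ∈ A, Pj g ∧ p * g = g ∧
    (v : R) * g = g ∧ ∀ y, Cent N y → (y * g = 0 → y * v = 0) ∧ (y * (v * p - g) = 0 → y * v = 0) :=
    fun v => (h1 v v.2).1.2
  choose g gA gP pg vg hy using hV
  have hg := rp_spec (Set.range g)
  have hgA := hg.mem C.hA (by rintro _ ⟨v, rfl⟩; exact gA v)
  have hzg : ∀ v : V, (v : R) * rp (Set.range g) = g v := by
    intro v
    have e1 := hg.2.2 (v - g v) (by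
      rintro _ ⟨w, rfl⟩
      by_cases hvw : v = w
      · subst hvw; rw [sub_mul, vg, (gP v).2, sub_self]
      · have := h2 v v.2 w w.2 (fun h' => hvw (Subtype.ext h'))
        rw [← vg w, sub_mul, asc0 this, ← flp (h1 v v.2).1.1.1.1 (gP v).1 (vg v), mul_assoc,
          asc0 this, mul_zero, sub_self])
    rw [sub_mul, sub_eq_zero] at e1
    rw [e1]
    exact flp hg.1.1 (gP v).1 (hg.2.1 _ ⟨v, rfl⟩)
  have hpg : p * rp (Set.range g) = rp (Set.range g) := hg.fix (by rintro _ ⟨v, rfl⟩; exact pg v)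
  have hpq : (1 - rp V) * p = 0 := by
    by_contra hne
    have hPj : Pj ((1 - rp V) * p) := hqc.one_sub.pj_mul hp (C.hAN hpA)
    have hmA : (1 - rp V) * p ∈ A := A.mul_mem (C.cent hqc.one_sub) hpA
    have hple : p * ((1 - rp V) * p) = (1 - rp V) * p := by
      rw [← mul_assoc, ← hqc.one_sub.comm (C.hAN hpA), mul_assoc, hp.2]
    have hqq := hqc.one_sub.pj.2
    obtain ⟨h, hhA, hh, hgh, a, ha, hne2⟩ := nonab C hPj hmA (fun hab => hne (hna _ hmA hPj hple hab))
    have hph : p * h = h := by rw [← hgh, ← mul_assoc, hple]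
    have hqh : (1 - rp V) * h = h := by
      calc (1 - rp V) * h = (1 - rp V) * ((1 - rp V) * p * h) := by rw [hgh]
        _ = h := by rw [← mul_assoc, ← mul_assoc, hqq, hgh]
    have hhN := C.hAN hhA
    have hdN : (1 - rp V) * p - h ∈ N := N.sub_mem (C.hAN hmA) hhN
    have c1 := cs_cent hN hhN
    have c2 := cs_cent hN hdN
    have cy := c1.mul c2
    have m1 := cs_mul (N := N) (e := h)
    have m2 := cs_mul (N := N) (e := (1 - rp V) * p - h)
    have yq : (1 - rp V) * (cs N h * cs N ((1 - rp V) * p - h)) =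
       cs N h * cs N ((1 - rp V) * p - h) := by
      rw [← mul_assoc, cs_min hqc.one_sub hqh]
    have y1 : ∀ x, Cent N x → x * (cs N h * cs N ((1 - rp V) * p - h) * h) = 0 →
        x * (cs N h * cs N ((1 - rp V) * p - h)) = 0 := by
      intro x hx h0
      have := cs_zero (hx.mul cy) (by rw [mul_assoc, h0])
      rw [c1.comm c2.mem, mul_assoc, mul_assoc, c1.pj.2] at this
      rw [c1.comm c2.mem]; exact this
    have y2 : ∀ x, Cent N x →
        x * (cs N h * cs N ((1 - rp V) * p - h) * ((1 - rp V) * p - h)) = 0 →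
        x * (cs N h * cs N ((1 - rp V) * p - h)) = 0 := by
      intro x hx h0
      have := cs_zero (hx.mul cy) (by rw [mul_assoc, h0])
      rw [mul_assoc, mul_assoc, c2.pj.2] at this
      exact this
    have y0 : cs N h * cs N ((1 - rp V) * p - h) = 0 := by
      apply h3
      · refine ⟨cy, cs N h * cs N ((1 - rp V) * p - h) * h, A.mul_mem (C.cent cy) hhA,
          cy.pj_mul hh hhN, ?_, asc cy.pj.2 h, fun x hx => ⟨y1 x hx, fun h0 => y2 x hx ?_⟩⟩
        · rw [← mul_assoc, ← cy.comm (C.hAN hpA), mul_assoc, hph]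
        · rw [mul_sub, ← mul_assoc _ (1 - rp V), ← hqc.one_sub.comm cy.mem, yq]; exact h0
      · intro v hv
        rw [← yq, ← mul_assoc, mul_sub, mul_one, flp hq.1.1 (h1 v hv).1.1.1.1 (hq.2.1 v hv),
          sub_self, zero_mul]
    apply hne2
    have e1 : h * (a * ((1 - rp V) * p - h)) = (cs N h * h) *
        (a * (cs N ((1 - rp V) * p - h) * ((1 - rp V) * p - h))) := by rw [m1, m2]
    rw [e1, c1.comm hhN, mul_assoc, ← mul_assoc a, ← c2.comm ha, mul_assoc (cs N ((1 - rp V) * p - h)),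
      ← mul_assoc (cs N h), y0]
    simp
  have hqp : rp V * p = p := by
    rw [sub_mul, one_mul, sub_eq_zero] at hpq; exact hpq.symm
  refine ⟨rp (Set.range g), hgA, hg.1, hpg, fun z hz => ?_⟩
  suffices h : (∀ v : V, z * v = 0) → z * p = 0 by
    constructor
    · intro h0
      refine h (fun v => (hy v z hz).1 ?_)
      rw [← hzg, ← mul_assoc, hz.comm (h1 v v.2).1.1.mem, mul_assoc, h0, mul_zero]
    · intro h0
      refine h (fun v => (hy v z hz).2 ?_)
      rw [← hzg, ← mul_sub, ← mul_assoc, hz.comm (h1 v v.2).1.1.mem, mul_assoc, h0, mul_zero]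
  intro hv
  rw [← hqp, ← mul_assoc, hq.2.2 z (fun v hv' => hv ⟨v, hv'⟩), zero_mul]

theorem seq_of_step (T Q : R → Prop) (p : R) (hTp : T p) (hTP : ∀ q, T q → Pj q)
    (hstep : ∀ q, T q → ∃ g, Q g ∧ Pj g ∧ q * g = g ∧ T (q - g)) :
    ∃ g : ℕ → R, (∀ k, Q (g k) ∧ Pj (g k) ∧ p * g k = g k) ∧ ∀ i j, i ≠ j → g i * g j = 0 := by
  choose! F hQ hP hF hT using hstep
  obtain ⟨q, q0, qs⟩ : ∃ q : ℕ → R, q 0 = p ∧ ∀ k, q (k + 1) = q k - F (q k) :=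
    ⟨fun k => Nat.rec p (fun _ x => x - F x) k, rfl, fun k => rfl⟩
  have hq : ∀ k, T (q k) := by
    intro k
    induction k with
    | zero => rw [q0]; exact hTp
    | succ k ih => rw [qs]; exact hT _ ih
  have hle : ∀ j d, q j * q (j + d) = q (j + d) := by
    intro j d
    induction d with
    | zero => exact (hTP _ (hq j)).2
    | succ d ih =>
      rw [← add_assoc, qs, mul_sub, ih]
      congr 1
      rw [← hF _ (hq (j + d)), ← mul_assoc, ih]
  have hlt : ∀ j d, F (q j) * F (q (j + 1 + d)) = 0 := by
    intro j d
    have a1 : q (j + 1) * F (q (j + 1 + d)) = F (q (j + 1 + d)) := by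
      rw [← hF _ (hq (j + 1 + d)), ← mul_assoc, hle (j + 1) d]
    rw [← a1, qs, ← mul_assoc, mul_sub, (hP _ (hq j)).2,
      flp (hTP _ (hq j)).1 (hP _ (hq j)).1 (hF _ (hq j)), sub_self, zero_mul]
  refine ⟨fun k => F (q k), fun k => ⟨hQ _ (hq k), hP _ (hq k), ?_⟩, ?_⟩
  · dsimp only
    have := hle 0 k
    rw [zero_add, q0] at this
    rw [← hF _ (hq k), ← mul_assoc, this]
  · intro i j hij
    rcases lt_or_gt_of_ne hij with h | h
    · obtain ⟨d, rfl⟩ := Nat.exists_eq_add_of_le (Nat.succ_le_of_lt h)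
      exact hlt i d
    · obtain ⟨d, rfl⟩ := Nat.exists_eq_add_of_le (Nat.succ_le_of_lt h)
      exact flp0 (hP _ (hq _)).1 (hP _ (hq _)).1 (hlt j d)

theorem seqH {N A : Subring R} (C : Ctx N A) {p : R} (hp : Pj p) (hpA : p ∈ A)
    (hna : ∀ g ∈ A, Pj g → p * g = g → AbA N A g → g = 0) :
    ∃ g : ℕ → R, (∀ k, (g k ∈ A ∧ ∀ z, Cent N z → z * g k = 0 → z * p = 0) ∧ Pj (g k) ∧
      p * g k = g k) ∧ ∀ i j, i ≠ j → g i * g j = 0 := by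
  refine seq_of_step (fun q => q ∈ A ∧ Pj q ∧ p * q = q ∧ ∀ z, Cent N z → z * q = 0 → z * p = 0)
    (fun g => g ∈ A ∧ ∀ z, Cent N z → z * g = 0 → z * p = 0) p
    ⟨hpA, hp, hp.2, fun z _ h => h⟩ (fun q h => h.2.1) ?_
  rintro q ⟨hqA, hq, hpq, hz⟩
  obtain ⟨g, hgA, hg, hqg, h⟩ := lemH C hq hqA (fun g hgA hg hqg => hna g hgA hg (by
    rw [← hqg, ← mul_assoc, hpq]))
  refine ⟨g, ⟨hgA, fun z hzc h0 => hz z hzc ((h z hzc).1 h0)⟩, hg, hqg, A.sub_mem hqA hgA,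
    hq.sub hg hqg, ?_, fun z hzc h0 => hz z hzc ((h z hzc).2 h0)⟩
  rw [mul_sub, hpq, ← hqg, ← mul_assoc, hpq]

theorem lemX {N A : Subring R} (C : Ctx N A) {p e' : R} (hp : Pj p) (hpA : p ∈ A) (he : Pj e')
    (hem : e' ∈ N) (hne : cs N p * e' ≠ 0)
    (hno : ∀ g ∈ A, Pj g → p * g = g → Sq N g e' → g = 0) :
    ∃ g : ℕ → R, (∀ k, g k ∈ A ∧ Pj (g k) ∧ p * g k = g k) ∧ (∀ i j, i ≠ j → g i * g j = 0) ∧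
      ∃ e ∈ N, Pj e ∧ e ≠ 0 ∧ e' * e = e ∧ ∀ k, Sq N e (g k) := by
  have hN := C.hN
  have hpN := C.hAN hpA
  have hc := cs_cent hN hem
  have hcp := cs_cent hN hpN
  have hce := cs_mul (N := N) (e := e')
  have hp1 : Pj (cs N e' * p) := hc.pj_mul hp hpN
  have hp1A : cs N e' * p ∈ A := A.mul_mem (C.cent hc) hpA
  have hpp1 : p * (cs N e' * p) = cs N e' * p := by
    rw [← mul_assoc, ← hc.comm hpN, mul_assoc, hp.2]
  have hle : ∀ g, cs N e' * p * g = g → p * g = g := by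
    intro g h
    rw [← h, ← mul_assoc, hpp1]
  have key : ∀ g ∈ A, Pj g → cs N e' * p * g = g → Sq N (cs N g * e') g := by
    intro g hgA hg hpg
    obtain ⟨z, hz, s1, s2⟩ := compare hN he hg hem (C.hAN hgA)
    have h0 : (1 - z) * g = 0 := by
      apply hno _ (A.mul_mem (C.cent hz.one_sub) hgA) (hz.one_sub.pj_mul hg (C.hAN hgA))
      · rw [← mul_assoc, ← hz.one_sub.comm hpN, mul_assoc, hle g hpg]
      · refine s2.mono ?_
        rw [← mul_assoc, ← hz.one_sub.comm hem, mul_assoc, he.2]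
    rw [sub_mul, one_mul, sub_eq_zero] at h0
    have h1 := cs_min hz h0.symm
    have := s1.cmul (cs_cent hN (C.hAN hgA))
    rwa [← h0, cs_mul, ← mul_assoc, ← hz.comm (cs_cent hN (C.hAN hgA)).mem, h1] at this
  obtain ⟨g, hg, hgo⟩ := seqH C hp1 hp1A (by
    intro g hgA hg hpg hab
    by_contra hg0
    have hgN := C.hAN hgA
    have : ∃ a ∈ N, g * (a * e') ≠ 0 := by
      by_contra hn
      push Not at hn
      have := cs_ann hn
      apply hg0
      have cg : cs N e' * g = g := by rw [← hpg, ← mul_assoc, ← mul_assoc, hc.pj.2]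
      rw [← hc.comm hgN, cg] at this
      exact this
    obtain ⟨a, ha, hna⟩ := this
    obtain ⟨u, huN, hu0, hup, hu1, hu2⟩ := polar_pair hN he hg hem hgN ha hna
    apply hu0
    apply eq_zero_of_star
    have hus : star u * g = star u := by
      have := congrArg star hu2
      rwa [star_mul, hg.1] at this
    apply hno
    · have := hab (u * star u) (N.mul_mem huN (hN.star_mem huN))
      rwa [mul_assoc, hus, ← mul_assoc, hu2] at this
    · exact pj_range hup rfl
    · rw [← hu2, ← mul_assoc, ← mul_assoc, hle g hpg]
    · refine ⟨star u, hN.star_mem huN, by simp, ?_⟩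
      have := congrArg star hu1
      rwa [star_mul, he.1] at this)
  have hc1 := cs_cent hN (C.hAN hp1A)
  refine ⟨g, fun k => ⟨(hg k).1.1, (hg k).2.1, hle _ (hg k).2.2⟩, hgo, cs N (cs N e' * p) * e',
    N.mul_mem hc1.mem hem, hc1.pj_mul he hem, ?_, ?_, ?_⟩
  · intro h0
    have h1 := cs_zero hc1 h0
    have h2 : cs N e' * p = 0 := by
      rw [← cs_mul (N := N) (e := cs N e' * p), ← mul_assoc, h1, zero_mul]
    have h3 := cs_zero hc h2
    apply hne
    rw [← hce, ← mul_assoc, ← hc.comm hcp.mem, h3, zero_mul]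
  · rw [← mul_assoc, ← hc1.comm hem, mul_assoc, he.2]
  · intro k
    have hgc := cs_cent hN (C.hAN (hg k).1.1)
    have h1 : cs N (g k) * cs N (cs N e' * p) = cs N (cs N e' * p) := by
      apply cs_min hgc
      have := (hg k).1.2 _ hgc.one_sub (by rw [sub_mul, cs_mul, one_mul, sub_self])
      rw [sub_mul, one_mul, sub_eq_zero] at this
      exact this.symm
    have := (key _ (hg k).1.1 (hg k).2.1 (hg k).2.2).cmul hc1
    rw [← mul_assoc, ← hgc.comm hc1.mem, h1] at this
    refine this.mono ?_
    rw [← mul_assoc, ← hc1.comm (C.hAN (hg k).1.1), mul_assoc, (hg k).2.1.2]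

end alg4
end KD
namespace KD

section alg5

set_option linter.unusedSectionVars false
set_option linter.unusedVariables false

variable {R : Type*} [Ring R] [StarRing R] [KAx R]

/-- an infinite sequence of orthogonal projections in `M` dominating a nonzero projection below
`c` -/
def InfSeq (N M : Subring R) (c : R) : Prop := ∃ g : ℕ → R, (∀ k, g k ∈ M ∧ Pj (g k)) ∧
  (∀ i j, i ≠ j → g i * g j = 0) ∧ ∃ x ∈ N, Pj x ∧ x ≠ 0 ∧ c * x = x ∧ ∀ k, Sq N x (g k)

theorem InfSeq.mono {N M : Subring R} {c d : R} (h : InfSeq N M c) (hd : d * c = c) :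
    InfSeq N M d := by
  obtain ⟨g, h1, h2, x, h3, h4, h5, h6, h7⟩ := h
  exact ⟨g, h1, h2, x, h3, h4, h5, by rw [← h6, ← mul_assoc, hd], h7⟩

/-- local goal -/
def Qz (N A : Subring R) {ι : Type*} (e : ι → R) (z : R) : Prop :=
  ∃ u ∈ N, star u * u = z ∧ u * star u = z ∧ ∀ i, star u * e i * u ∈ A

theorem iso_seq {N : Subring R} (hN : IsVN N) {c y : R} (hc : Pj c) (hcN : c ∈ N) (hy : y ∈ N)
    (h1 : star y * y = c) (h2 : c * y = y) (hfin : ¬ InfSeq N N c) : y * star y = c := by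
  by_contra hne
  apply hfin
  have hyp := pj_range hc h1
  have hyy : c * (y * star y) = y * star y := by rw [← mul_assoc, h2]
  have hx := hc.sub hyp hyy
  have hcx : c * (c - y * star y) = c - y * star y := by rw [mul_sub, hc.2, hyy]
  have hxy : (c - y * star y) * y = 0 := by
    rw [sub_mul, h2, mul_assoc, h1, pi_right hc h1, sub_self]
  have hxN : c - y * star y ∈ N := N.sub_mem hcN (N.mul_mem hy (hN.star_mem hy))
  have hx0 : c - y * star y ≠ 0 := fun h => hne (sub_eq_zero.1 h).symm
  generalize c - y * star y = x at *
  have hcy : ∀ k s, c * s = s → c * (y ^ k * s) = y ^ k * s := by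
    intro k s hs
    cases k with
    | zero => simpa using hs
    | succ k => rw [pow_succ', mul_assoc, asc h2]
  have hcan : ∀ k s, c * s = s → star (y ^ k) * (y ^ k * s) = s := by
    intro k
    induction k with
    | zero => intro s hs; simp
    | succ k ih =>
      intro s hs
      rw [pow_succ', star_mul, mul_assoc, mul_assoc, asc h1, hcy k s hs, ih s hs]
  have hlt : ∀ j d, star (y ^ j * x) * (y ^ (j + 1 + d) * x) = 0 := by
    intro j d
    rw [star_mul, add_assoc, pow_add, mul_assoc, mul_assoc, hcan j _ (hcy _ _ hcx), hx.1,
      add_comm 1 d, pow_succ', mul_assoc, asc0 hxy]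
  have hss : ∀ k, star (y ^ k * x) * (y ^ k * x) = x := by
    intro k
    rw [star_mul, mul_assoc, hcan k _ hcx, hx.1, hx.2]
  have hmem : ∀ k, y ^ k * x ∈ N := fun k => N.mul_mem (N.pow_mem hy k) hxN
  refine ⟨fun k => (y ^ k * x) * star (y ^ k * x),
    fun k => ⟨N.mul_mem (hmem k) (hN.star_mem (hmem k)), pj_range hx (hss k)⟩, ?_,
    x, hxN, hx, hx0, hcx, fun k => ⟨y ^ k * x, hmem k, hss k, ?_⟩⟩
  · intro i j hij
    have : star (y ^ i * x) * (y ^ j * x) = 0 := by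
      rcases lt_or_gt_of_ne hij with h | h
      · obtain ⟨d, rfl⟩ := Nat.exists_eq_add_of_le (Nat.succ_le_of_lt h)
        exact hlt i d
      · obtain ⟨d, rfl⟩ := Nat.exists_eq_add_of_le (Nat.succ_le_of_lt h)
        have := congrArg star (hlt j d)
        rwa [star_mul, star_star, star_zero] at this
    dsimp only
    rw [mul_assoc, asc0 this, mul_zero]
  · rw [mul_assoc, hss k, mul_assoc, hx.2]

theorem local_fin {N A : Subring R} (C : Ctx N A) {ι : Type*} (e : ι → R) (he : ∀ i, Pj (e i))
    (hem : ∀ i, e i ∈ N)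
    (heo : ∀ i j, i ≠ j → e i * e j = 0) (hsep : ∀ y, (∀ i, y * e i = 0) → y = 0) {z0 : R}
    (hz : Cent N z0) (hfin : ¬ InfSeq N N z0) : Qz N A e z0 := by
  have hN := C.hN
  obtain ⟨w, hwN, hwA, hwp, hzw, hA, hec, hy, hmax⟩ := lemM hN C.hA C.hAN hz.pj (C.cent hz) e he heo
  have hwr := pi_right hwp rfl
  have hz0w : z0 * w = w := by
    rw [hz.comm hwN, ← hwr, mul_assoc, flp hz.pj.1 hwp.1 hzw]
  have hws := hN.star_mem hwN
  by_cases hf : star w * w = z0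
  · exact ⟨w, hwN, hf, iso_seq hN hz.pj hz.mem hwN hf hz0w hfin, hA⟩
  exfalso
  have hp := hz.pj.sub hwp hzw
  have hpA : z0 - star w * w ∈ A := A.sub_mem (C.cent hz) hwA
  have hp0 : z0 - star w * w ≠ 0 := fun h => hf (sub_eq_zero.1 h).symm
  have hzp : z0 * (z0 - star w * w) = z0 - star w * w := by rw [mul_sub, hz.pj.2, hzw]
  have hpN := C.hAN hpA
  have hc := cs_cent hN hpN
  by_cases hX : ∃ i, cs N (z0 - star w * w) * (e i - e i * (w * star w)) ≠ 0
  · obtain ⟨i, hi⟩ := hX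
    have hpi : Pj (e i - e i * (w * star w)) := by
      have := (he i).mul (pj_range hwp rfl).one_sub (by rw [mul_sub, sub_mul, hec, mul_one, one_mul])
      rwa [mul_sub, mul_one] at this
    obtain ⟨g, h1, h2, x, h3, h4, h5, h6, h7⟩ := lemX C hp hpA hpi
      (N.sub_mem (hem i) (N.mul_mem (hem i) (N.mul_mem hwN hws))) hi
      (fun g hgA hg hpg hs => hmax i g hgA hg hpg hs)
    refine hfin ⟨g, fun k => ⟨C.hAN (h1 k).1, (h1 k).2.1⟩, h2, x, h3, h4, h5, ?_, h7⟩
    obtain ⟨v, hv, v1, v2⟩ := h7 0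
    have : z0 * v = v := by
      rw [← v2, ← mul_assoc]
      congr 1
      rw [← (h1 0).2.2, ← mul_assoc, hzp]
    rw [← v1, ← mul_assoc, hz.comm (hN.star_mem hv), mul_assoc, this]
  · push Not at hX
    have h1 : cs N (z0 - star w * w) * (w * star w) = cs N (z0 - star w * w) := by
      have := hsep (cs N (z0 - star w * w) * (1 - w * star w)) (fun i => by
        have := hX i
        rw [hec] at this
        rwa [mul_assoc, sub_mul, one_mul])
      rw [mul_sub, mul_one, sub_eq_zero] at this
      exact this.symm
    have hzc := cs_min hz hzp
    have hyy := iso_seq hN hc.pj hc.mem (y := cs N (z0 - star w * w) * star w)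
      (N.mul_mem hc.mem hws) (by
        rw [star_mul, star_star, hc.pj.1, mul_assoc, asc hc.pj.2, ← mul_assoc, ← hc.comm hwN,
          mul_assoc, h1]) (asc hc.pj.2 _) (fun h => hfin (h.mono hzc))
    rw [star_mul, star_star, hc.pj.1, mul_assoc, ← hc.comm hwN, ← mul_assoc (star w),
      ← hc.comm hws, mul_assoc, asc hc.pj.2] at hyy
    apply hp0
    rw [← cs_mul (N := N) (e := z0 - star w * w), mul_sub, hyy, ← hz.comm hc.mem, hzc, sub_self]

/-- no central projection below `z1` is dominated by `E` -/
def NB (N : Subring R) (z1 E : R) : Prop := ∀ z, Cent N z → z1 * z = z → Sq N z E → z = 0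

theorem lemS {N : Subring R} (hN : IsVN N) {z1 G E F : R} (hG : Pj G) (hGN : G ∈ N)
    (s1 : Sq N z1 G) (s2 : Sq N z1 (1 - G)) (hE : Pj E) (hF : Pj F) (hEN : E ∈ N) (hFN : F ∈ N)
    (ho : E * F = 0) (nE : NB N z1 E) (nF : NB N z1 F) : NB N z1 (E + F) := by
  rintro z hz hz1 ⟨v, hv, v1, v2⟩
  have hvs := hN.star_mem hv
  have hz1' : z * z1 = z := by
    have := hz1
    obtain ⟨s, hs, h1, h2⟩ := s1
    have hst : star z1 = z1 := by rw [← h1]; simp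
    exact flp hst hz.pj.1 hz1
  have hvz := pi_right hz.pj v1
  have hG1 : Pj (v * G * star v) := by
    refine ⟨by simp [hG.1, mul_assoc], ?_⟩
    simp only [mul_assoc, asc v1]
    rw [← mul_assoc G z, ← hz.comm hGN, mul_assoc z, asc hG.2, asc hvz]
  have hEF := hE.add hF ho
  have hle : (E + F) * (v * G * star v) = v * G * star v := by
    rw [← mul_assoc, ← mul_assoc, v2]
  have hH1 := hEF.sub hG1 hle
  have hG1N : v * G * star v ∈ N := N.mul_mem (N.mul_mem hv hGN) hvs
  have hH1N : E + F - v * G * star v ∈ N := N.sub_mem (N.add_mem hEN hFN) hG1N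
  have a1 : Sq N z (v * G * star v) := by
    have := s1.cmul hz
    rw [hz1'] at this
    obtain ⟨s, hs, h1, h2⟩ := this
    have hzs : z * s = s := by rw [← h2, ← mul_assoc, ← mul_assoc, hz.pj.2]
    refine ⟨v * s, N.mul_mem hv hs, ?_, ?_⟩
    · rw [star_mul, mul_assoc, asc v1, hzs, h1]
    · rw [mul_assoc, asc v1, hzs, mul_assoc]
      congr 1
      conv_lhs => rw [← hzs]
      rw [← mul_assoc, ← hz.comm hGN, h2]
  have a2 : Sq N z (E + F - v * G * star v) := by
    have := s2.cmul hz
    rw [hz1'] at this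
    obtain ⟨s, hs, h1, h2⟩ := this
    have hzs : z * s = s := by rw [← h2, ← mul_assoc, ← mul_assoc, hz.pj.2]
    have hGs : G * s = 0 := by
      rw [← h2, hz.comm (N.sub_mem N.one_mem hGN), mul_assoc, ← mul_assoc, mul_sub, hG.2]
      simp
    refine ⟨v * s, N.mul_mem hv hs, ?_, ?_⟩
    · rw [star_mul, mul_assoc, asc v1, hzs, h1]
    · rw [sub_mul, ← mul_assoc, v2, mul_assoc, asc v1, hzs, mul_assoc, hGs]
      simp
  obtain ⟨y, hy, b1, b2⟩ := PL hN hE hF hG1 hH1 hEN hFN hG1N hH1N ho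
    (by rw [mul_sub, hG1.2, flp hEF.1 hG1.1 hle, sub_self]) (by abel)
  have c1 : y * z = 0 := by
    apply nF _ (hy.mul hz)
    · rw [hy.comm hz.mem, ← mul_assoc, hz1]
    · refine ((a1.cmul hy).trans b1).mono ?_
      rw [← mul_assoc, ← hy.comm hFN, mul_assoc, hF.2]
  have c2 : (1 - y) * z = 0 := by
    apply nE _ (hy.one_sub.mul hz)
    · rw [hy.one_sub.comm hz.mem, ← mul_assoc, hz1]
    · refine ((a2.cmul hy.one_sub).trans b2).mono ?_
      rw [← mul_assoc, ← hy.one_sub.comm hEN, mul_assoc, hE.2]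
  rw [sub_mul, c1, one_mul, sub_zero] at c2
  exact c2

theorem seqA {N A : Subring R} (C : Ctx N A) {z1 G : R} (hz : Cent N z1) (hz0 : z1 ≠ 0)
    (hG : Pj G) (hGN : G ∈ N) (s1 : Sq N z1 G) (s2 : Sq N z1 (1 - G)) : InfSeq N A z1 := by
  have hN := C.hN
  by_cases hcase : ∃ e ∈ N, Pj e ∧ e ≠ 0 ∧ z1 * e = e ∧ NB N z1 e
  · obtain ⟨e, heN, he, he0, hze, hNB⟩ := hcase
    by_contra hcon
    have := seq_of_step (fun q => q ∈ A ∧ Pj q ∧ z1 * q = q ∧ NB N z1 (z1 - q))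
      (fun g => g ∈ A ∧ Sq N e g) z1 ⟨C.cent hz, hz.pj, hz.pj.2, by
        rintro z hzc hz1 ⟨v, hv, v1, v2⟩
        rw [sub_self, zero_mul] at v2
        rw [← v1, ← v2, mul_zero]⟩ (fun q h => h.2.1) (by
      rintro q ⟨hqA, hq, hzq, hNq⟩
      obtain ⟨w, hwN, hwA, hwp, hqw, -, hec, hy, hmax⟩ := lemM hN C.hA C.hAN hq hqA
        (fun _ : Unit => e) (fun _ => he) (by intro i j h; exact absurd rfl h)
      have hqN := C.hAN hqA
      have hew : e * w = w := by
        have := hy (e - 1) (by intro _; rw [sub_mul, he.2, one_mul, sub_self])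
        rwa [sub_mul, one_mul, sub_eq_zero] at this
      have hws := hN.star_mem hwN
      have hwr := pi_right hwp rfl
      have hNf : NB N z1 (star w * w) := fun z a b c => hNB z a b (c.trans ⟨w, hwN, rfl, hew⟩)
      have hzf : z1 * (star w * w) = star w * w := by rw [← hqw, ← mul_assoc, hzq]
      have hNp : NB N z1 (z1 - (q - star w * w)) := by
        have := lemS hN hG hGN s1 s2 (hz.pj.sub hq hzq) hwp (N.sub_mem hz.mem hqN)
          (N.mul_mem hws hwN) (by rw [sub_mul, hzf, hqw, sub_self]) hNq hNf
        rwa [sub_add] at this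
      have hp := hq.sub hwp hqw
      have hpA : q - star w * w ∈ A := A.sub_mem hqA hwA
      have hpN := C.hAN hpA
      have hzp : z1 * (q - star w * w) = q - star w * w := by rw [mul_sub, hzq, hzf]
      refine ⟨star w * w, ⟨hwA, ?_⟩, hwp, hqw, hpA, hp, hzp, hNp⟩
      have heww : e * (w * star w) = w * star w := by rw [← mul_assoc, hew]
      rw [heww] at hmax
      by_cases he' : e - w * star w = 0
      · rw [sub_eq_zero] at he'
        exact ⟨star w, hws, by rw [star_star]; exact he'.symm, by rw [mul_assoc, ← he']; rw [he', ← mul_assoc]; exact pi_left hwp rfl⟩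
      exfalso
      apply hcon
      have hc := cs_cent hN hpN
      have hzc := cs_min hz hzp
      have hcs : z1 - cs N (q - star w * w) = 0 := by
        have hpj := hz.pj.sub hc.pj hzc
        apply hNp _ (hz.sub hc hzc)
        · rw [mul_sub, hzc, hz.pj.2]
        · apply Sq.of_le hpj (N.sub_mem hz.mem hc.mem)
          rw [sub_mul, mul_sub, mul_sub, hzc, hz.pj.2, ← hz.comm hpN, hzp, ← hc.comm hpN, cs_mul]
          simp
      rw [sub_eq_zero] at hcs
      have hee := he.sub (pj_range hwp rfl) heww
      have hze' : z1 * (e - w * star w) = e - w * star w := by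
        have : z1 * w = w := by rw [← hew, ← mul_assoc, hze]
        rw [mul_sub, hze, ← mul_assoc, this]
      obtain ⟨g, h1, h2, x, h3, h4, h5, h6, h7⟩ := lemX C hp hpA hee
        (N.sub_mem heN (N.mul_mem hwN hws)) (by rw [← hcs, hze']; exact he')
        (fun g hgA hg hpg hs => hmax () g hgA hg hpg hs)
      exact ⟨g, fun k => ⟨(h1 k).1, (h1 k).2.1⟩, h2, x, h3, h4, h5,
        by rw [← h6, ← mul_assoc, hze'], h7⟩)
    obtain ⟨g, h1, h2⟩ := this
    exact hcon ⟨g, fun k => ⟨(h1 k).1.1, (h1 k).2.1⟩, h2, e, heN, he, he0, hze,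
      fun k => (h1 k).1.2⟩
  · have hbig : ∀ e ∈ N, Pj e → e ≠ 0 → z1 * e = e →
        ∃ z, Cent N z ∧ z1 * z = z ∧ Sq N z e ∧ z ≠ 0 := by
      intro e heN he he0 hze
      by_contra hn
      push Not at hn
      exact hcase ⟨e, heN, he, he0, hze, fun z a b c => hn z a b c⟩
    obtain ⟨g, hg, hgo⟩ := seqH C hz.pj (C.cent hz) (by
      intro g hgA hg hzg hab
      by_contra hg0
      obtain ⟨z, hzc, hzz, ⟨s, hs, hs1, hs2⟩, hzn⟩ := hbig g (C.hAN hgA) hg hg0 hzg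
      have hzz' := flp hz.pj.1 hzc.pj.1 hzz
      have t1 := s1.cmul hzc
      have t2 := s2.cmul hzc
      rw [hzz'] at t1 t2
      obtain ⟨t, ht, ht1, ht2⟩ := t1
      obtain ⟨t', ht', ht1', ht2'⟩ := t2
      have zt : z * t = t := by rw [← ht2, ← mul_assoc, ← mul_assoc, hzc.pj.2]
      have zt' : z * t' = t' := by rw [← ht2', ← mul_assoc, ← mul_assoc, hzc.pj.2]
      have Gt' : G * t' = 0 := by
        rw [← ht2', hzc.comm (N.sub_mem N.one_mem hGN), mul_assoc, ← mul_assoc, mul_sub, hG.2]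
        simp
      have tt' : star t * t' = 0 := by
        rw [← ht2, star_mul, mul_assoc, star_mul, hG.1, hzc.pj.1, mul_assoc, zt', Gt', mul_zero]
      have tt : star t' * t = 0 := by simpa using congrArg star tt'
      have gs : star s * g = star s := by
        have := congrArg star hs2
        rwa [star_mul, hg.1] at this
      have hst := N.mul_mem hs ht
      have hst' := N.mul_mem hs ht'
      have hxA : s * t' * star (s * t) ∈ A := by
        have := hab (s * t' * star (s * t)) (N.mul_mem hst' (hN.star_mem hst))
        rwa [star_mul, mul_assoc _ _ g, mul_assoc (star t), gs, ← mul_assoc, ← mul_assoc g, hs2,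
          ← star_mul] at this
      have hcm := C.hAc _ hxA _ (C.hA.star_mem hxA)
      have w1 : star (s * t) * (s * t) = z := by rw [star_mul, mul_assoc, asc hs1, zt, ht1]
      have w2 : star (s * t') * (s * t') = z := by rw [star_mul, mul_assoc, asc hs1, zt', ht1']
      have w3 : star (s * t) * (s * t') = 0 := by rw [star_mul, mul_assoc, asc hs1, zt', tt']
      generalize s * t = w at *
      generalize s * t' = w' at *
      rw [star_mul, star_star, mul_assoc, asc w1, pi_left hzc.pj w2, mul_assoc, asc w2,
        pi_left hzc.pj w1] at hcm
      apply hzn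
      have := congrArg (fun x => star w * (x * w)) hcm
      simp only [mul_assoc, w1] at this
      rw [asc0 w3, pi_right hzc.pj w1, w1] at this
      exact this.symm)
    refine ⟨g, fun k => ⟨(hg k).1.1, (hg k).2.1⟩, hgo, z1, hz.mem, hz.pj, hz0, hz.pj.2, ?_⟩
    intro k
    have hgN := C.hAN (hg k).1.1
    obtain ⟨V, h1, h2, h3⟩ := exists_max_pj (fun z : R => Cent N z ∧ z1 * z = z ∧ Sq N z (g k))
      (fun z h => h.1.1)
    have hP := rp_spec V
    have hPc := cent_rp hN (V := V) (fun v hv => (h1 v hv).1.1)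
    have hzP : z1 * rp V = rp V := hP.fix (fun v hv => (h1 v hv).1.2.1)
    have hdc := hz.sub hPc hzP
    have hzd : z1 * (z1 - rp V) = z1 - rp V := by rw [mul_sub, hzP, hz.pj.2]
    have key : (z1 - rp V) * g k = 0 := by
      by_contra hne
      obtain ⟨z, hzc, hzz, hs, hzn⟩ := hbig _ (N.mul_mem hdc.mem hgN) (hdc.pj_mul (hg k).2.1 hgN) hne
        (by rw [← mul_assoc, hzd])
      apply hzn
      apply h3
      · refine ⟨hzc, hzz, hs.mono ?_⟩
        rw [← mul_assoc, ← hdc.comm hgN, mul_assoc, (hg k).2.1.2]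
      · intro v hv
        obtain ⟨s, hs0, hs1, hs2⟩ := hs
        have hv1 := (h1 v hv).1
        have : v * s = 0 := by
          rw [← hs2, ← mul_assoc, ← mul_assoc, mul_sub, flp hz.pj.1 hv1.1.pj.1 hv1.2.1,
            flp hP.1.1 hv1.1.pj.1 (hP.2.1 v hv), sub_self]
          simp
        rw [← hs1, ← mul_assoc, hv1.1.comm (hN.star_mem hs0), mul_assoc, this, mul_zero]
    have key2 := (hg k).1.2 _ hdc key
    rw [← hz.comm hdc.mem, hzd, sub_eq_zero] at key2
    refine sum_sq hN (p := fun v : V => (v : R)) (f := fun v : V => v * g k)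
      (fun v => (h1 v v.2).1.1.pj) (fun v => (h1 v v.2).1.1.pj_mul (hg k).2.1 hgN)
      (fun v w h => h2 v v.2 w w.2 (fun h' => h (Subtype.ext h'))) ?_ ?_ ?_ ?_
    · intro v w h
      have := h2 v v.2 w w.2 (fun h' => h (Subtype.ext h'))
      rw [(h1 v v.2).1.1.comm hgN, mul_assoc, asc0 this, mul_zero]
    · intro v
      have := (h1 v v.2).1.2.2.cmul (h1 v v.2).1.1
      rwa [(h1 v v.2).1.1.pj.2] at this
    · rw [Subtype.range_coe, key2]; exact hP
    · intro v
      rw [← mul_assoc, ← (h1 v v.2).1.1.comm hgN, mul_assoc, (hg k).2.1.2]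

end alg5
end KD
namespace KD

section alg6

set_option linter.unusedSectionVars false
set_option linter.unusedVariables false

variable {R : Type*} [Ring R] [StarRing R] [KAx R]

theorem rp_orth {X Y : Set R} (h : ∀ x ∈ X, ∀ y ∈ Y, star x * y = 0) : rp X * rp Y = 0 := by
  have hX := rp_spec X
  have hY := rp_spec Y
  have : ∀ y ∈ Y, rp X * y = 0 := by
    intro y hy
    have := hX.2.2 (star y) (fun x hx => by simpa using congrArg star (h x hx y hy))
    have := congrArg star this
    rwa [star_mul, star_star, hX.1.1, star_zero] at this
  exact hY.2.2 _ this

theorem local_inf {N A : Subring R} (C : Ctx N A) {n : ℕ} (e : Fin n → R) (he : ∀ i, Pj (e i))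
    (hem : ∀ i, e i ∈ N)
    (heo : ∀ i j, i ≠ j → e i * e j = 0) (hsum : ∑ i, e i = 1) (heq : ∀ i j, Sq N (e i) (e j))
    {z0 : R} (hz : Cent N z0) (hinf : InfSeq N N z0) :
    ∃ z, Cent N z ∧ z0 * z = z ∧ z ≠ 0 ∧ Qz N A e z := by
  classical
  have hN := C.hN
  obtain ⟨g, h1, h2, x, h3, h4, h5, h6, h7⟩ := hinf
  have hz1 := cs_cent hN h3
  have hz01 := cs_min hz h6
  have hz1n : cs N x ≠ 0 := cs_ne h5
  have hG := rp_spec (Set.range fun k : ℕ => g (2 * k))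
  have hGN := hG.mem hN (by rintro _ ⟨k, rfl⟩; exact (h1 _).1)
  have s1 : Sq N (cs N x) (rp (Set.range fun k : ℕ => g (2 * k))) :=
    lemB C h4 h3 (fun k => (h1 (2 * k)).2) (fun i j hij => h2 _ _ (by omega)) (fun k => h7 _)
      (fun k => hG.2.1 _ ⟨k, rfl⟩)
  have s2 : Sq N (cs N x) (1 - rp (Set.range fun k : ℕ => g (2 * k))) :=
    lemB (g := fun k => g (2 * k + 1)) C h4 h3 (fun k => (h1 (2 * k + 1)).2)
      (fun i j hij => h2 _ _ (by omega)) (fun k => h7 _)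
      (fun k => by
        have := hG.2.2 (g (2 * k + 1)) (by rintro _ ⟨j, rfl⟩; exact h2 _ _ (by omega))
        rw [sub_mul, one_mul, flp0 (h1 _).2.1 hG.1.1 this, sub_zero])
  have hA := seqA C hz1 hz1n hG.1 hGN s1 s2
  generalize rp (Set.range fun k : ℕ => g (2 * k)) = G at *
  generalize cs N x = z1 at *
  have hG := hG.1
  clear h1 h2 h3 h4 h5 h6 h7
  obtain ⟨g, h1, h2, y, h3, h4, h5, h6, h7⟩ := hA
  have hz2 := cs_cent hN h3
  have hz12 := cs_min hz1 h6
  have hz2n : cs N y ≠ 0 := cs_ne h5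
  have hn : 0 < n := by
    rcases Nat.eq_zero_or_pos n with h | h
    · subst h
      exfalso
      apply hz2n
      rw [← mul_one (cs N y), ← hsum]
      simp
    · exact h
  let i0 : Fin n := ⟨0, hn⟩
  have hF : ∀ i : Fin n, IsRp (rp (Set.range fun m : ℕ => g (i + n * m)))
    (Set.range fun m : ℕ => g (i + n * m)) := fun i => rp_spec _
  have hFA : ∀ i : Fin n, rp (Set.range fun m : ℕ => g (i + n * m)) ∈ A := fun i =>
    (hF i).mem C.hA (by rintro _ ⟨k, rfl⟩; exact (h1 _).1)
  have hinj : ∀ (i j : Fin n) (k l : ℕ), (i : ℕ) + n * k = j + n * l → i = j ∧ k = l := by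
    intro i j k l h
    have a1 := congrArg (· % n) h
    simp only [Nat.add_mul_mod_self_left, Nat.mod_eq_of_lt i.2, Nat.mod_eq_of_lt j.2] at a1
    refine ⟨Fin.ext a1, ?_⟩
    rw [a1] at h
    exact Nat.eq_of_mul_eq_mul_left hn (Nat.add_left_cancel h)
  have hFo : ∀ i j : Fin n, i ≠ j → rp (Set.range fun m : ℕ => g (i + n * m)) *
      rp (Set.range fun m : ℕ => g (j + n * m)) = 0 := by
    intro i j hij
    apply rp_orth
    rintro _ ⟨k, rfl⟩ _ ⟨l, rfl⟩
    rw [(h1 _).2.1]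
    exact h2 _ _ (fun h => hij (hinj _ _ _ _ h).1)
  have hFs : ∀ i : Fin n, Sq N (cs N y) (rp (Set.range fun m : ℕ => g (i + n * m))) := by
    intro i
    exact lemB (g := fun m => g (i + n * m)) C h4 h3 (fun k => (h1 _).2)
      (fun k l hkl => h2 _ _ (fun h => hkl (hinj _ _ _ _ h).2)) (fun k => h7 _)
      (fun k => (hF i).2.1 _ ⟨k, rfl⟩)
  have hFp := fun i => (hF i).1
  obtain ⟨F, hFA, hFo, hFs, hFp⟩ : ∃ F : Fin n → R, (∀ i, F i ∈ A) ∧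
      (∀ i j, i ≠ j → F i * F j = 0) ∧ (∀ i, Sq N (cs N y) (F i)) ∧ ∀ i, Pj (F i) :=
    ⟨fun i : Fin n => rp (Set.range fun m : ℕ => g (i + n * m)), hFA, hFo, hFs, hFp⟩
  clear hF
  have hz2z1 := flp hz1.pj.1 hz2.pj.1 hz12
  have hz02 : z0 * cs N y = cs N y := by rw [← hz12, ← mul_assoc, hz01]
  have t1 : Sq N (cs N y) G := by
    have := s1.cmul hz2
    rw [hz2z1] at this
    exact this.mono (by rw [hz2.comm hGN, asc hG.2])
  have t2 : Sq N (cs N y) (1 - G) := by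
    have := s2.cmul hz2
    rw [hz2z1] at this
    exact this.mono (by rw [hz2.comm (N.sub_mem N.one_mem hGN), asc hG.one_sub.2])
  generalize cs N y = z2 at *
  obtain ⟨z3, hz3, hz23, hz3s, hz3n⟩ : ∃ z3, Cent N z3 ∧ z2 * z3 = z3 ∧ Sq N z3 (e i0) ∧
      z3 ≠ 0 := by
    by_contra hn
    push Not at hn
    have hall : ∀ i, NB N z2 (e i) := fun i z a b c => hn z a b (c.trans (heq i i0))
    have hind : ∀ s : Finset (Fin n), NB N z2 (∑ i ∈ s, e i) ∧ Pj (∑ i ∈ s, e i) ∧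
        (∑ i ∈ s, e i) ∈ N := by
      intro s
      induction s using Finset.induction_on with
      | empty =>
        refine ⟨?_, by simpa using Pj.zero, by simp⟩
        rintro z hzc hzz ⟨v, hv, v1, v2⟩
        rw [Finset.sum_empty, zero_mul] at v2
        rw [← v1, ← v2, mul_zero]
      | insert i s his ih =>
        rw [Finset.sum_insert his]
        have ho : e i * ∑ j ∈ s, e j = 0 := by
          rw [Finset.mul_sum]
          apply Finset.sum_eq_zero
          intro j hj
          exact heo i j (fun h => his (h ▸ hj))
        exact ⟨lemS hN hG hGN t1 t2 (he i) ih.2.1 (hem i) ih.2.2 ho (hall i) ih.1,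
          (he i).add ih.2.1 ho, N.add_mem (hem i) ih.2.2⟩
    have := (hind Finset.univ).1
    rw [hsum] at this
    exact hz2n (this z2 hz2 hz2.pj.2 (Sq.of_le hz2.pj hz2.mem (one_mul _)))
  have hz32 := flp hz2.pj.1 hz3.pj.1 hz23
  -- the partition of unity
  have hDF : ∀ i, (∑ j, F j) * F i = F i := by
    intro i
    rw [Finset.sum_mul, Finset.sum_eq_single i (fun j _ hj => hFo j i hj) (by simp), (hFp i).2]
  have hDP : Pj (∑ j, F j) := by
    refine ⟨by rw [star_sum]; exact Finset.sum_congr rfl (fun i _ => (hFp i).1), ?_⟩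
    rw [Finset.mul_sum]
    exact Finset.sum_congr rfl (fun i _ => hDF i)
  have hDA : (∑ j, F j) ∈ A := A.sum_mem (fun i _ => hFA i)
  obtain ⟨h, hhA, hhP, hho, hhs, hhsum⟩ : ∃ h : Fin n → R, (∀ i, h i ∈ A) ∧ (∀ i, Pj (h i)) ∧
      (∀ i j, i ≠ j → h i * h j = 0) ∧ (∀ i, h i * F i = F i) ∧ ∑ i, h i = 1 := by
    have d1 : ∀ i, (1 - ∑ j, F j) * F i = 0 := fun i => by rw [sub_mul, hDF, one_mul, sub_self]
    have d2 : ∀ i, F i * (1 - ∑ j, F j) = 0 := fun i => flp0 hDP.one_sub.1 (hFp i).1 (d1 i)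
    refine ⟨fun i => F i + if i = i0 then 1 - ∑ j, F j else 0, ?_, ?_, ?_, ?_, ?_⟩
    · intro i
      apply A.add_mem (hFA i)
      split_ifs
      · exact A.sub_mem A.one_mem hDA
      · exact A.zero_mem
    · intro i
      dsimp only
      split_ifs
      · exact (hFp i).add hDP.one_sub (d2 i)
      · rw [add_zero]; exact hFp i
    · intro i j hij
      dsimp only
      split_ifs with hi hj hj
      · exact absurd (hi.trans hj.symm) hij
      · rw [add_zero, add_mul, hFo i j hij, d1, add_zero]
      · rw [add_zero, mul_add, hFo i j hij, d2, add_zero]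
      · rw [add_zero, add_zero, hFo i j hij]
    · intro i
      dsimp only
      split_ifs
      · rw [add_mul, d1, (hFp i).2, add_zero]
      · rw [add_zero, (hFp i).2]
    · rw [Finset.sum_add_distrib]
      simp
  have hw : ∀ i, ∃ w ∈ N, star w * w = z3 * h i ∧ w * star w = z3 * e i := by
    intro i
    have hhN := C.hAN (hhA i)
    have a1 : Sq N z3 (z3 * e i) := by
      have := (hz3s.trans (heq i0 i)).cmul hz3
      rwa [hz3.pj.2] at this
    have a2 : Sq N z3 (z3 * h i) := by
      have := ((hFs i).mono (hhs i)).cmul hz3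
      rwa [hz32] at this
    have p1 := hz3.pj_mul (hhP i) hhN
    have p2 := hz3.pj_mul (he i) (hem i)
    have a3 : Sq N (z3 * h i) z3 := Sq.of_le p1 (N.mul_mem hz3.mem hhN) (asc hz3.pj.2 _)
    have a4 : Sq N (z3 * e i) z3 := Sq.of_le p2 (N.mul_mem hz3.mem (hem i)) (asc hz3.pj.2 _)
    exact SB hN p1 p2 (N.mul_mem hz3.mem hhN) (a3.trans a1) (a4.trans a2)
  choose w hwN hw1 hw2 using hw
  have p1 := fun i => hz3.pj_mul (hhP i) (C.hAN (hhA i))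
  have ew : ∀ i, e i * w i = w i := by
    intro i
    have : e i * (w i * star (w i)) = w i * star (w i) := by
      rw [hw2, ← mul_assoc, ← hz3.comm (hem i), mul_assoc, (he i).2]
    have r := pi_right (p1 i) (hw1 i)
    rw [← hw1] at r
    rw [← r, ← mul_assoc (w i), ← mul_assoc (e i), this]
  have ew' : ∀ i j, i ≠ j → e i * w j = 0 := by
    intro i j hij
    rw [← ew j, asc0 (heo i j hij)]
  have hw' : ∀ i, w i * h i = w i := by
    intro i
    have r := pi_right (p1 i) (hw1 i)
    rw [← r, mul_assoc, mul_assoc z3, (hhP i).2]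
  have o1 : ∀ i j, i ≠ j → star (w i) * w j = 0 := by
    intro i j hij
    rw [← ew i, star_mul, (he i).1, mul_assoc, ew' i j hij, mul_zero]
  have o2 : ∀ i j, i ≠ j → w i * star (w j) = 0 := by
    intro i j hij
    rw [← hw' i, ← hw' j, star_mul, (hhP j).1, mul_assoc, asc0 (hho i j hij), mul_zero]
  have su : ∀ i, star (∑ j, w j) * w i = z3 * h i := by
    intro i
    rw [star_sum, Finset.sum_mul, Finset.sum_eq_single i (fun j _ hj => o1 j i hj) (by simp), hw1]
  have us : ∀ i, (∑ j, w j) * star (w i) = z3 * e i := by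
    intro i
    rw [Finset.sum_mul, Finset.sum_eq_single i (fun j _ hj => o2 j i hj) (by simp), hw2]
  refine ⟨z3, hz3, by rw [← hz23, ← mul_assoc, hz02], hz3n, ∑ j, w j,
    N.sum_mem (fun i _ => hwN i), ?_, ?_, ?_⟩
  · rw [Finset.mul_sum, Finset.sum_congr rfl (fun i _ => su i), ← Finset.mul_sum, hhsum, mul_one]
  · rw [star_sum, Finset.mul_sum, Finset.sum_congr rfl (fun i _ => us i), ← Finset.mul_sum, hsum,
      mul_one]
  · intro i
    rw [mul_assoc, Finset.mul_sum, Finset.sum_eq_single i (fun j _ hj => ew' i j hj.symm) (by simp),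
      ew, su]
    exact A.mul_mem (C.cent hz3) (hhA i)

theorem global {N A : Subring R} (C : Ctx N A) {n : ℕ} (e : Fin n → R) (he : ∀ i, Pj (e i))
    (hem : ∀ i, e i ∈ N)
    (heo : ∀ i j, i ≠ j → e i * e j = 0) (hsum : ∑ i, e i = 1) (heq : ∀ i j, Sq N (e i) (e j)) :
    ∃ u ∈ N, star u * u = 1 ∧ u * star u = 1 ∧ ∀ i, star u * e i * u ∈ A := by
  have hN := C.hN
  have hloc : ∀ z0, Cent N z0 → z0 ≠ 0 → ∃ z, Cent N z ∧ z0 * z = z ∧ z ≠ 0 ∧ Qz N A e z := by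
    intro z0 hz hz0
    by_cases hinf : InfSeq N N z0
    · exact local_inf C e he hem heo hsum heq hz hinf
    · exact ⟨z0, hz, hz.pj.2, hz0, local_fin C e he hem heo (fun y hy => by
        rw [← mul_one y, ← hsum, Finset.mul_sum]
        exact Finset.sum_eq_zero (fun i _ => hy i)) hz hinf⟩
  obtain ⟨V, h1, h2, h3⟩ := exists_max_pj (fun z : R => Cent N z ∧ Qz N A e z) (fun z h => h.1.1)
  have hP := rp_spec V
  have hPc := cent_rp hN (V := V) (fun v hv => (h1 v hv).1.1)
  have hP1 : rp V = 1 := by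
    by_contra hne
    obtain ⟨z, hz, hzz, hzn, hq⟩ := hloc _ hPc.one_sub (fun h => hne (sub_eq_zero.1 h).symm)
    apply hzn
    apply h3 z ⟨hz, hq⟩
    intro v hv
    rw [← hzz, ← mul_assoc, mul_sub, mul_one, flp hP.1.1 (h1 v hv).1.1.pj.1 (hP.2.1 v hv), sub_self,
      zero_mul]
  rw [hP1] at hP
  have hV : ∀ v : V, Qz N A e v := fun v => (h1 v v.2).1.2
  choose u huN hu1 hu2 huA using hV
  have hvc : ∀ v : V, Cent N (v : R) := fun v => (h1 v v.2).1.1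
  have hur : ∀ v : V, u v * v = u v := fun v => pi_right (hvc v).pj (hu1 v)
  have hur' : ∀ v : V, (v : R) * u v = u v := fun v => by rw [(hvc v).comm (huN v), hur]
  have hvo : ∀ v w : V, v ≠ w → (v : R) * w = 0 :=
    fun v w h => h2 v v.2 w w.2 (fun h' => h (Subtype.ext h'))
  obtain ⟨w, hwN, hw1, hw2, hw3⟩ := sum_iso hN u huN (by
    intro v v' h
    constructor
    · rw [← hur' v, ← hur' v', star_mul, (hvc v).pj.1, mul_assoc, asc0 (hvo v v' h), mul_zero]
    · rw [← hur v, ← hur v', star_mul, (hvc v').pj.1, mul_assoc, asc0 (hvo v v' h), mul_zero])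
    (fun v => by rw [hu1]; exact (hvc v).pj)
  simp only [hu1] at hw1 hw2
  have hww : star w * w = 1 := by
    rw [Subtype.range_coe] at hw2
    exact hw2.uniq hP
  refine ⟨w, hwN, hww, ?_, ?_⟩
  · have := hP.2.2 (1 - w * star w) (by
      intro v hv
      have := hw3.2.1 _ ⟨⟨v, hv⟩, rfl⟩
      have h4 := hu2 ⟨v, hv⟩
      dsimp only at h4
      rw [← h4, sub_mul, one_mul, ← mul_assoc, this, sub_self])
    rw [mul_one, sub_eq_zero] at this
    exact this.symm
  · intro i
    have hbN : star w * e i * w ∈ N := N.mul_mem (N.mul_mem (hN.star_mem hwN) (hem i)) hwN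
    have hbv : ∀ v : V, star w * e i * w * v = star (u v) * e i * u v := by
      intro v
      rw [← hw1 v, star_mul, (hvc v).pj.1]
      rw [mul_assoc (v : R), mul_assoc (v : R), ← mul_assoc _ w, ← mul_assoc (v : R),
        (hvc v).comm hbN, mul_assoc _ (v : R) (v : R), (hvc v).pj.2]
    apply C.hA.dc
    intro t ht
    have := hP.2.2 (t * (star w * e i * w) - (star w * e i * w) * t) (by
      intro v hv
      have e1 := hbv ⟨v, hv⟩
      dsimp only at e1
      rw [sub_mul, mul_assoc t, e1, mul_assoc _ t, ht v (C.cent (hvc ⟨v, hv⟩)), ← mul_assoc _ v, e1,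
        ht _ (huA _ _), sub_self])
    rwa [mul_one, sub_eq_zero] at this

/-- existence of a masa -/
theorem exists_masa {N : Subring R} (hN : IsVN N)
    (hcd : ∀ P : Set R, (∀ p ∈ P, Pj p ∧ p ∈ N ∧ p ≠ 0) →
      (∀ p ∈ P, ∀ q ∈ P, p ≠ q → p * q = 0) → P.Countable)
    (S : Set R) (hS : ∀ s ∈ S, s ∈ N) (hSs : ∀ s ∈ S, star s ∈ S)
    (hSc : ∀ s ∈ S, ∀ t ∈ S, s * t = t * s) : ∃ A : Subring R, Ctx N A ∧ ∀ s ∈ S, s ∈ A := by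
  obtain ⟨M, hSM, hM⟩ := zorn_subset_nonempty {M : Set R | (∀ s ∈ M, s ∈ N) ∧
    (∀ s ∈ M, star s ∈ M) ∧ ∀ s ∈ M, ∀ t ∈ M, s * t = t * s} (by
    intro c hc hch _
    refine ⟨⋃₀ c, ⟨?_, ?_, ?_⟩, fun s hs => Set.subset_sUnion_of_mem hs⟩
    · rintro s ⟨m, hm, hs⟩; exact (hc hm).1 s hs
    · rintro s ⟨m, hm, hs⟩; exact ⟨m, hm, (hc hm).2.1 s hs⟩
    · rintro s ⟨m, hm, hs⟩ t ⟨k, hk, ht⟩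
      rcases hch.total hm hk with h | h
      · exact (hc hk).2.2 s (h hs) t ht
      · exact (hc hm).2.2 s hs t (h ht)) S ⟨hS, hSs, hSc⟩
  obtain ⟨m1, m2, m3⟩ := hM.prop
  -- anything in N that commutes with M and its own adjoint lies in M
  have hself : ∀ x ∈ N, (∀ s ∈ M, x * s = s * x) → x * star x = star x * x → x ∈ M := by
    intro x hx hxs hxx
    have hxs' : ∀ s ∈ M, star x * s = s * star x := by
      intro s hs
      have := congrArg star (hxs _ (m2 s hs))
      simpa using this.symm
    have : insert x (insert (star x) M) ⊆ M := hM.le_of_ge ⟨by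
      rintro s (rfl | rfl | hs)
      · exact hx
      · exact hN.star_mem hx
      · exact m1 s hs, by
      rintro s (rfl | rfl | hs)
      · right; left; rfl
      · left; simp
      · right; right; exact m2 s hs, by
      rintro s (rfl | rfl | hs) t (rfl | rfl | ht)
      · rfl
      · exact hxx
      · exact hxs t ht
      · exact hxx.symm
      · rfl
      · exact hxs' t ht
      · exact (hxs s hs).symm
      · exact (hxs' s hs).symm
      · exact m3 s hs t ht⟩ (fun s hs => Or.inr (Or.inr hs))
    exact this (Or.inl rfl)
  have hmem : ∀ x, x ∈ N ⊓ Subring.centralizer M ↔ x ∈ N ∧ ∀ s ∈ M, x * s = s * x := by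
    intro x
    rw [Subring.mem_inf, Subring.mem_centralizer_iff]
    exact and_congr_right fun _ => forall₂_congr fun s hs => eq_comm
  have hAM : ∀ x, x ∈ N ⊓ Subring.centralizer M ↔ x ∈ M := by
    intro x
    rw [hmem]
    constructor
    · rintro ⟨hx, hxs⟩
      have hxs' : ∀ s ∈ M, star x * s = s * star x := by
        intro s hs
        have := congrArg star (hxs _ (m2 s hs))
        simpa using this.symm
      have hy : x + star x ∈ M := by
        apply hself _ (N.add_mem hx (hN.star_mem hx))
        · intro s hs
          rw [add_mul, mul_add, hxs s hs, hxs' s hs]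
        · simp [add_comm]
      have := hxs _ hy
      rw [mul_add, add_mul, add_right_inj] at this
      exact hself x hx hxs this
    · intro hx
      exact ⟨m1 x hx, fun s hs => m3 x hx s hs⟩
  refine ⟨N ⊓ Subring.centralizer M, ⟨hN, ⟨?_, ?_⟩, inf_le_left, ?_, ?_, hcd⟩, ?_⟩
  · intro x hx
    rw [hAM] at hx ⊢
    exact m2 x hx
  · intro x hx
    rw [hmem]
    refine ⟨hN.dc (fun t ht => hx t (fun y hy => ht y ((hmem y).1 hy).1)), fun s hs => ?_⟩
    exact (hx s (fun y hy => m3 s hs y ((hAM y).1 hy))).symm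
  · intro x hx y hy
    rw [hAM] at hx hy
    exact m3 x hx y hy
  · intro x hx hxa
    rw [hmem]
    exact ⟨hx, fun s hs => hxa s ((hAM s).2 hs)⟩
  · intro s hs
    rw [hAM]
    exact hSM hs

end alg6
end KD
namespace KD
section hil

variable {K : Type*} [NormedAddCommGroup K] [InnerProductSpace ℂ K] [CompleteSpace K]

theorem hil_proper (x : K →L[ℂ] K) (h : star x * x = 0) : x = 0 :=
  (CStarRing.star_mul_self_eq_zero_iff x).1 h

theorem hil_rng (X : Set (K →L[ℂ] K)) : ∃ p, IsRp p X := by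
  set U : Submodule ℂ K := (⨆ x ∈ X, LinearMap.range (x : K →ₗ[ℂ] K)).topologicalClosure with hU
  have : CompleteSpace U := (Submodule.isClosed_topologicalClosure _).completeSpace_coe
  have hp := isStarProjection_starProjection (U := U)
  refine ⟨U.starProjection, ⟨hp.isSelfAdjoint, hp.isIdempotentElem⟩, ?_, ?_⟩
  · intro x hx
    ext v
    rw [mul_apply_eq_comp, Submodule.starProjection_eq_self_iff]
    apply Submodule.le_topologicalClosure
    exact Submodule.mem_iSup_of_mem x (Submodule.mem_iSup_of_mem hx ⟨v, rfl⟩)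
  · intro y hy
    ext v
    have h1 : U ≤ LinearMap.ker (y : K →ₗ[ℂ] K) := by
      apply Submodule.topologicalClosure_minimal
      · refine iSup₂_le (fun x hx => ?_)
        rintro _ ⟨v, rfl⟩
        exact congrArg (fun z : K →L[ℂ] K => z v) (hy x hx)
      · exact y.isClosed_ker
    exact h1 (Submodule.starProjection_apply_mem U v)

theorem hil_sqrt (x : K →L[ℂ] K) : ∃ a : K →L[ℂ] K, star a = a ∧ a * a = star x * x ∧
    ∀ t, t * (star x * x) = (star x * x) * t → t * a = a * t := by
  have h0 : 0 ≤ star x * x := star_mul_self_nonneg x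
  refine ⟨CFC.sqrt (star x * x), (CFC.sqrt_nonneg _).isSelfAdjoint, CFC.sqrt_mul_sqrt_self _ h0, ?_⟩
  intro t ht
  have : Commute (star x * x) t := ht.symm
  exact (Commute.cfcₙ_nnreal this NNReal.sqrt).eq.symm

theorem star_inner (a : K →L[ℂ] K) (x y : K) :
    inner ℂ (a x) y = inner ℂ x ((star a) y) := by
  rw [ContinuousLinearMap.star_eq_adjoint, ContinuousLinearMap.adjoint_inner_right]

theorem pj_norm_le {p : K →L[ℂ] K} (hp : Pj p) : ‖p‖ ≤ 1 := by
  have h := CStarRing.norm_star_mul_self (x := p)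
  rw [hp.1, hp.2] at h
  by_contra hc
  nlinarith [norm_nonneg p]

theorem hil_iso
    (S : Set ((K →L[ℂ] K) × (K →L[ℂ] K))) (p : K →L[ℂ] K)
    (hp : IsRp p (Prod.fst '' S))
    (h : ∀ s ∈ S, ∀ t ∈ S, star s.1 * t.1 = star s.2 * t.2) :
    ∃ w, (∀ s ∈ S, w * s.1 = s.2) ∧ star w * w = p := by
  classical
  obtain ⟨hpj, hp1, hp2⟩ := hp
  let A : (S →₀ K) →ₗ[ℂ] K := Finsupp.lsum ℂ (fun s : S => ((s.1.1 : K →L[ℂ] K) : K →ₗ[ℂ] K))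
  let B : (S →₀ K) →ₗ[ℂ] K := Finsupp.lsum ℂ (fun s : S => ((s.1.2 : K →L[ℂ] K) : K →ₗ[ℂ] K))
  have hAB : ∀ f, ‖B f‖ = ‖A f‖ := by
    intro f
    have : inner ℂ (B f) (B f) = inner ℂ (A f) (A f) := by
      simp only [A, B, Finsupp.lsum_apply, Finsupp.sum, sum_inner, inner_sum]
      refine Finset.sum_congr rfl (fun s _ => Finset.sum_congr rfl (fun t _ => ?_))
      have := congrArg (fun z : K →L[ℂ] K => z (f s)) (h t.1 t.2 s.1 s.2)
      simp only [mul_apply_eq_comp] at this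
      simp only [ContinuousLinearMap.coe_coe, star_inner, this]
    rw [@norm_eq_sqrt_re_inner ℂ, @norm_eq_sqrt_re_inner ℂ, this]
  have hpA : ∀ f, p (A f) = A f := by
    intro f
    simp only [A, Finsupp.lsum_apply, Finsupp.sum, map_sum]
    refine Finset.sum_congr rfl (fun s _ => ?_)
    exact congrArg (fun z : K →L[ℂ] K => z (f s)) (hp1 s.1.1 ⟨_, s.2, rfl⟩)
  let e : ((S →₀ K) × K) →ₗ[ℂ] K := LinearMap.coprod A ((1 - p : K →L[ℂ] K) : K →ₗ[ℂ] K)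
  let g : ((S →₀ K) × K) →ₗ[ℂ] K := LinearMap.coprod B 0
  have hpe : ∀ x, p (e x) = A x.1 := by
    intro x
    simp only [e, LinearMap.coprod_apply, map_add, hpA, ContinuousLinearMap.coe_coe]
    have : p * (1 - p) = 0 := by rw [mul_sub, hpj.2, mul_one, sub_self]
    have := congrArg (fun z : K →L[ℂ] K => z x.2) this
    simp only [mul_apply_eq_comp] at this
    rw [this]; simp
  have hnorm : ∃ C, ∀ x, ‖g x‖ ≤ C * ‖e x‖ := by
    refine ⟨1, fun x => ?_⟩
    have : g x = B x.1 := by simp [g]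
    rw [this, hAB, ← hpe]
    exact (p.le_opNorm _).trans (mul_le_mul_of_nonneg_right (pj_norm_le hpj) (norm_nonneg _))
  have hdense : DenseRange e := by
    set U : Submodule ℂ K := (LinearMap.range e).topologicalClosure with hU
    have : CompleteSpace U := (Submodule.isClosed_topologicalClosure _).completeSpace_coe
    have hmem : ∀ x, e x ∈ U := fun x => Submodule.le_topologicalClosure _ ⟨x, rfl⟩
    have k1 : (1 - U.starProjection) * p = 0 := by
      apply hp2
      rintro _ ⟨s, hs, rfl⟩
      ext v
      have : e (Finsupp.single ⟨s, hs⟩ v, 0) = s.1 v := by simp [e, A]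
      have h3 := hmem (Finsupp.single ⟨s, hs⟩ v, 0)
      rw [this, ← Submodule.starProjection_eq_self_iff] at h3
      simp [mul_apply_eq_comp, h3]
    have k2 : (1 - U.starProjection) * (1 - p) = 0 := by
      ext v
      have : e (0, v) = (1 - p) v := by simp [e]
      have h3 := hmem (0, v)
      rw [this, ← Submodule.starProjection_eq_self_iff] at h3
      rw [mul_apply_eq_comp, sub_apply, h3]
      simp
    have k3 : (1 - U.starProjection) = 0 := by
      have : (1 - U.starProjection) = (1 - U.starProjection) * p + (1 - U.starProjection) * (1 - p) := by
        rw [← mul_add]; simp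
      rw [this, k1, k2, add_zero]
    intro v
    have : U.starProjection v = v := by
      have := congrArg (fun z : K →L[ℂ] K => z v) k3
      simp only [sub_apply, zero_apply] at this
      exact (sub_eq_zero.1 this).symm
    rw [Submodule.starProjection_eq_self_iff] at this
    exact this
  let w : K →L[ℂ] K := g.extendOfNorm e
  have hw : ∀ x, w (e x) = g x := LinearMap.extendOfNorm_eq hdense hnorm
  have w1 : ∀ s ∈ S, w * s.1 = s.2 := by
    intro s hs
    ext v
    have := hw (Finsupp.single ⟨s, hs⟩ v, 0)
    simpa [e, g, A, B] using this
  have w2 : w * (1 - p) = 0 := by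
    ext v
    have := hw (0, v)
    simpa [e, g] using this
  refine ⟨w, w1, ?_⟩
  have wp : w * p = w := by
    rw [mul_sub, mul_one] at w2
    exact (sub_eq_zero.1 w2).symm
  have pw : p * star w = star w := by
    have := congrArg star wp
    rwa [star_mul, hpj.1] at this
  set y := star w * w - p with hy
  have hyp : y * p = y := by rw [hy, sub_mul, mul_assoc, wp, hpj.2]
  have hpy : p * y = y := by rw [hy, mul_sub, ← mul_assoc, pw, hpj.2]
  have key : ∀ s ∈ S, ∀ t ∈ S, star s.1 * (y * t.1) = 0 := by
    intro s hs t ht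
    have e1 : star s.1 * star w = star s.2 := by rw [← star_mul, w1 s hs]
    rw [hy, sub_mul, hp1 t.1 ⟨t, ht, rfl⟩, mul_sub, mul_assoc, w1 t ht, asc e1, h s hs t ht,
      sub_self]
  have key2 : ∀ t ∈ S, y * t.1 = 0 := by
    intro t ht
    have : star (y * t.1) * p = 0 := by
      apply hp2
      rintro _ ⟨s, hs, rfl⟩
      have := congrArg star (key s hs t ht)
      rwa [star_mul, star_star, star_zero] at this
    have := congrArg star this
    rwa [star_mul, star_star, star_zero, hpj.1, asc hpy] at this
  have : y * p = 0 := hp2 _ (by rintro _ ⟨s, hs, rfl⟩; exact key2 s hs)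
  rw [hyp] at this
  exact sub_eq_zero.1 this

theorem spec_step (b : K →L[ℂ] K) (hb : star b = b) (hb1 : ‖b‖ ≤ 1) :
    ∃ p, Pj p ∧ (∀ t, t * b = b * t → t * p = p * t) ∧ ‖(2 : ℂ) • b - ((2 : ℂ) • p - 1)‖ ≤ 1 := by
  have hbs : IsSelfAdjoint b := hb
  let f : ℝ → ℝ := fun t => max t 0
  let g : ℝ → ℝ := fun t => max (-t) 0
  have hf : Continuous f := by fun_prop
  have hg : Continuous g := by fun_prop
  have h1 : cfc f b - cfc g b = b := by
    rw [← cfc_sub f g b hf.continuousOn hg.continuousOn]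
    conv_rhs => rw [← cfc_id' ℝ b]
    congr 1
    ext t
    simp only [f, g]
    rcases le_total t 0 with h | h
    · rw [max_eq_right h, max_eq_left (by linarith)]; ring
    · rw [max_eq_left h, max_eq_right (by linarith)]; ring
  have h2 : cfc g b * cfc f b = 0 := by
    rw [← cfc_mul g f b hg.continuousOn hf.continuousOn]
    rw [← cfc_const_zero ℝ b]
    congr 1
    ext t
    simp only [f, g]
    rcases le_total t 0 with h | h
    · rw [max_eq_right h, mul_zero]
    · rw [max_eq_right (a := -t) (by linarith), zero_mul]
  have h3 : ‖(2 : ℝ) • (cfc f b + cfc g b) - 1‖ ≤ 1 := by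
    have : (2 : ℝ) • (cfc f b + cfc g b) - 1 = cfc (fun t => 2 * (f t + g t) - 1) b := by
      rw [cfc_sub (fun t => 2 * (f t + g t)) (fun _ => (1 : ℝ)) b (by fun_prop) (by fun_prop),
        cfc_const_one ℝ b, cfc_const_mul 2 _ b (by fun_prop),
        cfc_add b f g hf.continuousOn hg.continuousOn]
    rw [this]
    refine norm_cfc_le zero_le_one (fun t ht => ?_)
    have ht1 : |t| ≤ 1 := by
      have := spectrum.norm_le_norm_mul_of_mem ht
      rw [Real.norm_eq_abs] at this
      refine this.trans ?_
      have h1n : ‖(1 : K →L[ℂ] K)‖ ≤ 1 := ContinuousLinearMap.norm_id_le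
      nlinarith [norm_nonneg b, norm_nonneg (1 : K →L[ℂ] K)]
    rw [abs_le] at ht1
    rw [Real.norm_eq_abs, abs_le]
    simp only [f, g]
    rcases le_total t 0 with h | h
    · rw [max_eq_right h, max_eq_left (by linarith)]; constructor <;> linarith
    · rw [max_eq_left h, max_eq_right (by linarith)]; constructor <;> linarith
  have hsf : star (cfc f b) = cfc f b := cfc_predicate f b
  have hsg : star (cfc g b) = cfc g b := cfc_predicate g b
  obtain ⟨p, hp, hp1, hp2⟩ := hil_rng {cfc f b}
  have hp1' := hp1 _ rfl
  have hgp : cfc g b * p = 0 := hp2 _ (by rintro _ rfl; exact h2)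
  have hpg : p * cfc g b = 0 := flp0 hsg hp.1 hgp
  refine ⟨p, hp, ?_, ?_⟩
  · intro t ht
    have c1 : ∀ t, t * b = b * t → t * cfc f b = cfc f b * t := by
      intro t ht
      have : Commute b t := ht.symm
      exact (Commute.cfc_real this f).eq.symm
    have ht' : star t * b = b * star t := by
      have := congrArg star ht
      rw [star_mul, star_mul, hb] at this
      exact this.symm
    apply IsRp.comm ⟨hp, hp1, hp2⟩
    · rintro _ rfl
      rw [c1 t ht, asc hp1']
    · rintro _ rfl
      rw [c1 _ ht', asc hp1']
  · have e1 : (2 : ℂ) • b - ((2 : ℂ) • p - 1) =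
        (p + p - 1) * ((2 : ℝ) • (cfc f b + cfc g b) - 1) := by
      rw [two_smul, two_smul, two_smul]
      conv_lhs => rw [← h1]
      simp only [mul_sub, sub_mul, mul_add, add_mul, hp1', hpg, mul_one, one_mul]
      abel
    have e2 : ‖p + p - 1‖ ≤ 1 := by
      have h := CStarRing.norm_star_mul_self (x := p + p - 1)
      have h1n : ‖(1 : K →L[ℂ] K)‖ ≤ 1 := ContinuousLinearMap.norm_id_le
      have : star (p + p - 1) * (p + p - 1) = 1 := by
        simp only [star_sub, star_add, star_one, hp.1, mul_sub, sub_mul, mul_add, add_mul, hp.2,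
          mul_one, one_mul]
        abel
      rw [this] at h
      nlinarith [norm_nonneg (p + p - 1)]
    rw [e1]
    refine (norm_mul_le _ _).trans ?_
    nlinarith [norm_nonneg (p + p - 1), norm_nonneg ((2 : ℝ) • (cfc f b + cfc g b) - 1)]

theorem spec_ind (x : K →L[ℂ] K) (k : ℕ) : ∀ b : K →L[ℂ] K, star b = b → ‖b‖ ≤ 1 →
    (∀ p, Pj p → (∀ t, t * b = b * t → t * p = p * t) → x * p = p * x) →
    2 ^ k * ‖x * b - b * x‖ ≤ 2 * ‖x‖ := by
  induction k with
  | zero =>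
    intro b hb hb1 _
    have := norm_sub_le (x * b) (b * x)
    have := norm_mul_le x b
    have := norm_mul_le b x
    have : ‖x‖ * ‖b‖ ≤ ‖x‖ := mul_le_of_le_one_right (norm_nonneg _) hb1
    simp only [pow_zero]
    linarith [mul_comm ‖b‖ ‖x‖]
  | succ k ih =>
    intro b hb hb1 hx
    obtain ⟨p, hp, hpc, hpn⟩ := spec_step b hb hb1
    have hxp := hx p hp hpc
    set c := (2 : ℂ) • b - ((2 : ℂ) • p - 1) with hc
    have hcs : star c = c := by
      rw [hc, two_smul, two_smul]
      simp [hb, hp.1]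
    have := ih c hcs hpn (by
      intro q hq hqc
      apply hx q hq
      intro t ht
      apply hqc
      rw [hc, two_smul, two_smul]
      simp only [mul_sub, sub_mul, mul_add, add_mul, mul_one, one_mul, ht, hpc t ht])
    have e : x * c - c * x = (2 : ℂ) • (x * b - b * x) := by
      rw [hc, two_smul, two_smul, two_smul]
      simp only [mul_sub, sub_mul, mul_add, add_mul, mul_one, one_mul, hxp]
      abel
    rw [e, norm_smul] at this
    have h2 : ‖(2 : ℂ)‖ = 2 := by simp
    rw [h2] at this
    rw [pow_succ]
    linarith

theorem spec_sa (x b : K →L[ℂ] K) (hb : star b = b)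
    (hx : ∀ p, Pj p → (∀ t, t * b = b * t → t * p = p * t) → x * p = p * x) :
    x * b = b * x := by
  by_cases hb0 : b = 0
  · simp [hb0]
  have hn : 0 < ‖b‖ := norm_pos_iff.2 hb0
  have hne : ((‖b‖⁻¹ : ℝ) : ℂ) ≠ 0 := by simpa using hb0
  set c := ((‖b‖⁻¹ : ℝ) : ℂ) • b with hc
  have hcs : star c = c := by rw [hc, star_smul, hb]; simp
  have hcn : ‖c‖ ≤ 1 := by
    rw [hc, norm_smul]
    simp [hn.ne']
  have hcx : ∀ t : K →L[ℂ] K, t * c = c * t → t * b = b * t := by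
    intro t ht
    rw [hc, mul_smul_comm, smul_mul_assoc] at ht
    exact smul_right_injective _ hne ht
  have hcx' : ∀ t : K →L[ℂ] K, t * b = b * t → t * c = c * t := by
    intro t ht
    rw [hc, mul_smul_comm, smul_mul_assoc, ht]
  apply hcx
  by_contra hcon
  have hpos : 0 < ‖x * c - c * x‖ := norm_pos_iff.2 (sub_ne_zero.2 hcon)
  have key := fun k => spec_ind x k c hcs hcn
    (fun p hp h => hx p hp (fun t ht => h t (hcx' t ht)))
  obtain ⟨k, hk⟩ := pow_unbounded_of_one_lt (2 * ‖x‖ / ‖x * c - c * x‖) one_lt_two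
  rw [div_lt_iff₀ hpos] at hk
  exact absurd (key k) (not_le.2 hk)

theorem hil_spec (x a : K →L[ℂ] K) (hx : ∀ p, Pj p →
    (∀ t, t * a = a * t → t * star a = star a * t → t * p = p * t) → x * p = p * x) :
    x * a = a * x := by
  have h1 : x * (a + star a) = (a + star a) * x := by
    apply spec_sa
    · simp [add_comm]
    · intro p hp h
      refine hx p hp (fun t h1 h2 => h t ?_)
      rw [mul_add, add_mul, h1, h2]
  have h2 : x * (Complex.I • (a - star a)) = (Complex.I • (a - star a)) * x := by
    apply spec_sa
    · rw [star_smul, star_sub, star_star]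
      simp only [smul_sub, RCLike.star_def, Complex.conj_I, neg_smul]
      abel
    · intro p hp h
      refine hx p hp (fun t h1 h2 => h t ?_)
      rw [mul_smul_comm, smul_mul_assoc, mul_sub, sub_mul, h1, h2]
  rw [mul_smul_comm, smul_mul_assoc] at h2
  have h3 := smul_right_injective _ Complex.I_ne_zero h2
  rw [mul_sub, sub_mul] at h3
  rw [mul_add, add_mul] at h1
  have h4 : (2 : ℂ) • (x * a) = (2 : ℂ) • (a * x) := by
    rw [two_smul, two_smul]
    calc x * a + x * a = (x * a + x * star a) + (x * a - x * star a) := by abel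
      _ = a * x + a * x := by rw [h1, h3]; abel
  exact smul_right_injective _ two_ne_zero h4

instance hil_KAx : KAx (K →L[ℂ] K) where
  proper := hil_proper
  rng := hil_rng
  iso := hil_iso
  sqrt := hil_sqrt
  spec := hil_spec

end hil
end KD
namespace KD
section conc

variable {H : Type*} [NormedAddCommGroup H] [InnerProductSpace ℂ H] [CompleteSpace H]
variable {K : Type*} [NormedAddCommGroup K] [InnerProductSpace ℂ K] [CompleteSpace K]

/-- cyclic projection -/
theorem exists_cyc (N0 : Set (H →L[ℂ] H)) (hvN : N0 = Set.centralizer (Set.centralizer N0))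
    (hstar : ∀ a ∈ N0, star a ∈ N0) (ξ : H) :
    ∃ p : H →L[ℂ] H, Pj p ∧ p ∈ N0 ∧ p ξ = ξ ∧ ∀ a ∈ N0, a ξ = 0 → a * p = 0 := by
  set r : H →L[ℂ] H := (Submodule.span ℂ {ξ}).starProjection with hr
  have hrx : r ξ = ξ := by
    rw [hr, Submodule.starProjection_eq_self_iff]
    exact Submodule.mem_span_singleton_self ξ
  have har : ∀ a : H →L[ℂ] H, a ξ = 0 → a * r = 0 := by
    intro a ha
    ext v
    rw [mul_apply_eq_comp]
    obtain ⟨c, hc⟩ := Submodule.mem_span_singleton.1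
      (Submodule.starProjection_apply_mem (Submodule.span ℂ {ξ}) v)
    rw [hr, ← hc, map_smul, ha, smul_zero]
    rfl
  have hcs : ∀ t ∈ Set.centralizer N0, star t ∈ Set.centralizer N0 := by
    intro t ht a ha
    have := congrArg star (ht (star a) (hstar a ha))
    simp only [star_mul, star_star] at this
    exact this.symm
  obtain ⟨p, hp⟩ := KAx.rng {x : H →L[ℂ] H | ∃ t ∈ Set.centralizer N0, x = t * r}
  refine ⟨p, hp.1, ?_, ?_, ?_⟩
  · rw [hvN]
    intro t ht
    apply hp.comm
    · rintro _ ⟨s, hs, rfl⟩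
      exact hp.2.1 _ ⟨t * s, Set.mul_mem_centralizer ht hs, by rw [mul_assoc]⟩
    · rintro _ ⟨s, hs, rfl⟩
      exact hp.2.1 _ ⟨star t * s, Set.mul_mem_centralizer (hcs t ht) hs, by rw [mul_assoc]⟩
  · have := hp.2.1 r ⟨1, Set.one_mem_centralizer, by rw [one_mul]⟩
    have := congrArg (fun z : H →L[ℂ] H => z ξ) this
    simpa only [mul_apply_eq_comp, hrx] using this
  · intro a ha h0
    apply hp.2.2
    rintro _ ⟨t, ht, rfl⟩
    rw [← mul_assoc, ht a ha, mul_assoc, har a h0, mul_zero]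

theorem exists_sep (N0 : Set (H →L[ℂ] H)) (hvN : N0 = Set.centralizer (Set.centralizer N0))
    (hstar : ∀ a ∈ N0, star a ∈ N0)
    (hcd : ∀ P : Set (H →L[ℂ] H), P ⊆ N0 →
      (∀ p ∈ P, p ≠ 0 ∧ star p = p ∧ p * p = p) →
      (∀ p ∈ P, ∀ q ∈ P, p ≠ q → p * q = 0) → P.Countable) :
    ∃ Q : Set H, Q.Countable ∧ ∀ a ∈ N0, (∀ ξ ∈ Q, a ξ = 0) → a = 0 := by
  choose p hpj hpN hpx hpa using exists_cyc N0 hvN hstar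
  obtain ⟨Q, hQ⟩ := zorn_subset {Q : Set H | ∀ ξ ∈ Q, ξ ≠ 0 ∧ ∀ η ∈ Q, ξ ≠ η → p ξ * p η = 0} (by
    intro c hc hch
    refine ⟨⋃₀ c, ?_, fun s hs => Set.subset_sUnion_of_mem hs⟩
    rintro ξ ⟨s, hs, hξ⟩
    refine ⟨(hc hs ξ hξ).1, ?_⟩
    rintro η ⟨t, ht, hη⟩ hne
    rcases hch.total hs ht with h | h
    · exact (hc ht ξ (h hξ)).2 η hη hne
    · exact (hc hs ξ hξ).2 η (h hη) hne)
  have hQg := hQ.prop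
  have hp0 : ∀ ξ, ξ ≠ 0 → p ξ ≠ 0 := by
    intro ξ hξ h
    have := hpx ξ
    rw [h] at this
    exact hξ this.symm
  have hinj : Set.InjOn p Q := by
    intro ξ hξ η hη h
    by_contra hne
    have := (hQg ξ hξ).2 η hη hne
    rw [← h, (hpj ξ).2] at this
    exact hp0 ξ (hQg ξ hξ).1 this
  refine ⟨Q, ?_, ?_⟩
  · apply Set.countable_of_injective_of_countable_image hinj
    apply hcd
    · rintro _ ⟨ξ, _, rfl⟩
      exact hpN ξ
    · rintro _ ⟨ξ, hξ, rfl⟩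
      exact ⟨hp0 ξ (hQg ξ hξ).1, (hpj ξ).1, (hpj ξ).2⟩
    · rintro _ ⟨ξ, hξ, rfl⟩ _ ⟨η, hη, rfl⟩ hne
      exact (hQg ξ hξ).2 η hη (fun h => hne (by rw [h]))
  · intro a ha h0
    by_contra hane
    have hsa : star a ≠ 0 := by simpa using hane
    obtain ⟨v, hv⟩ : ∃ v, star a v ≠ 0 := by
      by_contra hcon
      push Not at hcon
      exact hsa (ContinuousLinearMap.ext hcon)
    set ζ := star a v with hζ
    have k1 : ∀ ξ ∈ Q, p ξ ζ = 0 := by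
      intro ξ hξ
      have := congrArg star (hpa ξ a ha (h0 ξ hξ))
      rw [star_mul, (hpj ξ).1, star_zero] at this
      have := congrArg (fun z : H →L[ℂ] H => z v) this
      simpa only [mul_apply_eq_comp, zero_apply] using this
    have k2 : ∀ ξ ∈ Q, p ξ * p ζ = 0 := fun ξ hξ => hpa ζ _ (hpN ξ) (k1 ξ hξ)
    have hζQ : ζ ∉ Q := by
      intro h
      have := k1 ζ h
      rw [hpx] at this
      exact hv this
    have hgood : insert ζ Q ∈ {Q : Set H | ∀ ξ ∈ Q, ξ ≠ 0 ∧ ∀ η ∈ Q, ξ ≠ η → p ξ * p η = 0} := by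
      rintro ξ (rfl | hξ)
      · refine ⟨hv, ?_⟩
        rintro η (rfl | hη) hne
        · exact absurd rfl hne
        · exact flp0 (hpj _).1 (hpj _).1 (k2 η hη)
      · refine ⟨(hQg ξ hξ).1, ?_⟩
        rintro η (rfl | hη) hne
        · exact k2 ξ hξ
        · exact (hQg ξ hξ).2 η hη hne
    exact hζQ (hQ.le_of_ge hgood (Set.subset_insert _ _) (Set.mem_insert _ _))

theorem countable_of_orth (P : Set (K →L[ℂ] K)) (hP : ∀ p ∈ P, Pj p)
    (ho : ∀ p ∈ P, ∀ q ∈ P, p ≠ q → p * q = 0) (η : K) : {p ∈ P | p η ≠ 0}.Countable := by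
  classical
  have hs : Summable (fun p : P => ‖p.1 η‖ ^ 2) := by
    apply summable_of_sum_le (c := ‖η‖ ^ 2) (fun p => by positivity)
    intro F
    set q : K →L[ℂ] K := ∑ p ∈ F, p.1 with hq
    have hqj : Pj q := by
      refine ⟨?_, ?_⟩
      · rw [hq, star_sum]
        exact Finset.sum_congr rfl (fun p _ => (hP p.1 p.2).1)
      · rw [hq, Finset.sum_mul_sum]
        refine Finset.sum_congr rfl (fun p hp => ?_)
        rw [Finset.sum_eq_single p]
        · exact (hP p.1 p.2).2
        · intro b _ hb
          exact ho p.1 p.2 b.1 b.2 (fun h => hb (Subtype.ext h.symm))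
        · intro h; exact absurd hp h
    have hn : ∀ p : K →L[ℂ] K, Pj p → ‖p η‖ ^ 2 = RCLike.re (inner ℂ η (p η)) := by
      intro p hp
      rw [← @inner_self_eq_norm_sq ℂ, star_inner, hp.1, ← mul_apply_eq_comp, hp.2]
    have e : ∑ p ∈ F, ‖p.1 η‖ ^ 2 = ‖q η‖ ^ 2 := by
      rw [hn q hqj, hq, sum_apply, inner_sum, map_sum]
      exact Finset.sum_congr rfl (fun p _ => hn p.1 (hP p.1 p.2))
    rw [e]
    have h1 := q.le_opNorm η
    have h2 := pj_norm_le hqj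
    have : ‖q η‖ ≤ ‖η‖ := h1.trans (mul_le_of_le_one_left (norm_nonneg _) h2)
    exact pow_le_pow_left₀ (norm_nonneg _) this 2
  have hc := hs.countable_support
  have := hc.image (Subtype.val)
  refine this.mono ?_
  rintro p ⟨hp, hne⟩
  exact ⟨⟨p, hp⟩, by simpa using hne, rfl⟩

end conc
end KD
namespace KD
section conc9

set_option linter.unusedSectionVars false

variable {H : Type*} [NormedAddCommGroup H] [InnerProductSpace ℂ H] [CompleteSpace H]
variable {K : Type*} [NormedAddCommGroup K] [InnerProductSpace ℂ K] [CompleteSpace K]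

/-- A decomposition of `K` as the orthogonal sum of `n` copies of `H`. -/
structure Dec (n : ℕ) (V : Fin n → H →L[ℂ] K) (W : Fin n → K →L[ℂ] H) : Prop where
  adj : ∀ i x y, inner ℂ (V i x) y = inner ℂ x (W i y)
  wv : ∀ i j x, W i (V j x) = if i = j then x else 0
  vw : ∀ x, ∑ i, V i (W i x) = x

variable {n : ℕ} {V : Fin n → H →L[ℂ] K} {W : Fin n → K →L[ℂ] H}

/-- entries of an operator -/
noncomputable def ent (V : Fin n → H →L[ℂ] K) (W : Fin n → K →L[ℂ] H) (x : K →L[ℂ] K) :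
    Matrix (Fin n) (Fin n) (H →L[ℂ] H) := fun i j => W i ∘L x ∘L V j

/-- operator of a matrix -/
noncomputable def opr (V : Fin n → H →L[ℂ] K) (W : Fin n → K →L[ℂ] H)
    (a : Matrix (Fin n) (Fin n) (H →L[ℂ] H)) : K →L[ℂ] K := ∑ i, ∑ j, V i ∘L a i j ∘L W j

theorem ent_apply (x : K →L[ℂ] K) (i j : Fin n) (h : H) : ent V W x i j h = W i (x (V j h)) := rfl

theorem opr_apply (a : Matrix (Fin n) (Fin n) (H →L[ℂ] H)) (k : K) :
    opr V W a k = ∑ i, ∑ j, V i (a i j (W j k)) := by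
  simp [opr, sum_apply]

theorem Dec.ent_inj (D : Dec n V W) {x y : K →L[ℂ] K} (h : ent V W x = ent V W y) : x = y := by
  ext k
  have hx : ∀ x : K →L[ℂ] K, x k = ∑ i, ∑ j, V i (ent V W x i j (W j k)) := by
    intro x
    simp only [ent_apply, ← map_sum, D.vw]
  rw [hx x, hx y, h]

theorem Dec.ent_opr (D : Dec n V W) (a : Matrix (Fin n) (Fin n) (H →L[ℂ] H)) :
    ent V W (opr V W a) = a := by
  ext i j h
  simp only [ent_apply, opr_apply, map_sum, D.wv]
  rw [Finset.sum_eq_single i]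
  · rw [Finset.sum_eq_single j]
    · simp
    · intro b _ hb
      simp [hb]
    · simp
  · intro b _ hb
    simp [hb.symm]
  · simp

theorem Dec.ent_mul (D : Dec n V W) (x y : K →L[ℂ] K) :
    ent V W (x * y) = ent V W x * ent V W y := by
  ext i j h
  simp only [ent_apply, Matrix.mul_apply, sum_apply, mul_apply_eq_comp, ← map_sum, D.vw]

theorem Dec.ent_star (D : Dec n V W) (x : K →L[ℂ] K) :
    ent V W (star x) = star (ent V W x) := by
  ext i j h
  rw [Matrix.star_apply]
  refine ext_inner_left ℂ (fun v => ?_)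
  rw [ent_apply, ← D.adj, ← star_inner, ← star_inner, ent_apply]
  rw [← inner_conj_symm, D.adj, inner_conj_symm]

theorem Dec.ent_one (D : Dec n V W) : ent V W (1 : K →L[ℂ] K) = 1 := by
  ext i j h
  rw [ent_apply]
  change W i (V j h) = _
  rw [D.wv, Matrix.one_apply]
  split_ifs <;> rfl

/-- diagonal amplification -/
noncomputable def amp (V : Fin n → H →L[ℂ] K) (W : Fin n → K →L[ℂ] H) (t : H →L[ℂ] H) :
    K →L[ℂ] K := opr V W (Matrix.diagonal (fun _ => t))

theorem Dec.ent_amp (D : Dec n V W) (t : H →L[ℂ] H) :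
    ent V W (amp V W t) = Matrix.diagonal (fun _ => t) := D.ent_opr _

/-- the operator algebra -/
noncomputable def bigN (V : Fin n → H →L[ℂ] K) (W : Fin n → K →L[ℂ] H) (N0 : Set (H →L[ℂ] H)) :
    Subring (K →L[ℂ] K) := Subring.centralizer (amp V W '' Set.centralizer N0)

theorem Dec.mem_bigN (D : Dec n V W) {N0 : Set (H →L[ℂ] H)}
    (hvN : N0 = Set.centralizer (Set.centralizer N0)) (x : K →L[ℂ] K) :
    x ∈ bigN V W N0 ↔ ∀ i j, ent V W x i j ∈ N0 := by
  rw [bigN, Subring.mem_centralizer_iff]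
  constructor
  · intro h i j
    rw [hvN]
    intro t ht
    have := congrArg (ent V W) (h _ ⟨t, ht, rfl⟩)
    rw [D.ent_mul, D.ent_mul, D.ent_amp] at this
    have := congrFun (congrFun this i) j
    rwa [Matrix.diagonal_mul, Matrix.mul_diagonal] at this
  · rintro h _ ⟨t, ht, rfl⟩
    apply D.ent_inj
    rw [D.ent_mul, D.ent_mul, D.ent_amp]
    ext1 i j
    rw [Matrix.diagonal_mul, Matrix.mul_diagonal]
    exact (ht _ (h i j)).symm

theorem Dec.isVN (D : Dec n V W) {N0 : Set (H →L[ℂ] H)}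
    (hvN : N0 = Set.centralizer (Set.centralizer N0)) (hstar : ∀ a ∈ N0, star a ∈ N0) :
    IsVN (bigN V W N0) := by
  refine ⟨?_, ?_⟩
  · intro x hx
    rw [D.mem_bigN hvN] at hx ⊢
    intro i j
    rw [D.ent_star, Matrix.star_apply]
    exact hstar _ (hx j i)
  · intro x hx
    rw [bigN, Subring.mem_centralizer_iff]
    intro t ht
    apply hx
    intro y hy
    exact (Subring.mem_centralizer_iff.1 hy) t ht

theorem Dec.main (D : Dec n V W) (N0 : Set (H →L[ℂ] H))
    (hvN : N0 = Set.centralizer (Set.centralizer N0))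
    (hstar : ∀ a ∈ N0, star a ∈ N0)
    (hcd : ∀ P : Set (H →L[ℂ] H), P ⊆ N0 →
      (∀ p ∈ P, p ≠ 0 ∧ star p = p ∧ p * p = p) →
      (∀ p ∈ P, ∀ q ∈ P, p ≠ q → p * q = 0) → P.Countable)
    (S : Set (Matrix (Fin n) (Fin n) (H →L[ℂ] H)))
    (hSentries : ∀ a ∈ S, ∀ i j, a i j ∈ N0)
    (hSstar : ∀ a ∈ S, star a ∈ S)
    (hScomm : ∀ a ∈ S, ∀ b ∈ S, a * b = b * a) :
    ∃ u : Matrix (Fin n) (Fin n) (H →L[ℂ] H),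
      (∀ i j, u i j ∈ N0) ∧ u ∈ unitary (Matrix (Fin n) (Fin n) (H →L[ℂ] H)) ∧
      ∀ a ∈ S, ∀ i j, i ≠ j → (u * a * star u) i j = 0 := by
  have hN := D.isVN hvN hstar
  have hzero : (0 : H →L[ℂ] H) ∈ N0 := by rw [hvN]; exact Set.zero_mem_centralizer
  have hone : (1 : H →L[ℂ] H) ∈ N0 := by rw [hvN]; exact Set.one_mem_centralizer
  have hcd' : ∀ P : Set (K →L[ℂ] K), (∀ p ∈ P, Pj p ∧ p ∈ bigN V W N0 ∧ p ≠ 0) →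
      (∀ p ∈ P, ∀ q ∈ P, p ≠ q → p * q = 0) → P.Countable := by
    intro P hP ho
    obtain ⟨Q, hQ, hsep⟩ := exists_sep N0 hvN hstar hcd
    have hc : (⋃ i : Fin n, ⋃ ξ ∈ Q, {p ∈ P | p (V i ξ) ≠ 0}).Countable :=
      Set.countable_iUnion (fun i => hQ.biUnion (fun ξ _ =>
        countable_of_orth P (fun p hp => (hP p hp).1) ho (V i ξ)))
    refine hc.mono ?_
    intro p hp
    by_contra hcon
    apply (hP p hp).2.2
    apply D.ent_inj
    ext1 i j
    have h0 : ent V W (0 : K →L[ℂ] K) i j = 0 := by ext v; simp [ent_apply]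
    rw [h0]
    apply hsep _ ((D.mem_bigN hvN p).1 (hP p hp).2.1 i j)
    intro ξ hξ
    rw [ent_apply]
    have : p (V j ξ) = 0 := by
      by_contra hne
      exact hcon (Set.mem_iUnion.2 ⟨j, Set.mem_iUnion₂.2 ⟨ξ, hξ, hp, hne⟩⟩)
    rw [this, map_zero]
  have ho_mem : ∀ a : Matrix (Fin n) (Fin n) (H →L[ℂ] H), (∀ i j, a i j ∈ N0) →
      opr V W a ∈ bigN V W N0 := by
    intro a ha
    rw [D.mem_bigN hvN, D.ent_opr]
    exact ha
  have ho_star : ∀ a, star (opr V W a) = opr V W (star a) := by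
    intro a
    apply D.ent_inj
    rw [D.ent_star, D.ent_opr, D.ent_opr]
  have ho_mul : ∀ a b, opr V W a * opr V W b = opr V W (a * b) := by
    intro a b
    apply D.ent_inj
    rw [D.ent_mul, D.ent_opr, D.ent_opr, D.ent_opr]
  have ho_one : opr V W (1 : Matrix (Fin n) (Fin n) (H →L[ℂ] H)) = 1 := by
    apply D.ent_inj
    rw [D.ent_opr, D.ent_one]
  have ho_zero : opr V W (0 : Matrix (Fin n) (Fin n) (H →L[ℂ] H)) = 0 := by
    ext k; simp [opr_apply]
  obtain ⟨A, C, hSA⟩ := exists_masa hN hcd' (opr V W '' S)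
    (by rintro _ ⟨a, ha, rfl⟩; exact ho_mem a (hSentries a ha))
    (by rintro _ ⟨a, ha, rfl⟩; exact ⟨star a, hSstar a ha, (ho_star a).symm⟩)
    (by rintro _ ⟨a, ha, rfl⟩ _ ⟨b, hb, rfl⟩; rw [ho_mul, ho_mul, hScomm a ha b hb])
  let E : Fin n → Fin n → Matrix (Fin n) (Fin n) (H →L[ℂ] H) := fun i j => Matrix.single i j 1
  have hEmem : ∀ i j, opr V W (E i j) ∈ bigN V W N0 := by
    intro i j
    apply ho_mem
    intro k l
    simp only [E, Matrix.single_apply]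
    split_ifs
    · exact hone
    · exact hzero
  have hEstar : ∀ i j, star (E i j) = E j i := by
    intro i j
    simp [E, Matrix.star_eq_conjTranspose, Matrix.conjTranspose_single]
  have hEE : ∀ i j k, E i j * E j k = E i k := by
    intro i j k
    simp [E]
  have hE0 : ∀ i j k l, j ≠ k → E i j * E k l = 0 := by
    intro i j k l h
    exact Matrix.single_mul_single_of_ne _ _ _ _ h _
  obtain ⟨u, hu, hu1, hu2, huA⟩ := global C (fun i => opr V W (E i i))
    (fun i => ⟨by rw [ho_star, hEstar], by rw [ho_mul, hEE]⟩)
    (fun i => hEmem i i)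
    (fun i j h => by rw [ho_mul, hE0 _ _ _ _ h, ho_zero])
    (by
      apply D.ent_inj
      rw [D.ent_one]
      ext1 i j
      have : ent V W (∑ k, opr V W (E k k)) = ∑ k, E k k := by
        ext1 i j
        ext1 v
        rw [ent_apply, sum_apply, map_sum, Matrix.sum_apply, sum_apply]
        refine Finset.sum_congr rfl (fun k _ => ?_)
        rw [← ent_apply, D.ent_opr]
      rw [this, Matrix.sum_apply, Matrix.one_apply]
      simp only [E, Matrix.single_apply]
      by_cases h : i = j
      · subst h; simp
      · rw [if_neg h]
        apply Finset.sum_eq_zero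
        intro k _
        rw [if_neg]
        rintro ⟨rfl, h'⟩
        exact h h')
    (fun i j => ⟨opr V W (E j i), hEmem j i, by rw [ho_star, hEstar, ho_mul, hEE],
      by rw [ho_mul, hEE]⟩)
  refine ⟨ent V W u, (D.mem_bigN hvN u).1 hu, ?_, ?_⟩
  · rw [Unitary.mem_iff, ← D.ent_star, ← D.ent_mul, ← D.ent_mul, hu1, hu2, D.ent_one]
    exact ⟨rfl, rfl⟩
  · intro a ha i j hij
    have hc := C.hAc _ (huA j) _ (hSA _ ⟨a, ha, rfl⟩)
    set x := opr V W a with hx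
    set y := u * x * star u with hy
    set e := opr V W (E j j) with he
    have hye : y * e = e * y := by
      calc y * e = u * (x * (star u * e * u)) * star u := by
            rw [hy]
            simp only [mul_assoc, hu2, mul_one]
        _ = u * ((star u * e * u) * x) * star u := by rw [hc]
        _ = e * y := by
            rw [hy]
            simp only [mul_assoc, asc hu2, one_mul]
    have h1 : ent V W y * E j j = E j j * ent V W y := by
      have := congrArg (ent V W) hye
      rwa [D.ent_mul y e, D.ent_mul e y, he, D.ent_opr] at this
    have h2 := congrFun (congrFun h1 i) j
    have h3 : ent V W u * a * star (ent V W u) = ent V W y := by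
      rw [hy, D.ent_mul, D.ent_mul, D.ent_star, hx, D.ent_opr]
    rw [h3]
    simpa [E, Matrix.mul_apply, Matrix.single_apply, hij.symm, hij] using h2

theorem exists_dec (n : ℕ) : ∃ (V : Fin n → H →L[ℂ] PiLp 2 (fun _ : Fin n => H))
    (W : Fin n → PiLp 2 (fun _ : Fin n => H) →L[ℂ] H), Dec n V W := by
  refine ⟨fun i => ((PiLp.continuousLinearEquiv 2 ℂ (fun _ : Fin n => H)).symm :
      (Fin n → H) →L[ℂ] PiLp 2 (fun _ : Fin n => H)) ∘L
      ContinuousLinearMap.single ℂ (fun _ : Fin n => H) i,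
    fun i => PiLp.proj 2 (fun _ : Fin n => H) i, ?_, ?_, ?_⟩
  · intro i x y
    rw [PiLp.inner_apply, Finset.sum_eq_single i]
    · simp
    · intro j _ hj
      simp [hj]
    · simp
  · intro i j x
    by_cases h : i = j
    · subst h; simp
    · simp [h]
  · intro x
    ext j
    simp [Pi.single_apply]

end conc9
end KD

/-- Kadison's diagonalization: let N₀ be a countably
decomposable von Neumann algebra (realized on a Hilbert space ℋ as a
star-closed set equal to its double commutant, such that any family of
pairwise orthogonal nonzero projections in it is countable), N = M_n(N₀),
and S an abelian self-adjoint subset of N.  Then there is a unitary u ∈ N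
with u a u⁻¹ diagonal for every a ∈ S. -/
theorem stmt_15 (ℋ : Type*) [NormedAddCommGroup ℋ] [InnerProductSpace ℂ ℋ]
    [CompleteSpace ℋ] (N0 : Set (ℋ →L[ℂ] ℋ))
    (hvN : N0 = Set.centralizer (Set.centralizer N0))
    (hstar : ∀ a ∈ N0, star a ∈ N0)
    (hcd : ∀ P : Set (ℋ →L[ℂ] ℋ), P ⊆ N0 →
      (∀ p ∈ P, p ≠ 0 ∧ star p = p ∧ p * p = p) →
      (∀ p ∈ P, ∀ q ∈ P, p ≠ q → p * q = 0) → P.Countable)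
    (n : ℕ) (hn : 0 < n)
    (S : Set (Matrix (Fin n) (Fin n) (ℋ →L[ℂ] ℋ)))
    (hSentries : ∀ a ∈ S, ∀ i j, a i j ∈ N0)
    (hSstar : ∀ a ∈ S, star a ∈ S)
    (hScomm : ∀ a ∈ S, ∀ b ∈ S, a * b = b * a) :
    ∃ u : Matrix (Fin n) (Fin n) (ℋ →L[ℂ] ℋ),
      (∀ i j, u i j ∈ N0) ∧ u ∈ unitary (Matrix (Fin n) (Fin n) (ℋ →L[ℂ] ℋ)) ∧
      ∀ a ∈ S, ∀ i j, i ≠ j → (u * a * star u) i j = 0 := by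
  obtain ⟨V, W, D⟩ := KD.exists_dec (H := ℋ) n
  exact D.main N0 hvN hstar hcd S hSentries hSstar hScomm
end
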